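/- Let S = {(0,1),(0,2),(0,4),(0,5),(1,1),(1,4),(1,5),(2,0),(2,1),(2,4),(3,2),(3,3),(3,5),(4,2),(5,0),(5,5)} ⊆ ℕ×ℕ. The generalised toric code C_S over the field with 8 elements has minimum distance exactly 24: every nonzero codeword of C_S has Hamming weight at least 24, and some codeword of C_S has Hamming weight exactly 24. -/

import Mathlib

/-- `F8` is the finite field with 8 elements, `GF(2,3)`. -/
abbrev F8 : Type := GaloisField 2 3

/-- The evaluation vector of an exponent pair `(a, b)`: the function
`F8ˣ × F8ˣ → F8` sending `(x, y)` to `x ^ a * y ^ b`. -/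
noncomputable def evalVec (ab : ℕ × ℕ) : F8ˣ × F8ˣ → F8 :=
  fun xy => (xy.1 : F8) ^ ab.1 * (xy.2 : F8) ^ ab.2

/-- The Hamming weight of a vector `c : F8ˣ × F8ˣ → F8`: the number of
coordinates at which `c` is nonzero. -/
noncomputable def hammingWeight (c : F8ˣ × F8ˣ → F8) : ℕ :=
  Nat.card {p : F8ˣ × F8ˣ // c p ≠ 0}

/-- The set of exponent vectors. -/
def S : Set (ℕ × ℕ) := {(0,1),(0,2),(0,4),(0,5),(1,1),(1,4),(1,5),(2,0),(2,1),(2,4),(3,2),(3,3),(3,5),(4,2),(5,0),(5,5)}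

/-! ### Linear algebra over `F₂` on natural numbers (bitwise xor) -/

/-- `lin t x` is the xor of the entries `t[k]` over the set bits `k` of `x`. -/
def lin : List Nat → Nat → Nat
  | [], _ => 0
  | g :: t, x => Nat.xor (Nat.mul (Nat.mod x 2) g) (lin t (Nat.div x 2))

/-- Additive maps for xor. -/
def XH (f : Nat → Nat) : Prop := ∀ a b, f (a ^^^ b) = f a ^^^ f b

theorem xor_bit_mul (g a b : Nat) : ((a ^^^ b) % 2) * g = (a % 2 * g) ^^^ (b % 2 * g) := by
  have h : (a ^^^ b) % 2 = (a % 2) ^^^ (b % 2) := by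
    simpa using Nat.xor_mod_two_pow (a := a) (b := b) (n := 1)
  rw [h]
  rcases Nat.mod_two_eq_zero_or_one a with ha | ha <;>
    rcases Nat.mod_two_eq_zero_or_one b with hb | hb <;> simp [ha, hb]

theorem xor_div_two (a b : Nat) : (a ^^^ b) / 2 = (a / 2) ^^^ (b / 2) := by
  have := Nat.shiftRight_xor_distrib (a := a) (b := b) (i := 1)
  simpa [Nat.shiftRight_eq_div_pow] using this

theorem lin_cons (g : Nat) (t : List Nat) (x : Nat) :
    lin (g :: t) x = (x % 2 * g) ^^^ lin t (x / 2) := rfl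

theorem lin_nil (x : Nat) : lin [] x = 0 := rfl

theorem XH_lin (t : List Nat) : XH (lin t) := by
  induction t with
  | nil => intro a b; simp [lin]
  | cons g t ih =>
    intro a b
    simp only [lin_cons, xor_bit_mul, xor_div_two, ih _ _]
    ac_rfl

theorem XH.zero {f : Nat → Nat} (h : XH f) : f 0 = 0 := by
  have := h 0 0
  simpa using this

theorem XH.comp {f g : Nat → Nat} (hf : XH f) (hg : XH g) : XH (fun x => f (g x)) := by
  intro a b; simp only [hg a b, hf _ _]

theorem XH.xor {f g : Nat → Nat} (hf : XH f) (hg : XH g) : XH (fun x => f x ^^^ g x) := by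
  intro a b; simp only [hg a b, hf a b]; ac_rfl

theorem XH_shr (k : Nat) : XH (fun x => x >>> k) := fun _ _ => Nat.shiftRight_xor_distrib
theorem XH_shl (k : Nat) : XH (fun x => x <<< k) := fun _ _ => Nat.shiftLeft_xor_distrib
theorem XH_mod (k : Nat) : XH (fun x => x % 2 ^ k) := fun _ _ => Nat.xor_mod_two_pow
theorem XH_id : XH (fun x => x) := fun _ _ => rfl
theorem XH_const : XH (fun _ => 0) := fun _ _ => by simp

/-- Two additive maps agree at `x` if they agree on the powers of two occurring in `x`. -/
theorem XH.ext {f g : Nat → Nat} (hf : XH f) (hg : XH g) :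
    ∀ (n : Nat) (x : Nat), x < 2 ^ n → (∀ k < n, x.testBit k = true → f (2 ^ k) = g (2 ^ k)) →
      f x = g x := by
  intro n
  induction n with
  | zero =>
    intro x hx _
    have : x = 0 := by omega
    rw [this, hf.zero, hg.zero]
  | succ n ih =>
    intro x hx h
    by_cases hb : x.testBit n = true
    · have hlt : x ^^^ 2 ^ n < 2 ^ n := by
        apply Nat.lt_pow_two_of_testBit
        intro i hi
        rw [Nat.testBit_xor, Nat.testBit_two_pow]
        rcases Nat.eq_or_lt_of_le hi with h1 | h1
        · subst h1; simp [hb]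
        · have : x.testBit i = false := Nat.testBit_lt_two_pow (lt_of_lt_of_le hx (Nat.pow_le_pow_right (by norm_num) h1))
          simp [this]; omega
      have h2 := ih _ hlt (by
        intro k hk hkb
        apply h k (by omega)
        rw [Nat.testBit_xor, Nat.testBit_two_pow] at hkb
        have : ¬ n = k := by omega
        simpa [this] using hkb)
      have hx2 : x = (x ^^^ 2 ^ n) ^^^ 2 ^ n := by rw [Nat.xor_assoc, Nat.xor_self, Nat.xor_zero]
      rw [hx2, hf, hg, h2, h n (by omega) hb]
    · have hlt : x < 2 ^ n := by
        apply Nat.lt_pow_two_of_testBit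
        intro i hi
        rcases Nat.eq_or_lt_of_le hi with h1 | h1
        · subst h1; simpa using hb
        · exact Nat.testBit_lt_two_pow (lt_of_lt_of_le hx (Nat.pow_le_pow_right (by norm_num) h1))
      exact ih x hlt (fun k hk => h k (by omega))

theorem XH.ext_all {f g : Nat → Nat} (hf : XH f) (hg : XH g) (n : Nat)
    (h : ∀ k < n, f (2 ^ k) = g (2 ^ k)) (x : Nat) (hx : x < 2 ^ n) : f x = g x :=
  hf.ext hg n x hx (fun k hk _ => h k hk)

theorem lin_lt (n : Nat) (t : List Nat) (h : ∀ g ∈ t, g < 2 ^ n) (x : Nat) : lin t x < 2 ^ n := by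
  induction t generalizing x with
  | nil => simp [lin]
  | cons g t ih =>
    rw [lin_cons]
    apply Nat.xor_lt_two_pow
    · have := h g (by simp)
      rcases Nat.mod_two_eq_zero_or_one x with ha | ha <;> simp [ha, this]
    · exact ih (fun g hg => h g (by simp [hg])) _

theorem lin_append (s t : List Nat) (x : Nat) :
    lin (s ++ t) x = lin s x ^^^ lin t (x / 2 ^ s.length) := by
  induction s generalizing x with
  | nil => simp [lin]
  | cons g s ih =>
    simp only [List.cons_append, lin_cons, ih, List.length_cons, Nat.xor_assoc, Nat.pow_succ',
      Nat.div_div_eq_div_mul]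

theorem lin_mod (s : List Nat) (x : Nat) : lin s x = lin s (x % 2 ^ s.length) := by
  induction s generalizing x with
  | nil => simp [lin]
  | cons g s ih =>
    simp only [lin_cons, List.length_cons]
    rw [ih (x / 2), ih (x % 2 ^ (s.length + 1) / 2)]
    have h1 : x % 2 ^ (s.length + 1) % 2 = x % 2 := by
      rw [Nat.mod_mod_of_dvd]; exact dvd_pow_self 2 (by omega)
    have h2 : x % 2 ^ (s.length + 1) / 2 = x / 2 % 2 ^ s.length := by
      rw [Nat.pow_succ', Nat.mod_mul_right_div_self]
    rw [h1, h2, Nat.mod_mod]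

/-! ### Lanes -/

/-- The `l`-th block of `w` bits. -/
def lane (w l X : Nat) : Nat := (X >>> (w * l)) % 2 ^ w

theorem lane_zero (w X : Nat) : lane w 0 X = X % 2 ^ w := by simp [lane]

theorem lane_succ (w l X : Nat) : lane w (l + 1) X = lane w l (X / 2 ^ w) := by
  simp only [lane, Nat.shiftRight_eq_div_pow, Nat.div_div_eq_div_mul, ← Nat.pow_add]
  congr 3; ring

theorem testBit_lane (w l X i : Nat) :
    (lane w l X).testBit i = (decide (i < w) && X.testBit (w * l + i)) := by
  simp [lane, Nat.testBit_mod_two_pow, Nat.testBit_shiftRight]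

theorem lane_lt (w l X : Nat) : lane w l X < 2 ^ w := Nat.mod_lt _ (by positivity)

theorem lane_of_zero (w l : Nat) : lane w l 0 = 0 := by simp [lane]

theorem lane_add (w : Nat) (l X Y : Nat) (h : ∀ l, lane w l X + lane w l Y < 2 ^ w) :
    lane w l (X + Y) = lane w l X + lane w l Y := by
  have hp : 0 < 2 ^ w := by positivity
  induction l generalizing X Y with
  | zero =>
    have := h 0
    simp only [lane_zero] at *
    rw [Nat.add_mod, Nat.mod_eq_of_lt this]
  | succ l ih =>
    have h0 := h 0
    simp only [lane_succ]
    rw [← ih]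
    · congr 1
      simp only [lane_zero] at h0
      rw [Nat.add_div hp, if_neg (by omega), Nat.add_zero]
    · intro l
      simpa only [lane_succ] using h (l + 1)

theorem lane_mul (w : Nat) (g l X : Nat) (h : ∀ l, g * lane w l X < 2 ^ w) :
    lane w l (g * X) = g * lane w l X := by
  have hp : 0 < 2 ^ w := by positivity
  have h0 := h 0
  rw [lane_zero] at h0
  have hX : g * X = g * (X % 2 ^ w) + 2 ^ w * (g * (X / 2 ^ w)) := by
    conv_lhs => rw [← Nat.mod_add_div X (2 ^ w)]
    ring
  induction l generalizing X with
  | zero =>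
    simp only [lane_zero]
    rw [hX, Nat.add_mul_mod_self_left, Nat.mod_eq_of_lt h0]
  | succ l ih =>
    simp only [lane_succ]
    have : g * X / 2 ^ w = g * (X / 2 ^ w) := by
      rw [hX, Nat.add_mul_div_left _ _ hp, Nat.div_eq_of_lt h0, Nat.zero_add]
    rw [this]
    apply ih
    · intro l; simpa only [lane_succ] using h (l + 1)
    · simpa only [lane_zero, lane_succ] using h 1
    · conv_lhs => rw [← Nat.mod_add_div (X / 2 ^ w) (2 ^ w)]
      ring

theorem lane_shl (w l k X : Nat) :
    lane w l (X <<< (w * k)) = if l < k then 0 else lane w (l - k) X := by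
  apply Nat.eq_of_testBit_eq
  intro i
  split_ifs with h
  · simp only [testBit_lane, Nat.testBit_shiftLeft, Nat.zero_testBit]
    by_cases hi : i < w
    · have : w * l + w ≤ w * k := by
        calc w * l + w = w * (l + 1) := by ring
          _ ≤ w * k := Nat.mul_le_mul_left _ h
      have : ¬ (w * l + i ≥ w * k) := by omega
      simp [this]
    · simp [hi]
  · simp only [testBit_lane, Nat.testBit_shiftLeft]
    have h1 : w * l = w * k + w * (l - k) := by rw [← Nat.mul_add]; congr 1; omega
    have h2 : w * l + i ≥ w * k := by omega
    have h3 : w * l + i - w * k = w * (l - k) + i := by omega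
    simp [h2, h3]

theorem lane_lane (w c q r X : Nat) (h : r < c) :
    lane w r (lane (w * c) q X) = lane w (q * c + r) X := by
  apply Nat.eq_of_testBit_eq
  intro i
  simp only [testBit_lane]
  by_cases hi : i < w
  · have h1 : w * r + i < w * c := by
      calc w * r + i < w * r + w := by omega
        _ = w * (r + 1) := by ring
        _ ≤ w * c := Nat.mul_le_mul_left _ h
    have h2 : w * c * q + (w * r + i) = w * (q * c + r) + i := by ring
    simp [h1, h2]
  · simp [hi]

theorem lane_mod (w l N X : Nat) :
    lane w l (X % 2 ^ (w * N)) = if l < N then lane w l X else 0 := by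
  apply Nat.eq_of_testBit_eq
  intro i
  split_ifs with h
  · simp only [testBit_lane, Nat.testBit_mod_two_pow]
    by_cases hi : i < w
    · have h1 : w * l + i < w * N := by
        calc w * l + i < w * l + w := by omega
          _ = w * (l + 1) := by ring
          _ ≤ w * N := Nat.mul_le_mul_left _ h
      simp [h1]
    · simp [hi]
  · simp only [testBit_lane, Nat.testBit_mod_two_pow, Nat.zero_testBit]
    have h1 : w * N ≤ w * l := Nat.mul_le_mul_left _ (by omega)
    have : ¬ (w * l + i < w * N) := by omega
    simp [this]

theorem lane_xor (w l X Y : Nat) : lane w l (X ^^^ Y) = lane w l X ^^^ lane w l Y := by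
  apply Nat.eq_of_testBit_eq
  intro i
  simp only [testBit_lane, Nat.testBit_xor]
  cases decide (i < w) <;> simp

theorem lane_or (w l X Y : Nat) : lane w l (X ||| Y) = lane w l X ||| lane w l Y := by
  apply Nat.eq_of_testBit_eq
  intro i
  simp only [testBit_lane, Nat.testBit_or]
  cases decide (i < w) <;> simp

theorem lane_and (w l X Y : Nat) : lane w l (X &&& Y) = lane w l X &&& lane w l Y := by
  apply Nat.eq_of_testBit_eq
  intro i
  simp only [testBit_lane, Nat.testBit_and]
  cases decide (i < w) <;> simp

/-! ### The bit-parallel weight engine -/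

/-- `2^n` copies of the `w`-bit block `x`. -/
def rep (w x : Nat) : Nat → Nat
  | 0 => x
  | n + 1 => Nat.add (rep w x n) (Nat.shiftLeft (rep w x n) (Nat.mul w (Nat.pow 2 n)))

/-- Lane indicator (64-bit lanes) of bit `k` of the lane number, `2^n` lanes. -/
def bmask (n k : Nat) : Nat :=
  rep (Nat.mul 64 (Nat.pow 2 (Nat.succ k)))
    (Nat.shiftLeft (rep 64 1 k) (Nat.mul 64 (Nat.pow 2 k))) (Nat.sub n (Nat.succ k))

def trunc (n x : Nat) : Nat := Nat.mod x (Nat.pow 2 (Nat.mul 64 n))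

/-- Bit plane `d` of a packed word of 49 digits. -/
def pl (d w : Nat) : Nat := Nat.mod (Nat.shiftRight w (Nat.mul 49 d)) 562949953421312

def bro (d : Nat) : List Nat → List Nat → Nat
  | g :: gs, M :: Ms => Nat.xor (Nat.mul (pl d g) M) (bro d gs Ms)
  | _, _ => 0

def cat (L : Nat) : List Nat → Nat
  | [] => 0
  | x :: xs => Nat.add x (Nat.shiftLeft (cat L xs) L)

def stage (w M Y : Nat) : Nat := Nat.add (Nat.land Y M) (Nat.land (Nat.shiftRight Y w) M)

def fin (A B C Y : Nat) : Bool :=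
  Nat.beq (Nat.land (Nat.add Y A) C) (Nat.land (Nat.add Y B) C)

def pmask (n w j : Nat) : Nat := rep (Nat.mul 2 w) (Nat.sub (Nat.pow 2 w) 1) (Nat.add n j)

def check (n O Y : Nat) : Bool :=
  fin (Nat.mul 40 O) (Nat.mul 63 O) (Nat.mul 64 O)
   (stage 32 (pmask n 32 0) (stage 16 (pmask n 16 1) (stage 8 (pmask n 8 2) (stage 4 (pmask n 4 3)
     (stage 2 (pmask n 2 4) (stage 1 (pmask n 1 5) Y))))))

def lmasks (n m : Nat) : List Nat := rep 64 1 n :: (List.range m).map (bmask n)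

def fam (m : Nat) (cs : List (List Nat)) (d : Nat) : Nat :=
  cat (Nat.mul 64 (Nat.pow 2 m)) (cs.map fun c => trunc (Nat.pow 2 m) (bro d c (lmasks m m)))

def tms (n k m : Nat) : List Nat := (lmasks n m).map (trunc (Nat.mul k (Nat.pow 2 m)))

def run2 (n O X0 X1 X2 Y0 Y1 Y2 : Nat) : Bool :=
  check n O (Nat.lor (Nat.xor X0 Y0) (Nat.lor (Nat.xor X1 Y1) (Nat.xor X2 Y2)))

def run1 (n O : Nat) (Ms : List Nat) (bs : List (List Nat)) (X0 X1 X2 : Nat) : Bool :=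
  bs.all fun b => run2 n O X0 X1 X2 (bro 0 b Ms) (bro 1 b Ms) (bro 2 b Ms)

def run0 (n O : Nat) (Ms : List Nat) (X0 X1 X2 : Nat) (as bs : List (List Nat)) : Bool :=
  as.all fun a =>
    run1 n O Ms bs (Nat.xor X0 (bro 0 a Ms)) (Nat.xor X1 (bro 1 a Ms)) (Nat.xor X2 (bro 2 a Ms))

def run (n m : Nat) (cs as bs : List (List Nat)) : Bool :=
  run0 n (trunc (Nat.mul cs.length (Nat.pow 2 m)) (rep 64 1 n)) (tms n cs.length m)
    (fam m cs 0) (fam m cs 1) (fam m cs 2) as bs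

/-! Soundness of the engine. -/

theorem lane_rep (w x : Nat) (hx : x < 2 ^ w) (n l : Nat) :
    lane w l (rep w x n) = if l < 2 ^ n then x else 0 := by
  induction n generalizing l with
  | zero =>
    cases l with
    | zero => simp [rep, lane_zero, Nat.mod_eq_of_lt hx]
    | succ l => simp [rep, lane_succ, Nat.div_eq_of_lt hx, lane_of_zero]
  | succ n ih =>
    have e : rep w x (n + 1) = rep w x n + (rep w x n) <<< (w * 2 ^ n) := rfl
    have key : ∀ l, lane w l (rep w x n) + lane w l ((rep w x n) <<< (w * 2 ^ n))
        = if l < 2 ^ (n + 1) then x else 0 := by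
      intro l
      rw [lane_shl, ih, ih, Nat.pow_succ]
      by_cases h1 : l < 2 ^ n
      · simp [h1]; intro; omega
      · by_cases h2 : l < 2 ^ n * 2
        · have : l - 2 ^ n < 2 ^ n := by omega
          simp [h1, h2, this]
        · have : ¬ l - 2 ^ n < 2 ^ n := by omega
          simp [h1, h2, this]
    rw [e, lane_add, key]
    intro l
    rw [key]
    split_ifs
    · exact hx
    · positivity

theorem lane_bmask (n k : Nat) (hk : k < n) (l : Nat) :
    lane 64 l (bmask n k) = if l < 2 ^ n ∧ l.testBit k then 1 else 0 := by
  have e : bmask n k = rep (64 * 2 ^ (k + 1)) ((rep 64 1 k) <<< (64 * 2 ^ k)) (n - (k + 1)) := rfl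
  have hr : l % 2 ^ (k + 1) < 2 ^ (k + 1) := Nat.mod_lt _ (by positivity)
  have hl : l = l / 2 ^ (k + 1) * 2 ^ (k + 1) + l % 2 ^ (k + 1) := by
    rw [Nat.mul_comm]; exact (Nat.div_add_mod _ _).symm
  have hbit : l.testBit k = decide (2 ^ k ≤ l % 2 ^ (k + 1)) := by
    have h1 : l.testBit k = (l % 2 ^ (k + 1)).testBit k := by simp [Nat.testBit_mod_two_pow]
    rw [h1]
    by_cases h2 : 2 ^ k ≤ l % 2 ^ (k + 1)
    · rw [Nat.testBit_of_two_pow_le_and_two_pow_add_one_gt h2 hr]; simp [h2]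
    · rw [Nat.testBit_lt_two_pow (by omega)]; simp [h2]
  have hx : (rep 64 1 k) <<< (64 * 2 ^ k) < 2 ^ (64 * 2 ^ (k + 1)) := by
    have hrep : rep 64 1 k < 2 ^ (64 * 2 ^ k) := by
      apply Nat.lt_pow_two_of_testBit
      intro i hi
      have h1 := testBit_lane 64 (i / 64) (rep 64 1 k) (i % 64)
      have h2 : i % 64 < 64 := Nat.mod_lt _ (by norm_num)
      have h3 : ¬ i / 64 < 2 ^ k := by omega
      rw [lane_rep _ _ (by norm_num), if_neg h3, Nat.div_add_mod] at h1
      simpa [h2] using h1.symm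
    rw [Nat.shiftLeft_eq]
    calc rep 64 1 k * 2 ^ (64 * 2 ^ k) < 2 ^ (64 * 2 ^ k) * 2 ^ (64 * 2 ^ k) :=
          Nat.mul_lt_mul_of_pos_right hrep (by positivity)
      _ = 2 ^ (64 * 2 ^ (k + 1)) := by rw [← Nat.pow_add]; congr 1; ring
  have hn : 2 ^ n = 2 ^ (n - (k + 1)) * 2 ^ (k + 1) := by rw [← Nat.pow_add]; congr 1; omega
  conv_lhs => rw [hl]
  rw [← lane_lane _ _ _ _ _ hr, e, lane_rep _ _ hx, hbit]
  have hdiv : l / 2 ^ (k + 1) < 2 ^ (n - (k + 1)) ↔ l < 2 ^ n := by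
    rw [Nat.div_lt_iff_lt_mul (by positivity), ← hn]
  by_cases h1 : l < 2 ^ n
  · rw [if_pos (hdiv.2 h1), lane_shl, lane_rep _ _ (by norm_num)]
    have h3 : l % 2 ^ (k + 1) - 2 ^ k < 2 ^ k := by rw [Nat.pow_succ] at hr ⊢; omega
    by_cases h2 : 2 ^ k ≤ l % 2 ^ (k + 1)
    · rw [if_neg (by omega), if_pos h3, if_pos (by simp [h1, h2])]
    · rw [if_pos (by omega), if_neg (by simp [h2])]
  · rw [if_neg (fun h => h1 (hdiv.1 h)), if_neg (by simp [h1]), lane_of_zero]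

theorem lane_stage (w M Y : Nat) (hw : 0 < w) (hM : ∀ l, lane (2 * w) l M ≤ 2 ^ w - 1) :
    (∀ l, lane (2 * w) l (stage w M Y) ≤ 2 * (2 ^ w - 1)) ∧
    ∀ l, lane (2 * w) l M = 2 ^ w - 1 →
      lane (2 * w) l (stage w M Y) = lane w (2 * l) Y + lane w (2 * l + 1) Y := by
  have e : stage w M Y = (Y &&& M) + ((Y >>> w) &&& M) := rfl
  have h1 : ∀ l, lane (2 * w) l (Y &&& M) ≤ 2 ^ w - 1 := fun l => by
    rw [lane_and]; exact le_trans Nat.and_le_right (hM l)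
  have h2 : ∀ l, lane (2 * w) l ((Y >>> w) &&& M) ≤ 2 ^ w - 1 := fun l => by
    rw [lane_and]; exact le_trans Nat.and_le_right (hM l)
  have hp : 2 ≤ 2 ^ w := by
    calc 2 = 2 ^ 1 := rfl
      _ ≤ 2 ^ w := Nat.pow_le_pow_right (by norm_num) hw
  have hpp : 2 * 2 ^ w ≤ 2 ^ (2 * w) := by
    rw [Nat.two_mul w, Nat.pow_add]; exact Nat.mul_le_mul_right _ hp
  have hs : ∀ l, lane (2 * w) l (stage w M Y)
      = lane (2 * w) l (Y &&& M) + lane (2 * w) l ((Y >>> w) &&& M) := by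
    intro l
    rw [e, lane_add]
    intro l
    have := h1 l
    have := h2 l
    omega
  refine ⟨fun l => ?_, fun l hl => ?_⟩
  · rw [hs]
    have := h1 l
    have := h2 l
    omega
  · rw [hs, lane_and, lane_and, hl, Nat.and_two_pow_sub_one_eq_mod, Nat.and_two_pow_sub_one_eq_mod]
    congr 1
    · apply Nat.eq_of_testBit_eq
      intro i
      simp only [Nat.testBit_mod_two_pow, testBit_lane]
      have : 2 * w * l = w * (2 * l) := by ring
      rw [this]
      by_cases hi : i < w
      · have : i < 2 * w := by omega
        simp [hi, this]
      · simp [hi]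
    · apply Nat.eq_of_testBit_eq
      intro i
      simp only [Nat.testBit_mod_two_pow, testBit_lane, Nat.testBit_shiftRight]
      have : w + (2 * w * l + i) = w * (2 * l + 1) + i := by ring
      rw [this]
      by_cases hi : i < w
      · have : i < 2 * w := by omega
        simp [hi, this]
      · simp [hi]

theorem stage_pmask (n w j Y : Nat) (hw : 0 < w) :
    (∀ l, lane (2 * w) l (stage w (pmask n w j) Y) ≤ 2 * (2 ^ w - 1)) ∧
    ∀ l < 2 ^ (n + j), lane (2 * w) l (stage w (pmask n w j) Y)
      = lane w (2 * l) Y + lane w (2 * l + 1) Y := by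
  have hx : 2 ^ w - 1 < 2 ^ (2 * w) := by
    have h1 : 0 < 2 ^ w := by positivity
    have : 2 ^ w ≤ 2 ^ (2 * w) := Nat.pow_le_pow_right (by norm_num) (by omega)
    omega
  have hl : ∀ l, lane (2 * w) l (pmask n w j) = if l < 2 ^ (n + j) then 2 ^ w - 1 else 0 := by
    intro l
    exact lane_rep (2 * w) (2 ^ w - 1) hx (n + j) l
  have := lane_stage w (pmask n w j) Y hw (by intro l; rw [hl]; split_ifs <;> simp)
  exact ⟨this.1, fun l h => this.2 l (by rw [hl, if_pos h])⟩

/-- Number of set bits among the first `n`. -/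
def cnt (n Y : Nat) : Nat := ∑ i ∈ Finset.range n, lane 1 i Y

theorem cnt_lane (w k l Y : Nat) (h : k ≤ w) :
    cnt k (lane w l Y) = ∑ i ∈ Finset.range k, lane 1 (w * l + i) Y := by
  apply Finset.sum_congr rfl
  intro i hi
  have hi := Finset.mem_range.1 hi
  apply Nat.eq_of_testBit_eq
  intro j
  simp only [testBit_lane]
  by_cases hj : j < 1
  · have : j = 0 := by omega
    subst this
    have : i < w := by omega
    simp [this]
  · simp [hj]

theorem pop_stage (n w j Y Z : Nat) (hw : 0 < w)
    (hY : ∀ l < 2 ^ (n + j + 1), lane w l Y = ∑ i ∈ Finset.range w, lane 1 (w * l + i) Z) :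
    ∀ l < 2 ^ (n + j), lane (2 * w) l (stage w (pmask n w j) Y)
      = ∑ i ∈ Finset.range (2 * w), lane 1 (2 * w * l + i) Z := by
  intro l hl
  rw [(stage_pmask n w j Y hw).2 l hl, hY _ (by rw [Nat.pow_succ]; omega),
    hY _ (by rw [Nat.pow_succ]; omega), Nat.two_mul w, Finset.sum_range_add]
  congr 1
  · apply Finset.sum_congr rfl
    intro i _
    congr 1; ring
  · apply Finset.sum_congr rfl
    intro i _
    congr 1; ring

theorem check_spec (n N Y : Nat) (h : check n (trunc N (rep 64 1 n)) Y = true)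
    (l : Nat) (hl : l < 2 ^ n) (hN : l < N) :
    cnt 64 (lane 64 l Y) = 0 ∨ 24 ≤ cnt 64 (lane 64 l Y) := by
  set O := trunc N (rep 64 1 n) with hO
  have hOl : ∀ l, lane 64 l O = if l < N ∧ l < 2 ^ n then 1 else 0 := by
    intro l
    have e : O = (rep 64 1 n) % 2 ^ (64 * N) := rfl
    rw [e, lane_mod, lane_rep _ _ (by norm_num)]
    by_cases h1 : l < N <;> by_cases h2 : l < 2 ^ n <;> simp [h1, h2]
  have s0 : ∀ l < 2 ^ (n + 5 + 1), lane 1 l Y = ∑ i ∈ Finset.range 1, lane 1 (1 * l + i) Y := by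
    intro l _; simp
  have s1 := pop_stage n 1 5 Y Y (by norm_num) s0
  have s2 := pop_stage n 2 4 _ Y (by norm_num) s1
  have s3 := pop_stage n 4 3 _ Y (by norm_num) s2
  have s4 := pop_stage n 8 2 _ Y (by norm_num) s3
  have s5 := pop_stage n 16 1 _ Y (by norm_num) s4
  have s6 := pop_stage n 32 0 _ Y (by norm_num) s5 l hl
  unfold check at h
  set Z := stage 16 (pmask n 16 1) (stage 8 (pmask n 8 2) (stage 4 (pmask n 4 3)
     (stage 2 (pmask n 2 4) (stage 1 (pmask n 1 5) Y)))) with hZ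
  have hb := (stage_pmask n 32 0 Z (by norm_num)).1
  set X := stage 32 (pmask n 32 0) Z with hX
  norm_num at hb
  have hc : cnt 64 (lane 64 l Y) = lane 64 l X := by
    rw [cnt_lane 64 64 l Y le_rfl]
    exact s6.symm
  have hle : cnt 64 (lane 64 l Y) ≤ 64 := by
    have : ∀ i ∈ Finset.range 64, lane 1 i (lane 64 l Y) ≤ 1 := by
      intro i _
      have := lane_lt 1 i (lane 64 l Y)
      omega
    calc cnt 64 (lane 64 l Y) ≤ ∑ i ∈ Finset.range 64, 1 := Finset.sum_le_sum this
      _ = 64 := by simp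
  have hmul : ∀ c, c ≤ 64 → ∀ l, lane 64 l (c * O) = c * lane 64 l O := by
    intro c hc l
    apply lane_mul
    intro l
    rw [hOl]
    split_ifs
    · norm_num; omega
    · norm_num
  have hadd : ∀ c, c ≤ 64 → ∀ l, lane 64 l (X + c * O) = lane 64 l X + c * lane 64 l O := by
    intro c hc l
    rw [lane_add, hmul c hc]
    intro l
    rw [hmul c hc, hOl]
    have := hb l
    split_ifs
    · norm_num; omega
    · norm_num; omega
  have hf : ((X + 40 * O) &&& (64 * O)) = ((X + 63 * O) &&& (64 * O)) := Nat.eq_of_beq_eq_true h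
  have hf2 := congrArg (lane 64 l) hf
  rw [lane_and, lane_and, hadd 40 (by norm_num), hadd 63 (by norm_num), hmul 64 (by norm_num), hOl,
    if_pos ⟨hN, hl⟩, ← hc] at hf2
  generalize cnt 64 (lane 64 l Y) = c at hle hf2
  revert hf2
  revert c
  decide

theorem pl_eq (d w : Nat) : pl d w = (w >>> (49 * d)) % 2 ^ 49 := by
  simp only [pl]; norm_num; rfl

theorem XH_pl (d : Nat) : XH (pl d) := by
  intro a b
  simp only [pl_eq]
  rw [Nat.shiftRight_xor_distrib, Nat.xor_mod_two_pow]

theorem lane_bro (d l : Nat) (b Ms : List Nat) (z : Nat) (hz : z < 2 ^ Ms.length)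
    (h1 : ∀ M ∈ Ms, ∀ l, lane 64 l M ≤ 1)
    (h2 : ∀ i (hi : i < Ms.length), lane 64 l Ms[i] = (z >>> i) % 2) :
    lane 64 l (bro d b Ms) = pl d (lin b z) := by
  induction b generalizing Ms z with
  | nil => simp [bro, lin, lane_of_zero, (XH_pl d).zero]
  | cons g b ih =>
    cases Ms with
    | nil =>
      have : z = 0 := by simpa using hz
      subst this
      rw [(XH_lin _).zero, (XH_pl d).zero]
      simp [bro, lane_of_zero]
    | cons M Ms =>
      have e : bro d (g :: b) (M :: Ms) = (pl d g * M) ^^^ bro d b Ms := rfl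
      rw [e, lane_xor, lin_cons, XH_pl d, ih Ms (z / 2)]
      · congr 1
        have hM : lane 64 l M = z % 2 := by
          have := h2 0 (by simp)
          rwa [Nat.shiftRight_zero] at this
        have hg : pl d g < 2 ^ 49 := by rw [pl_eq]; exact Nat.mod_lt _ (by positivity)
        rw [lane_mul, hM]
        · rcases Nat.mod_two_eq_zero_or_one z with h | h <;> simp [h, (XH_pl d).zero]
        · intro l
          have := h1 M (by simp) l
          calc pl d g * lane 64 l M ≤ pl d g * 1 := Nat.mul_le_mul_left _ this
            _ < 2 ^ 64 := by omega
      · simp only [List.length_cons, Nat.pow_succ] at hz; omega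
      · intro M hM; exact h1 M (by simp [hM])
      · intro i hi
        have := h2 (i + 1) (by simpa using hi)
        simp only [List.getElem_cons_succ] at this
        rw [this, Nat.shiftRight_eq_div_pow, Nat.shiftRight_eq_div_pow, Nat.div_div_eq_div_mul,
          Nat.pow_succ']

theorem lmasks_le (n m : Nat) (hm : m ≤ n) : ∀ M ∈ lmasks n m, ∀ l, lane 64 l M ≤ 1 := by
  intro M hM l
  simp only [lmasks, List.mem_cons, List.mem_map, List.mem_range] at hM
  rcases hM with rfl | ⟨k, hk, rfl⟩
  · rw [lane_rep _ _ (by norm_num)]; split_ifs <;> simp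
  · rw [lane_bmask n k (by omega)]; split_ifs <;> simp

theorem lmasks_length (n m : Nat) : (lmasks n m).length = m + 1 := by simp [lmasks]

theorem lmasks_get (n m : Nat) (hm : m ≤ n) (q r : Nat) (hr : r < 2 ^ m) (hl : q * 2 ^ m + r < 2 ^ n)
    (i : Nat) (hi : i < (lmasks n m).length) :
    lane 64 (q * 2 ^ m + r) (lmasks n m)[i] = ((2 * r + 1) >>> i) % 2 := by
  cases i with
  | zero => simp [lmasks, lane_rep, hl]
  | succ k =>
    have hk : k < m := by simpa [lmasks] using hi
    have e : (lmasks n m)[k + 1] = bmask n k := by simp [lmasks]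
    rw [e, lane_bmask n k (by omega)]
    have hb : (q * 2 ^ m + r).testBit k = r.testBit k := by
      have h1 : (q * 2 ^ m + r).testBit k = ((q * 2 ^ m + r) % 2 ^ m).testBit k := by
        rw [Nat.testBit_mod_two_pow]; simp only [hk, decide_true, Bool.true_and]
      rw [h1, Nat.add_comm, Nat.add_mul_mod_self_right, Nat.mod_eq_of_lt hr]
    rw [hb, Nat.shiftRight_eq_div_pow, Nat.pow_succ', ← Nat.div_div_eq_div_mul]
    have : (2 * r + 1) / 2 = r := by omega
    rw [this]
    simp only [hl, true_and]
    rw [Nat.testBit_eq_decide_div_mod_eq]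
    rcases Nat.mod_two_eq_zero_or_one (r / 2 ^ k) with h | h <;> simp [h]

theorem lane_cat (L : Nat) (xs : List Nat) (h : ∀ x ∈ xs, x < 2 ^ L) (i : Nat)
    (hi : i < xs.length) : lane L i (cat L xs) = xs[i] := by
  induction xs generalizing i with
  | nil => simp at hi
  | cons x xs ih =>
    have e : cat L (x :: xs) = x + 2 ^ L * cat L xs := by
      have : cat L (x :: xs) = x + (cat L xs) <<< L := rfl
      rw [this, Nat.shiftLeft_eq, Nat.mul_comm]
    have hx := h x (by simp)
    cases i with
    | zero => rw [lane_zero, e, Nat.add_mul_mod_self_left, Nat.mod_eq_of_lt hx]; rfl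
    | succ i =>
      rw [lane_succ, e, Nat.add_mul_div_left _ _ (by positivity), Nat.div_eq_of_lt hx, Nat.zero_add,
        ih (fun x hx => h x (by simp [hx])) i (by simpa using hi)]
      rfl

theorem lane_fam (m : Nat) (cs : List (List Nat)) (d i r : Nat) (hi : i < cs.length)
    (hr : r < 2 ^ m) : lane 64 (i * 2 ^ m + r) (fam m cs d) = pl d (lin cs[i] (2 * r + 1)) := by
  have e : fam m cs d = cat (64 * 2 ^ m)
    (cs.map fun c => (bro d c (lmasks m m)) % 2 ^ (64 * 2 ^ m)) := rfl
  rw [← lane_lane _ _ _ _ _ hr, e, lane_cat _ _ _ _ (by simpa using hi)]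
  · simp only [List.getElem_map]
    rw [lane_mod, if_pos hr]
    apply lane_bro
    · rw [lmasks_length, Nat.pow_succ]; omega
    · exact lmasks_le m m le_rfl
    · intro j hj
      have := lmasks_get m m le_rfl 0 r hr (by simpa using hr) j hj
      simpa using this
  · intro x hx
    simp only [List.mem_map] at hx
    obtain ⟨c, _, rfl⟩ := hx
    exact Nat.mod_lt _ (by positivity)

theorem lane_bro_tms (n m k : Nat) (hm : m ≤ n) (d q r : Nat) (a : List Nat) (hr : r < 2 ^ m)
    (hq : q < k) (hk : k * 2 ^ m ≤ 2 ^ n) :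
    lane 64 (q * 2 ^ m + r) (bro d a (tms n k m)) = pl d (lin a (2 * r + 1)) := by
  have hlk : q * 2 ^ m + r < k * 2 ^ m := by
    calc q * 2 ^ m + r < q * 2 ^ m + 2 ^ m := by omega
      _ = (q + 1) * 2 ^ m := by ring
      _ ≤ k * 2 ^ m := Nat.mul_le_mul_right _ hq
  have ht : ∀ x, trunc (Nat.mul k (Nat.pow 2 m)) x = x % 2 ^ (64 * (k * 2 ^ m)) := fun _ => rfl
  apply lane_bro
  · simp only [tms, List.length_map]
    rw [lmasks_length, Nat.pow_succ]; omega
  · intro M hM l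
    simp only [tms, List.mem_map] at hM
    obtain ⟨M', hM', rfl⟩ := hM
    rw [ht, lane_mod]
    split_ifs
    · exact lmasks_le n m hm M' hM' l
    · simp
  · intro i hi
    simp only [tms, List.length_map] at hi
    simp only [tms, List.getElem_map]
    rw [ht, lane_mod, if_pos hlk]
    exact lmasks_get n m hm q r hr (by omega) i hi

/-- Indicator of the nonzero digits of a packed word. -/
def nz (w : Nat) : Nat := pl 0 w ||| (pl 1 w ||| pl 2 w)

/-- The weight of a packed word. -/
def wt (w : Nat) : Nat := cnt 64 (nz w)

theorem run_spec (n m : Nat) (cs as bs : List (List Nat)) (h : run n m cs as bs = true)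
    (hm : m ≤ n) (hk : cs.length * 2 ^ m ≤ 2 ^ n) :
    ∀ c ∈ cs, ∀ a ∈ as, ∀ b ∈ bs, ∀ r < 2 ^ m,
      wt (lin c (2 * r + 1) ^^^ lin a (2 * r + 1) ^^^ lin b (2 * r + 1)) = 0 ∨
      24 ≤ wt (lin c (2 * r + 1) ^^^ lin a (2 * r + 1) ^^^ lin b (2 * r + 1)) := by
  intro c hc a ha b hb r hr
  obtain ⟨i, hi, rfl⟩ := List.getElem_of_mem hc
  simp only [run, run0, run1, List.all_eq_true] at h
  have h := h a ha b hb
  have hlk : i * 2 ^ m + r < cs.length * 2 ^ m := by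
    calc i * 2 ^ m + r < i * 2 ^ m + 2 ^ m := by omega
      _ = (i + 1) * 2 ^ m := by ring
      _ ≤ cs.length * 2 ^ m := Nat.mul_le_mul_right _ hi
  have hs := check_spec n (cs.length * 2 ^ m) _ h (i * 2 ^ m + r) (by omega) hlk
  have hX : ∀ d, lane 64 (i * 2 ^ m + r)
      ((fam m cs d ^^^ bro d a (tms n cs.length m)) ^^^ bro d b (tms n cs.length m))
      = pl d (lin cs[i] (2 * r + 1) ^^^ lin a (2 * r + 1) ^^^ lin b (2 * r + 1)) := by
    intro d
    rw [lane_xor, lane_xor, lane_fam m cs d i r hi hr, lane_bro_tms n m _ hm d i r a hr hi hk,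
      lane_bro_tms n m _ hm d i r b hr hi hk, XH_pl, XH_pl]
  have e : lane 64 (i * 2 ^ m + r)
      (((fam m cs 0 ^^^ bro 0 a (tms n cs.length m)) ^^^ bro 0 b (tms n cs.length m)) |||
      (((fam m cs 1 ^^^ bro 1 a (tms n cs.length m)) ^^^ bro 1 b (tms n cs.length m)) |||
      ((fam m cs 2 ^^^ bro 2 a (tms n cs.length m)) ^^^ bro 2 b (tms n cs.length m)))) =
      nz (lin cs[i] (2 * r + 1) ^^^ lin a (2 * r + 1) ^^^ lin b (2 * r + 1)) := by
    rw [lane_or, lane_or, hX, hX, hX]; rfl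
  have hs' : cnt 64 (nz (lin cs[i] (2 * r + 1) ^^^ lin a (2 * r + 1) ^^^ lin b (2 * r + 1))) = 0 ∨
    24 ≤ cnt 64 (nz (lin cs[i] (2 * r + 1) ^^^ lin a (2 * r + 1) ^^^ lin b (2 * r + 1))) := by
    rw [← e]; exact hs
  exact hs'

/-! ### Tables -/

/-- Packed values of the monomials of `S`, times `1, α, α²`. -/
def GEN : List Nat :=
  [162953476726270865310326324785179656875308265, 81476738363135432655163162392871303414364788,
  40738369181567874783906609724829363818372410, 109572165384906463645661341498470073613579497,
  162953476726270817898197576091524848143279950, 54786082692453231822830670749516511783500404,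
  81476738363135554928547830076149975362467049, 109572165384906381298279830609490202376183098,
  116596022140349167118875345007162852673562446, 160143934024093753976538355785374270870637463,
  64619482150073123986463759547214062702868850, 141881906459942839733441022446912023869232942,
  147255800077834961211638760079914283308071529, 162830838627454959809555328185919771144314228,
  82112317271450428961056851188129494568505018, 146775857335801699625943604161862016601136489,
  81986887730109509183996234561194600684644154, 109356655403228280734886990015362892987967950,
  32684438225343511367211586223815244720617751, 159148156713166017706152990398174590978840434,
  65357987420097287218648831663237191830024878, 177012250083888303513848438990660474838712447,
  178405877177074958388131435209450870552919936, 1382908203780377371201940930173086866587648,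
  116539464587715382100899398277800822998015337, 146775857335801842807373918634230648918363892,
  162590867256438400597752676921840759735641914, 55627900012015784858370988968943934813054825,
  146671522015815292566746007222937863571597754, 81274794313517431724874573504999928170674766,
  116950737378062947150525502567888166767252457, 40853744434400695972168858042643560219172174,
  146986895710974629210630108598577439456864756, 80696396941425740998755050279469909160846743,
  141592119422228200913595458433076374414939996, 32566081840475339601454686311218944446766322,
  105040555035153390143376084993867725279228567, 80548215742730259595447195251707662039379570,
  33068860645800244356081325122776963852576174, 81986887730109521943228455531406532654898537,
  116539464587715195431525194816677888850209230, 41690341822777867236682559950886550890991348,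
  178405876522804989393685785737538387637698559, 1382992609718176224232132291229251157376896,
  178395073211965778498048055677675847876083584, 141592119422228371965467950754604374472353175,
  128859725492655928062381603108849426812574962, 104789165632490965432887845831532901068622766]

/-- Contribution of line 0 to the whole word. -/
def GR0 : List Nat :=
  [40580603623599819730002036300708060499804161, 81150318876072167321481245930046359634706434,
  162300637752144334642962491859534133271199748, 147578222119824375942420631008000974719549448,
  116750483316017447751706208343197882372849680, 55095090114381323712435292405344422993068064,
  108796384318468478914295338277794225202397248, 18284181739125607274843734605890796862308352,
  36568279072273479731650641840893399178149888, 73136558144546645007339607808814735830286336,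
  146262312323943233325007074393937508139270144, 114129552095382637111639316971142055249051648,
  49864031638261442209174839282242428583542784, 98345071331378455703989394175371831070949376,
  85977506711795075320061356228302879154241536, 170561217513295984567042969130086527439732736,
  164099466048105408151931212327240726785032192, 149803775137729254423329663446563080598716416,
  122595300856143955299220001189455198964154368, 66784640788656923339420495262681882278494208,
  132186289632169420401976209342626128642179072]

/-- Contribution of line 1 to the whole word. -/
def GR1 : List Nat :=
  [16993389035452886961373908627399369042165888, 33975974105755717213883978644720172994134272,
  67951863805533702085610027897687654499615232, 134520820071900393362247722310862234420511744,
  90635679220169482591210455813093688317315072, 4248389461852089763496207206665189805002752,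
  8496694517726444708955587042442219154841600, 129225861618339093947646933543654496409747456,
  80045762313046883762158813414509289440018432, 160091524626093765067630426236260984375214080,
  141787892293705968235536393878217028035149824, 105180627628930372114811063704644046087520256,
  33349090244523608606762449997162201110020096, 65304384578753051159636854054187409499750400,
  130757708489860021709743156885541382652952576, 83120344427216211424574216497423321273466880,
  164857696909287996591325414062664497498161152, 152692340434111385421418259177664487626899456,
  126978719944591783583817011239100459337646080, 76945190469869013620344631910365431364321280,
  153890380939738024764960300977417743532818432]

/-- Contribution of line 2 to the whole word. -/
def GR2 : List Nat :=
  [107901002383613686190336779483217845882470400, 38789839753890551194733795177289322311221248,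
  76196771968614408473952435949975938611085312, 150999748026934336438055150086279872290881536,
  124987246634554119328820909604724257270792192, 71579420716604406662879657072183131696005120,
  143148037468058759092624438378159368871870464, 32113810089638851374879437492424593528324096,
  64227620179277388312988896497700810772185088, 128455240358554774169440527538470774854647808,
  79887511738622672919956350657414999192895488, 159764219512095606043547804034654376336293888,
  141133366471687380092333445931480454233325568, 105254483524060206637227566159852827735752704,
  118864976016994546795485234630590866944688128, 60717787020651957968260726985445540058103808,
  120052666502137219564469034109361891101900800, 63093167990937301049541125349671408135831552,
  126186251575896555300812710298791280616931328, 73977430599289595500170502403270570175102976,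
  147943972827451404405856502261645127972814848]

/-- Contribution of the coefficient of `y^5`. -/
def VE : List Nat :=
  [33061099706956995770010134340479049848061952, 159719252393612091080298279204545709071138816,
  64739291874746980711856237810621372967157760]

/-- Power sums (syndromes) of line 0. -/
def SYN0 : List Nat :=
  [299593, 1988210, 1014356, 714875, 1392230, 1688687, 1289309, 599186, 1416380, 1823395, 1111726, 420511,
  2046093, 970417, 1198372, 470827, 2004254, 875791, 652085, 1566481, 1620794]

/-- Power sums (syndromes) of line 1. -/
def SYN1 : List Nat :=
  [299761, 1988306, 1014524, 714979, 1392366, 1688799, 1289421, 599482, 1416612, 1823659, 1111966, 420751,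
  2046389, 970641, 1198572, 471003, 2004430, 876023, 652245, 1566713, 1620962]

/-- Power sums (syndromes) of line 2. -/
def SYN2 : List Nat :=
  [299601, 1988218, 1014372, 714859, 1392222, 1688655, 1289333, 599202, 1416364, 1823387, 1111694, 420535,
  2046101, 970425, 1198364, 470795, 2004278, 875799, 652093, 1566497, 1620778]

/-- Substitution `x ↦ α x` on coefficients. -/
def RX : List Nat :=
  [1, 2, 4, 8, 16, 32, 64, 128, 256, 512, 1024, 2048, 8192, 16384, 12288, 65536, 131072, 98304,
  524288, 1048576, 786432, 8388608, 6291456, 12582912, 67108864, 50331648, 100663296, 536870912, 402653184,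
  805306368, 3221225472, 6442450944, 7516192768, 25769803776, 51539607552, 60129542144, 206158430208, 412316860416,
  481036337152, 3298534883328, 3848290697216, 2748779069440, 30786325577728, 21990232555520, 4398046511104,
  246290604621824, 175921860444160, 35184372088832]

/-- Substitution `y ↦ α y` on coefficients. -/
def RY : List Nat :=
  [2, 4, 3, 32, 24, 48, 384, 448, 320, 3584, 2560, 512, 8192, 16384, 12288, 196608, 229376,
  163840, 1835008, 1310720, 262144, 2097152, 4194304, 8388608, 33554432, 67108864, 50331648, 805306368,
  939524096, 671088640, 4294967296, 3221225472, 6442450944, 25769803776, 51539607552, 60129542144, 481036337152,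
  343597383680, 68719476736, 2199023255552, 1649267441664, 3298534883328, 4398046511104, 8796093022208,
  17592186044416, 246290604621824, 175921860444160, 35184372088832]

/-- Multiplication by `α` on coefficients. -/
def MA : List Nat :=
  [2, 4, 3, 16, 32, 24, 128, 256, 192, 1024, 2048, 1536, 8192, 16384, 12288, 65536, 131072,
  98304, 524288, 1048576, 786432, 4194304, 8388608, 6291456, 33554432, 67108864, 50331648, 268435456,
  536870912, 402653184, 2147483648, 4294967296, 3221225472, 17179869184, 34359738368, 25769803776, 137438953472,
  274877906944, 206158430208, 1099511627776, 2199023255552, 1649267441664, 8796093022208, 17592186044416,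
  13194139533312, 70368744177664, 140737488355328, 105553116266496]

/-- Interpolation tables for line 0, three-point supports. -/
def T03 : List (Nat × List Nat) := [
  (7, [155007175037712096251132009765149292172935171, 99182990075361251138359283189126795536367621,
  75984974108995808395711270405679288609144832, 124634900194343414890351290738568483548692486,
  147335104325554170262948349489698024835776512, 89051456777973009340977143569513927776665603,
  60286982887607016630208339870391572071710724, 49492719773007863526969312653826769383587845,
  73607281642377991722666445927211455335104515]),
  (11, [121099552493954971170966896435791888098787337, 4508974641218604263028320130867292880764931,
  32175715560475714949266460285240859550547977, 7292136144895308715400834227232411754692611,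
  158808549776880751599640731868240032296861699, 8624129599524511440897658974460579669868553,
  109785168446131110237151091813240798367973387, 178160506346543452842261137161615092177960960,
  62079343160141239558209694442609171796852736]),
  (19, [125420459318344151789241244078495053029310481, 37701770934925961422742746993065741546160128,
  125952815795275494767369982529169361693835267, 132922257253474822442044350279460292646666258,
  71991328534083374861438060599500818945671185, 12796670653481994484733870373177803203936273,
  38659266364799976221219846642268426991566850, 52551993168273569894638187611444395221450769,
  154515811952180660539726679096883182210908178]),
  (35, [159681162036175665831880305376116294035701763, 71647101018465644840306114049410731360649250,
  60978258540647877374501245238871522577219584, 63727619105611082644682762951764040153563169,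
  146568515943509007573386430516587344238215168, 47752272499860501969610566078622621346299907,
  92281105300830514417005584700648711820148771, 121703224046696803821307534512117886994087970,
  72928127219439673863286845135036339196002307]),
  (67, [138097619747337902342824336878483323400224834, 37997889037072775324231749039222463255281664,
  28652748954271145262266079011821203987890179, 60159202206549640054812001795313598273159233,
  99816609799482903751908076796346836577157186, 72167081053523859751730259291184531771490370,
  118649573950492201308006296979304681501097986, 113943896162775814505355220023217641159131202,
  37500496573367337898745537108293519455289409]),
  (13, [60126222730729184238644602384771030712320005, 143172008101124548715618509894932870341853196,
  104911534061168507303908903911476997847515148, 84931444820567579415860835087165384057421833,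
  75121523553667973770620352549976977430282245, 55237399922069785138761695377621998234501120,
  15078483246308056428395153177019718557499405, 131383881878691617808590731663491812646977545,
  113306632360105438098640364401405436903817228]),
  (21, [133511827026409284734586475365039878602489861, 90766568965533890688288012156906744001331217,
  151355789056365575652953601110742942663835665, 155591287000495788763499233681824901496832020,
  74658596642646058557882735393031127767711749, 116022500367273345711939368424799372014780416,
  63368021062075774564433240199308098609872912, 169444111044153094457492665538146809090670612,
  2819200862329575267436299416779880956690449]),
  (37, [38881529901041442694635869124931834628538404, 99941018229113457428978908226937515692523525,
  60121814346087792972272822611371948354043904, 62925856692341561100379334405488850522603553,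
  162458903612701953424148175433001194951278592, 119935972891014492894687694870986314051747876,
  61140351248584985920995707310794434777448452, 86616812208659000468752486714121652575141893,
  89910481668685324237937969410555763260129316]),
  (69, [90760612030286860076822467734117968471130177, 104599342269481296412364215081124023599366212,
  149039118788575110053213024455179713904640005, 171966484661214754989249086897553856629047301,
  80828930155884997472618603693632712584724548, 91319177560218634234841698383487814716096517,
  54892584223065713565229167878380751763275845, 178277789449523485209722509135083766439477248,
  31736527332249119034902150609287289874939904]),
  (25, [17448775900674140136820902008576802232991768, 91174339560870609466942298296626525323132945,
  33515746192182038272675677780686402802941969, 100979569317559885910894025314496816634396681,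
  143378403978166268417776667957788755720405016, 116081470902692237876763194587346740910751744,
  125325567060955953304614621180905569038368784, 59465851628600896433495206491895290962903049,
  165755638272494340722952391935290032898703377]),
  (41, [148135304231326299602547353076682598318604288, 32175977418398030029563528780873488171794472,
  38877845945662349605188447603793224676671521, 41660051734401838257679669307062937741950976,
  119181592803498821240579801108380236564660233, 75849382884216809196124041883726375154614312,
  148738366333029864714276741558562100814544897, 110859884505267678686193250881371126884204577,
  22477641518675904740526597172359678153195529]),
  (73, [107356967974151515257619878568881413792202752, 62976407897657871337038582010275594623778881,
  46650387685116872923065981778371481566183496, 40792630775052568363681660436806406458310656,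
  159478542495875993246692275349877518048952329, 60944763988988597227145768644702556810903617,
  107841159874652415954100679629904181620375553, 114787523276368931609475421504089140733411400,
  77257905976110454223141962726216966443368457]),
  (49, [126808487043761165045022215617662408162541601, 92717108698802235547782154788474506857938977,
  56759017719504853470222795043194912467058736, 65159851637255681383704536359710339113156625,
  67782455691328035354456801781503110548553761, 112416571989545697275334017696739989678719024,
  146836120775917691524717015580063048205860913, 177331272113671080592503188350097946522419200,
  97134432405094834115532144741627915881414656]),
  (81, [125026488768059608325237467894169494718775313, 119692067529170848536092775469907222655401984,
  135170264919910120245736885242537425072291920, 141761161518715978380713796256962419366035521,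
  72352812752151236130155032343653963662360593, 100337990840852086803595228781299888778379281,
  46145996835979150496149194965051488002375761, 149357736733025803856249869752465633010778129,
  37155517379323465070660460884080912158949441]),
  (97, [108201924980372006473247851515850881937440768, 15023272432282656886420662808386692358078529,
  84557772911025579856664040428893408914833441, 81786416281187688833579691860834004703903744,
  155718843706674210890676996120383498781458528, 18074393007651345003151507469632189746905153,
  147836313667478404534544465431316377905397761, 145478030588076443027194747776673300103561249,
  19441702056267015916801162053581385421029472])]

/-- Interpolation tables for line 0, two-point supports. -/
def T02 : List (Nat × List Nat × List Nat) := [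
  (3, [144893816939321721039316356137782271339921410, 112053208243077325173680742798355569294966787,
  14684571846666548630788447942194053024579586, 171315505219468549367289457721074034522718211,
  130290940109890186299280310671986865641357315, 76869524829524927249980956915239812482465794], [3, 6, 7, 2, 4, 3]),
  (5, [157113468390603702743109836705840956241346564, 151106842597328226034558009078120165490556929,
  29304369083871249473773154247951425426423813, 152818537339707232073648426929852261066604549,
  135850068006106679383705721427148323457859585, 56676370310412173521981521808325767176650757], [5, 1, 2, 4, 3, 6]),
  (9, [170611223070499359512507612737548854633693193, 69921771719921709643032416647417620632436744,
  95199959050606109463296294827288982538158089, 144199075988906339993190744252870297621889032,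
  88097061772404600764903372309898176925532168, 169884831207658362941427285959959483613446153], [4, 3, 6, 5, 1, 2]),
  (17, [12766545694803646476487295170622466755133456, 153906984988651602725082282056336091333525520,
  91824282869368397917985661392858290809995265, 28167952919632573378993830156939379827802129,
  138609123960080440361727038680737978488193040, 173260381112236628501906958084274952366718977], [7, 5, 1, 6, 7, 5]),
  (33, [52624459355538271110912833795016725620588577, 10049018146482263724770831881585898547052577,
  87612699066105484681358531806399270362284033, 79255439900533392519134562254275079632322592,
  14177195551465348841903369776168784216719393, 4815583010705859287387137133056538137591809], [2, 4, 3, 3, 6, 7]),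
  (65, [56032048307102398656026817202971525997658177, 7342285923353555496653685085079157159755777,
  127233299671241823723753827610939069934075968, 74121933467013990231765684962750987132469312,
  11644945770431519215416111438593773310836737, 143422295751221629511306494767586936925192256], [6, 7, 5, 7, 5, 1])]

/-- Interpolation tables for line 1, three-point supports. -/
def T13 : List (Nat × List Nat) := [
  (7, [88890637470648076630675454616599323801026944, 166230804714893589740387581261854138712457856,
  138761576442229945609376601168291509554905088, 134812394208265275728151557002994723640574720,
  24639169611898353546382583489511442836619648, 129384556819730731066419588866496868755964544,
  5615000665871834395537315886189046111666944, 170791471039307382418021279370482447607136512,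
  173860736905904814517716740664903609664668544]),
  (11, [72201569867837266844081575717012869616764032, 168433354113466226459495331538682681497747840,
  142564876568311654240439836637872318597563520, 154900381537864684643947490374911257418399744,
  28458186529802222718044670465562803622118656, 132782607231410101422468658908743393012089984,
  16185290192773729147350919396007780835917824, 177436875955312558037037179421078481589503360,
  177258784659209273589156289123021234947229056]),
  (19, [57053336711559766189162391326137844670400640, 158473702623353699853235633575630692895686656,
  166223254035953110205871623176929165214482816, 142569528201277082790412959018975363785032064,
  7500377655742083562249342444477756869705728, 107395013137948099890087096782187188398852352,
  4135520725086783799452793817720516415324544, 153695554661220892466714913246596539254571136,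
  152469755224448087499168690948359284926187520]),
  (35, [34534690504445244839636676866155328351240576, 111799783614926463597615071364270260800721152,
  95342600502014106272788465429012766529683456, 100073090987510366580681574433264439505457280,
  75636991525672720283557746543456503231152512, 129101475786942783661032284129748221639528704,
  49408794975890274847677059490572133357064320, 130149201871541261946369727029744060996780288,
  173926102358469043846361218883984769140396032]),
  (67, [172318340616273580765757320339649753513992448, 158578366700355596536090577646024271736078336,
  50545237727288470555739286409880301163512192, 142498521506356451010469268662895470845100416,
  120390718406348567850503723896820747120672768, 42110803581715219781701471370662911030599808,
  3498954102519264155526239721055296358973824, 85395735522229557238270250522275825634508928,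
  86935770435527278385234488708465247062598016]),
  (13, [67409704272625708616184365548096014067434112, 159615384524666364882609067956696098287912448,
  133968347058851324764545909309504833894483456, 151503670988005114988917574410667776121243136,
  42108338528762220830163362647176916389331584, 124152724733079535522218317597758170482083328,
  19229134573951748459153699600665875062981248, 165178597138066824259620874894262569053193216,
  160497415028958010454696868983735257380421760]),
  (21, [64084543407728872912325944241771174093128320, 159364890179835526548828386999733753724536960,
  134391318041380335654077235908794147498100864, 158023253840222950762192381349535998074161280,
  4972742954248874083117454954853187696198272, 125100120024469486305202210183628818105763968,
  23407560120772954863203560434233021908910720, 149572337269895462160845668190734813847620224,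
  154025195228807612088486631672330986985619584]),
  (37, [33948979479206297446284950631654120285540864, 166796558045213465712382829431806065127719552,
  95561434630030262988336826365469084453175296, 134007711482427715927366043346173815041298560,
  75528071259451734091245450304823195672252928, 128557449351651485566732426766142210083652224,
  6203061101836817110871340395639216296431744, 170157610061339441560788515623248690155623040,
  127015082305157985005932048146110896760950784]),
  (69, [84216677059308979249486395481377490279080064, 71282480487144850519279720951296354462736896,
  140836105898280746742887954761732203497915008, 141591851105384116564279747243368564922523776,
  25126633409663983323171735770741679084019840, 34428076448594219785827719241845026391597568,
  96604129588206169531070211355726730477174784, 177915974256484059816890653463677625111159424,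
  177140876821423784543183751093753900806709888]),
  (25, [67681979347801128576039879894339744507628544, 160207135560944773514147658481016786437277824,
  174808980909126535300964163277731658001811584, 151057256412531461614898336412647951190460544,
  42182860367320679257040338935988296725040128, 95333820285514495341521989927289403914324096,
  23338482799760688526526282033028473921997824, 164671274676599570388293126906689371206845440,
  153525356320956587689453490921250379058380928]),
  (41, [24935684490021926039370125923644567998955520, 171764676615913917932657852188069097329660928,
  151279190300882918984157519047068355827601536, 107388163627302577615410583301273815621829760,
  32833580404555044016433784935934669388517504, 119195492542260749724086453273026635185000576,
  1896513263033402303419533438691956764972032, 131739639782874288732062036795236671241065600,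
  164521060614637875310340852284691404923339776]),
  (73, [168439789573079501841845113215757276973891584, 172309205499793202072386840037479312667975808,
  150786036081636613393322348577280311745848320, 50472757583377730939638174000872715852973184,
  32158388411854156716974409239371940171359232, 118659803027149485363836178140327133348635648,
  2759214134702604877147736255284386969165952, 76847777330610603461338294559786482733686784,
  164746362101467325468930345744766269420209152]),
  (49, [79807794613984234312888858503769732092530816, 138092895672988138986672299010881292968398976,
  119576604803905620208795727791070943629023232, 95830323496034297372640979076978145019041792,
  8952745996940464262621504609729930353182848, 174427871305288619260031433359521468295151616,
  69441317610532238052357106735105104523821056, 178275319081281255050463575023293257001998464,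
  178084224612309107639232704838250076485720192]),
  (81, [56591345577046579984908717756474700955912320, 48362796226155132294565353017632057620168704,
  50839267610266402443876923910609708882339840, 74492961542091307226734919858357393065781248,
  119983289422606672843543422806332341091303424, 107623699506992409535128249349766823104487552,
  113907335746771922091058459157629953850222592, 153580683442439041575825566246490586168164480,
  86968495367374125249895298775534465233979392]),
  (97, [168492163814569159135966556128153190807896064, 25964114836216449644645638668624280065941632,
  7948650494631194775592009727591673889820800, 51104329630168941050017644806052472774733824,
  33037592975804042571655487416755959608905856, 84347323555822994651787384328481009953673344,
  2440973026407868444648417721496616642289792, 131203950270359056469708218289124496627474432,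
  44164783172910880666289856864254105019756672]),
  (14, [80239614930353716825987192545770458411172608, 176398367402129144889724143819234215922238208,
  155438556045322569263155263255506950461326592, 138210463229298846507007695101211213352142080,
  38946787020264969357765580405946143266047488, 126155636049250471016773467640964411950104576,
  11219197366593612082360728298130672459974144, 163177065560961193025873737073531281488216576,
  169315597294156057244456357048192928158058240]),
  (22, [59991686913704171161073364746742834107777024, 143009428231357783082975855805726740371736832,
  158471551268450891019416139618891499424449280, 166648756532307432680532904940388771094858240,
  32565094292889150751230927144395449818940160, 100484925698052984670144044531727770004226816,
  30987672846380449942416705900260081597939712, 177861586897287980432172919180034167512500992,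
  177494600339931669302850608369035282512612096]),
  (38, [88303735459477472705892780227859020102242816, 112712877512825049411937795381677201672900864,
  138541528729053830371881473191301018028081152, 99400267678854489872945033521687955270271744,
  24878780903892906132608238556544183000109568, 128622749671962794119337715826138400593809664,
  6877245539879087088905930685937916663825152, 130368055937977177172347192681918200190861568,
  127927345435559036919090374163497306753601536]),
  (70, [79813094244908053567755619922277064037630720, 67675669504573741530773258696769251812836096,
  46587402216515791553178767930586580608098816, 138092895673718305732403759146143394014700032,
  119576604803905620208795726998437409211818240, 125886966505216279392512162288056371834257408,
  98817505545802502916276275966412053614174464, 83286154323767653451992884412863767707124224,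
  169446243793306786016124649551537799822319616]),
  (26, [46715939893342052094414863344649589640661248, 134808604580101360542696589872500064879904000,
  140835612090851167884835309841304934840011776, 140836105898808089392582894229587159945316608,
  21302675749109439642152359479507136616073472, 120122562606298385532890640466934217066939648,
  37064557643586746313270038708863828408403200, 151962121723629818981016853108181840485681152,
  143982665044578885267492298304789167187427584]),
  (42, [37825262862279057966388656632264132460024832, 126786179276290737472366755591786868112360704,
  141717615346333917455755334337344711782568192, 142004720618298843263032125649405732425044992,
  74743368158482897522693812774262216830489600, 120392649107375856098057715361550400818775296,
  45421324331251429235749096441180674813068544, 122132509526453786223252631262420314668143872,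
  129644513939961652366654506540838731194040576]),
  (74, [80379300844651847378286614214562765017719808, 67887154993262538183855997789060820807721984,
  155187239572773359614596837196178516529382656, 62938904397025386000784111660023956853753088,
  118604265885006808321993522153479684430504192, 28314330167900047617238186555826550154985472,
  12395233832545847627408113382213497359704320, 163292251144192007702652326826975193481618688,
  77017999596978834389004418880095902456881152]),
  (50, [38736453971843076828123475320555942015142144, 133970162785307774185542837382249924203124736,
  142008310198258245332355896223942639160922368, 141144468849252340870837282414288159578786048,
  74271821870063725029161993357104786343725312, 151271768554745794733426515587435331384776704,
  45293973654376636339267869260339824675526656, 152319495968734533015353684866272786951178240,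
  130038463222598304938310347331148929067647232]),
  (82, [172595857501847357815862324505965498158031104, 48477573069749371588082227420003766993158144,
  166517188218490697766876999257088881632225280, 73909530808655210365465693036179575766263808,
  7081304634756879943813149797105978610548736, 41882191655685656151950924518066834288675072,
  3793026526066487713531822933309019884890112, 85084207013244747906557544387921093255506176,
  152019067844811140403061805300622930976180224]),
  (98, [124152724735391730217034612133371017290584320, 159615589227968154169816041134004486065365248,
  99162822367489400097882628145313950461862144, 7460273518530399224142926026860428183740672,
  166646271543003456226022674254002849635635456, 175719482151348524747043909580987535798051072,
  137499643275919732953733885729784315680653312, 178155565610058678106164987909316767205306624,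
  177773376672114385740090577859767226299592960]),
  (28, [62941235860739564415180499562498218465954816, 159085518356390683027595392076864043498866176,
  174390773880626985627121536579282126629766656, 158469748170917815297959030729531724109186560,
  5425658784417766960677080474199792669428736, 95758451473810170722703385371838934360786432,
  22438394733186909727951478109112968635485184, 149341966108585250429037731871326369145160704,
  161619029574974978866202971820091110577933824]),
  (44, [74492961542091307226734917768687165965862400, 119983289421430293086531621021827005937614848,
  107623699504234001829031620082439769829675520, 91443889053832557562534009237365936483209728,
  88554227146298532745876810008717180599795712, 112438950208914093488213413490332400464434176,
  61964541727610843195161270576828199940915200, 177328016836094398983963012287981073289188864,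
  177977035666526200507112576482631622946985472]),
  (76, [80108969765623281131169515264766922132038656, 176607470918954628518328381375812069415199744,
  47030598067168536943342829555436064465756672, 62823718813632004602762435210374867580887552,
  37826045112548754758786487808958411302766080, 28586022376396327348448183274998431173574656,
  12360695169463691230616571487663947494983168, 82341039323450522349782288090735508256195072,
  77459533912636511938456289732131120885014528]),
  (52, [12709816903854690844021509423701702609996288, 92048972247517093379857393204786104702603776,
  91222052201721159185668721150695189044529664, 119193379734685872318213454409947299740385280,
  72201569868526868770605735321673243639683072, 168433354115048254408580163705248012084185600,
  72735319376879012116690355604055685976820224, 126901274468772762523917304410454892306501632,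
  110942361110670892659372691596740001666171392]),
  (84, [174388463020190101750116502396520228666214912, 75639637353430326901097177784914755503269888,
  75177286000077642930629716524094969637505536, 46714884488666095972802453019524743089356800,
  99673528375736908281669289411337948588155392, 17103464402384260284866703804990166237448704,
  89459741123335847662525859397848275047418368, 65869862094426010546780803930535688621009408,
  82265974495458696972076444134012955018658304]),
  (100, [174660727459553879038181720174414142696861696, 76089915998541412961653953221781362697048576,
  90928076151300677949530802504253368581500928, 46133579855409408122954467377081400451661824,
  71798650293843481991615721334635592698307072, 167316122034666172393624222204544196706054144,
  90577143343603218445550797889745280068235264, 127626826924131930407847692320978234744246272,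
  83064677025881741892561325607872546446770688]),
  (56, [46594033736934073163609548398454470193714176, 125882387315501082032241393859717494697105408,
  141148067734294490636116144598374823023873024, 141718099850181645670635791987404717080712192,
  21783749946885435469636438469891511677883392, 151616733127281949924781186933352283750012928,
  44865985501223765203726318200904966152919040, 121660963238683622982463558730372957488547840,
  144842902191468395852023117567536407513144320]),
  (88, [158243984112745985490717230574354795837007872, 148985838678204567655200295136264244370082816,
  62943525458395978392638975710170181951029248, 174423413741111371832849233392625982856242176,
  132781743233780672357380733019876343372851200, 128855608484156603596665014463635903632903168,
  123918195084093899815029735995138261966127104, 177643784252873927527329390065168869436173312,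
  177548194815398831660593596754197597088918528]),
  (104, [24878253865235783003147739358669764521099264, 25419633807709067251273040360255028935529472,
  7085779481697051137005044133836015573935104, 108106784160245803641393113804531623585132544,
  32275432253794939805530701476442686307181568, 83816738274187498918032376039281681386972160,
  145459750382630237658237841185424311182169088, 76790383924208386968587601088247073421139968,
  43489649668837955761178853990369202198807552]),
  (112, [12982057420684249298236056718762134141415424, 93177263508718092094234156165974571104610304,
  74752609617665028441623110307867650236100608, 118609164092118514534031420257413535247630336,
  100076429347394205387559305672686041548462080, 17543024149042880171175479258739767546753024,
  89731971002447215951341025392443808859303936, 66298873092902635728115520806166713551818752,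
  111279927865283222350264743788176020894398464])]

/-- Interpolation tables for line 1, four-point supports. -/
def T14 : List (Nat × List Nat) := [
  (15, [75320229847366540242747729233986097954947072, 171830064663001316169428750386820448711083904,
  150649412709289798317169770949015576638391040, 154900381537864684643947490374911257418399744,
  28458186529802222718044670465562803622118656, 132782607231410101422468658908743393012089984,
  19229134573951748459153699600665875062981248, 165178597138066824259620874894262569053193216,
  160497415028958010454696868983735257380421760, 14443733013996652391728426800346991138178944,
  8836816712795493804719130343712416394642048, 13657690051208093260407410519254963813613952]),
  (23, [81993470126871990148626511544721856616467328, 162586711543671498321599282661151009300023808,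
  162594130629121404972634796707068630530001152, 166648756532307432680532904940388771094858240,
  32565094292889150751230927144395449818940160, 100484925698052984670144044531727770004226816,
  1492559544994011178847761025589818911885568, 169241496821602334766985281772027403640506752,
  149944874683362142121959136924599526294030976, 24878253863856579150099422022846461461400448,
  25419633805599696652493264978839851929436928, 7085779480764060295237061673842107056392704]),
  (39, [34425851321132003612589671494932181484048896, 112429731348270957049346381772201286248170112,
  139349614280994481505760306694458065217917824, 134921337071524447379605771953648677194567808,
  23966516444263843610336184401021949771256320, 171839198453133802012292108808710677862551808,
  49408794975890274847677059490572133357064320, 130149201871541261946369727029744060996780288,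
  173926102358469043846361218883984769140396032, 1265650356132622029469337126208263084310528,
  54367018108938133069689676662195000698732544, 54998614746447264762777192198553168861205376]),
  (71, [174421114838169068687355077924749504071869312, 75330150542784659703684568627002002580177280,
  143044018734007017392184797425840346720379776, 141591851105384116564279747243368564922523776,
  25126633409663983323171735770741679084019840, 34428076448594219785827719241845026391597568,
  98817505545802502916276275966412053614174464, 83286154323767653451992884412863767707124224,
  169446243793306786016124649551537799822319616, 9092176696907881187196877082534128916628096,
  100079943160465382313000169828901905087070592, 93224966174766018377026731877491426491113984]),
  (27, [80689808502641913800517313335785224484687232, 139347261546509048012149557450970257969646976,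
  154898569135086956290628673342239541624308992, 154900381537864684643947490374911257418399744,
  28458186529802222718044670465562803622118656, 132782607231410101422468658908743393012089984,
  37064557643586746313270038708863828408403200, 151962121723629818981016853108181840485681152,
  143982665044578885267492298304789167187427584, 13128602810537881935679754054501070383612288,
  23756719072492913488476344497090534865634560, 25485988866703114406573262539275366423334272]),
  (43, [25129603566862378072782770888402596331001216, 158874462870240754333824236931886294201532416,
  107689002483082431894834799197473054883053952, 154900381537864684643947490374911257418399744,
  28458186529802222718044670465562803622118656, 132782607231410101422468658908743393012089984,
  49408794975890274847677059490572133357064320, 130149201871541261946369727029744060996780288,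
  173926102358469043846361218883984769140396032, 59989417257509688008471540117865560570594560,
  57048738912287232663171903264759437074632832, 47643013948024638226797946157444506631275648]),
  (75, [81990211523993967245008304476808037347099904, 81988561289708781644413551088744451048211584,
  54683716646683426492277091488773416041848960, 154900381537864684643947490374911257418399744,
  28458186529802222718044670465562803622118656, 132782607231410101422468658908743393012089984,
  89943816051324786378200095572465080588043392, 173126830920045601224107127436852897928717440,
  163483921833500218799989326301349745562494208, 91222052200139131236583892154663996126929920,
  104648170797967894754169512959877690456802432, 4836808790592846614191502991287940169081088]),
  (51, [61168074293007664770736257720059351751720960, 91440930858266634812752758072836872367769856,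
  120950112708030327838314970012347773285830784, 95830323496034297372640979076978145019041792,
  8952745996940464262621504609729930353182848, 174427871305288619260031433359521468295151616,
  49408794975890274847677059490572133357064320, 130149201871541261946369727029744060996780288,
  173926102358469043846361218883984769140396032, 48133007927670142282520008007702301143734656,
  4256380116678977520755012619607071180982400, 67120321369625589526624919185141504688523520]),
  (83, [56911721428869719846855637851553850351165696, 158872343419324864323271374587947070143867264,
  50244938536493261209068105044490552392820736, 74203551392391729189920274758217395358138752,
  7467695264302268958854361627959598822467968, 107683742729403881586035384946592908557951104,
  113907335746771922091058459157629953850222592, 153580683442439041575825566246490586168164480,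
  86968495367374125249895298775534465233979392, 116321639808016021303756028059687052843679744,
  315851824339290362540260537861180326160768, 431307903439375757919035756572264443685248]),
  (99, [38361973229115278898450069427690074517020800, 71522009367003667152341869377871645146886528,
  141600805448520268720808957454767256196092160, 7460273518530399224142926026860428183740672,
  166646271543003456226022674254002849635635456, 175719482151348524747043909580987535798051072,
  49408794975890274847677059490572133357064320, 130149201871541261946369727029744060996780288,
  173926102358469043846361218883984769140396032, 134001029455848519466359615590340556455149952,
  92811212725315313839412097300597110151852416, 91752467343106183352540729772360214698266752]),
  (29, [63503000842458157063969463616371770242632704, 154907305486778871111764345330373458560812544,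
  134915729057961316213810167667679268058433664, 150644493900685564717120526671633314125710848,
  4478353881180567840409924564126388411433600, 95833653876453477188950033807515835258898560,
  19229134573951748459153699600665875062981248, 165178597138066824259620874894262569053193216,
  160497415028958010454696868983735257380421760, 40423495521814442713664325766254819702472704,
  41566805725880538012436358945557761153306240, 41330990046780636026768653633406189894107136]),
  (45, [80696985669448607985294413742588749221466240, 175722991975802483331276267879736672887246976,
  100486002371999342203222832768368736284448384, 91443889053832557562534009237365936483209728,
  88554227146298532745876810008717180599795712, 112438950208914093488213413490332400464434176,
  19229134573951748459153699600665875062981248, 165178597138066824259620874894262569053193216,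
  160497415028958010454696868983735257380421760, 47033899206356248579475036840248214250586752,
  13548833590527055489324070439590355401708032, 17550407345337047675986813224055411635656320]),
  (77, [158876569032081309911234157127396750373430912, 166652265029358973003092727533354508592611968,
  63500521170065650186639215121468006701465600, 141591851105384116564279747243368564922523776,
  25126633409663983323171735770741679084019840, 34428076448594219785827719241845026391597568,
  19229134573951748459153699600665875062981248, 165178597138066824259620874894262569053193216,
  160497415028958010454696868983735257380421760, 16992939759310911572989447353439949361783296,
  91468951648058020808538690571201911147471872, 7086561731236938019958569711968261578425472]),
  (53, [84669848100644694224388526283964152828402304, 100308366336687537169999661227798687016556544,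
  141594474334400169547261013671832800238502528, 95830323496034297372640979076978145019041792,
  8952745996940464262621504609729930353182848, 174427871305288619260031433359521468295151616,
  72735319376879012116690355604055685976820224, 126901274468772762523917304410454892306501632,
  110942361110670892659372691596740001666171392, 51418462095540160293600066117561028272195712,
  67403402402413537008174554881377170129689216, 46131764128669015471289094012878486727819904]),
  (85, [167943356147353678397278353747649370762772480, 143042037520368997974058096080338136346927232,
  158879719969478987605941809066278964363799168, 141591851105384116564279747243368564922523776,
  25126633409663983323171735770741679084019840, 34428076448594219785827719241845026391597568,
  113907335746771922091058459157629953850222592, 153580683442439041575825566246490586168164480,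
  86968495367374125249895298775534465233979392, 91218537057150318455939983784688107359578752,
  7493199159910291812226694229634406131173888, 112747178908506912746376172782266933015742592]),
  (101, [41685734417013762246281741437932436518347264, 116539394602169336816604734553020284127948800,
  5003880250660053757745836792649663651968, 141591851105384116564279747243368564922523776,
  25126633409663983323171735770741679084019840, 34428076448594219785827719241845026391597568,
  44971950231227126608186374922608260157547008, 87254911432595172187543727588360119694406144,
  170939497193001868178990759551672055400239744, 7943647946529218304379888527634552911310848,
  50478006704449244458105477901599515233759872, 95557888913215497620498350747430607258656896]),
  (57, [6674054132126458208764746738335129540608, 116543444758858661773809293103085095403652224,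
  162584231205813309805285693701849861811344384, 95830323496034297372640979076978145019041792,
  8952745996940464262621504609729930353182848, 174427871305288619260031433359521468295151616,
  11939885512954022511622375948228331535599744, 110665600555380267831876036264263917982715008,
  131932431675996816751435904433977282636289152, 67675669502788889485651915806744753861563392,
  46587402218827986247995057061879874571996160, 13662147618833435563033871545609887353412736]),
  (89, [134918043910949808385786013962859829899822208, 61171954309162246955697361245372181282564096,
  74208128589238776343414074942994868420478080, 174423413741111371832849233392625982856242176,
  132781743233780672357380733019876343372851200, 128855608484156603596665014463635903632903168,
  113907335746771922091058459157629953850222592, 153580683442439041575825566246490586168164480,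
  86968495367374125249895298775534465233979392, 111872263761717387912358811327008622105331840,
  124150748836272169100686525199352529961361536, 100825489199209833828934232239836169615969280]),
  (105, [167947656198905712652788022404012476278518912, 25122511473811520023332589442298842298979328,
  150647660788819667093401187617667104070706176, 50247413561252569166480424359934972986918016,
  175718944476068512330270721088271637563843584, 84666160158260035842823693443914465791709312,
  145459750382630237658237841185424311182169088, 76790383924208386968587601088247073421139968,
  43489649668837955761178853990369202198807552, 147254923299005322101978547511550540867712128,
  319176884804125545452420720712434864619520, 146353600383883053281685116614970783907708928]),
  (113, [124272531375734138694576733016504699239544960, 160003340983086761818910239733194334383638656,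
  28462576973401312352548687638616800676022400, 95830323496034297372640979076978145019041792,
  8952745996940464262621504609729930353182848, 174427871305288619260031433359521468295151616,
  113907335746771922091058459157629953850222592, 153580683442439041575825566246490586168164480,
  86968495367374125249895298775534465233979392, 24872263034374943992616563168038687392929792,
  91476045741400933097265182553489803745169536, 158476007505266202336876498497683431480111104]),
  (30, [74206541487401621689889506417520211409241600, 150640459694732766048575544844992674298593280,
  166647879906687764354798131719774137640554240, 166648756532307432680532904940388771094858240,
  32565094292889150751230927144395449818940160, 100484925698052984670144044531727770004226816,
  37064557643586746313270038708863828408403200, 151962121723629818981016853108181840485681152,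
  143982665044578885267492298304789167187427584, 42114308091934485403932302786433518271464960,
  14716008089739978263389733840213575842400512, 8552000372777945482914194896223885567462400]),
  (46, [41683280660105384139108526918151312848717056, 162593144343449497349907798069400750256035584,
  146778266128861432286936841271070560524178432, 91443889053832557562534009237365936483209728,
  88554227146298532745876810008717180599795712, 112438950208914093488213413490332400464434176,
  2985034684009975578767614172278570050654720, 161470828629867531454573620675561018944918272,
  121494592408242722363385512640722161801106688, 64557464783766997971083365253810551359803904,
  17964243206923493663750660696931905166116096, 56591345578912561668444666535561453495124736]),
  (78, [166651189022217059126348361474099581340877568, 67457906731969524277984053105652477135430656,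
  46464390144038082103780666271301680370812160, 139356049737484247239216004047825648243180800,
  119780263803671684704078192541076152733664768, 28455377206311334780217251839639532651685632,
  98817505545802502916276275966412053614174464, 83286154323767653451992884412863767707124224,
  169446243793306786016124649551537799822319616, 1263154069120497850111526867393187453871872,
  320716133987234095507225670598637652027136, 109040885839082973146112998226699341352937216]),
  (54, [63496569374504283195822726029570660469051648, 159996709466116816792212228322888519717493504,
  100299450540514266485924283085766141174356736, 166648756532307432680532904940388771094858240,
  32565094292889150751230927144395449818940160, 100484925698052984670144044531727770004226816,
  72735319376879012116690355604055685976820224, 126901274468772762523917304410454892306501632,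
  110942361110670892659372691596740001666171392, 9085577081247320631511904346414383229833472,
  28313835029497898866041556317132251010699776, 75639177439975790932441908523323819238103040]),
  (86, [88558351742635324550762803051374364843845632, 50248403168574699456043335688944374733875968,
  139353853187977679110231879797051416320671744, 166648756532307432680532904940388771094858240,
  32565094292889150751230927144395449818940160, 100484925698052984670144044531727770004226816,
  98817505545802502916276275966412053614174464, 83286154323767653451992884412863767707124224,
  169446243793306786016124649551537799822319616, 28589889100473837089939980594563244345010176,
  92815494167594369230119030597427669715919360, 25490599294452860171924220770256203972346624]),
  (102, [171837659206911791620027129662161703625826560, 120953241046848318713308484569227754463035392,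
  4475900792901965473028829950656362376598016, 7460273518530399224142926026860428183740672,
  166646271543003456226022674254002849635635456, 175719482151348524747043909580987535798051072,
  98817505545802502916276275966412053614174464, 83286154323767653451992884412863767707124224,
  169446243793306786016124649551537799822319616, 142567861353264662884932867547599263275942656,
  47883662037612595632077769548616105006739456, 50543392095676799474220712448609932313370880]),
  (58, [38358834255134523123684005015069371098204416, 125612290180599565960097199674993115807094784,
  132791557589093132005758856256714444831198208, 132786989697328883080748004686474137697257728,
  22206484990998855678544674138676694087635968, 120948002560209548162545530202392106780071936,
  37064557643586746313270038708863828408403200, 151962121723629818981016853108181840485681152,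
  143982665044578885267492298304789167187427584, 1272060560495103575893907695072822551387392,
  82106717028231291092816220612405590296108288, 433624079855088331303912343851692963397632]),
  (90, [139357163632735286680826972862991018437381120, 160000175428602735460589170535674382276108544,
  174422930567140358901469901948198467456213248, 174423413741111371832849233392625982856242176,
  132781743233780672357380733019876343372851200, 128855608484156603596665014463635903632903168,
  37064557643586746313270038708863828408403200, 151962121723629818981016853108181840485681152,
  143982665044578885267492298304789167187427584, 14439166451988027788035383507865452597479680,
  100546908931239433806339375662419760319040512, 125880119651972279408814362402907202049288192]),
  (106, [71526462948324258294339217338647383499616256, 167945984696972637824547994689082509477557504,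
  22210856155721502549022198174541634768744448, 7460273518530399224142926026860428183740672,
  166646271543003456226022674254002849635635456, 175719482151348524747043909580987535798051072,
  145459750382630237658237841185424311182169088, 76790383924208386968587601088247073421139968,
  43489649668837955761178853990369202198807552, 48130893792530778036609249976508266196250624,
  148102268264942945479379743536789588637917440, 15299407586723786844128132587332314740036608]),
  (114, [146775779810328945021010978883119476321032192, 2544143114196207553690883398105168883712,
  54680928594086019414483532533370487427827968, 7460273518530399224142926026860428183740672,
  166646271543003456226022674254002849635635456, 175719482151348524747043909580987535798051072,
  22485975115613564532436792333340148739608832, 44318951691445665242347135404112433284913408,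
  85469790799489801488917949343748392105289984, 111869454436441649197575588348273974331842816,
  67409704273518134638745043946666087703120128, 159615384527424772588705697944599091942002944]),
  (60, [7469516304993409036601279521121779524309504, 148402194603675456804636142812353362047011840,
  124268754376128394017904081957322637405323264, 91443889053832557562534009237365936483209728,
  88554227146298532745876810008717180599795712, 112438950208914093488213413490332400464434176,
  72735319376879012116690355604055685976820224, 126901274468772762523917304410454892306501632,
  110942361110670892659372691596740001666171392, 33942666975738061979820084397929518046644736,
  50471149216204819099136195168526304196691456, 67130155662546822641364239035261393557263360]),
  (92, [146783206868672612606250646822129174658949632, 81983569375066025108045028709490130495212032,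
  146780412169245425365375737314672278075616768, 174423413741111371832849233392625982856242176,
  132781743233780672357380733019876343372851200, 128855608484156603596665014463635903632903168,
  5969984962041901902878357622351680505914368, 144535780742081493555515685140614940991694336,
  65966215837998566831967422882219389058296320, 101667646851271314432766968199554151762365440,
  28321256774823557134857645702625329726629888, 17546623034815206208766819450900214940967424]),
  (108, [119783555636397770437703860378228243830936576, 125610146803863823240665124318715427571114496,
  141598346379729801589662294508507292636296704, 91443889053832557562534009237365936483209728,
  88554227146298532745876810008717180599795712, 112438950208914093488213413490332400464434176,
  145459750382630237658237841185424311182169088, 76790383924208386968587601088247073421139968,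
  43489649668837955761178853990369202198807552, 95005015141738974839931070160018735571670016,
  100539355591368549319652776616251962614101504, 134517394654113441296164367194384279881650688]),
  (116, [13258111489063976867606325138918729523923456, 75323872599974565737518288216466771356422656,
  74201611382712256482077997544077442949328896, 46471157242547627402961940129072958110972416,
  71519703820476851014275529453578325810223104, 17902358341638698238224102432693074954029568,
  72735319376879012116690355604055685976820224, 126901274468772762523917304410454892306501632,
  110942361110670892659372691596740001666171392, 162107611914894593213219220210440051707886080,
  162536452772511936971544785402644305572528128, 424710946234730036547783949107931362900480]),
  (120, [80693124263702595124740940634673457773159424, 14928144238859031478867991633178623815459840,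
  119781420228864038190347581205184537264396288, 174423413741111371832849233392625982856242176,
  132781743233780672357380733019876343372851200, 128855608484156603596665014463635903632903168,
  145459750382630237658237841185424311182169088, 76790383924208386968587601088247073421139968,
  43489649668837955761178853990369202198807552, 56087160097543588380498243710404531467592704,
  34197113119984304822334394704690590641041408, 112751468326235142239695169647654355381271552])]

/-- Interpolation tables for line 1, two-point supports. -/
def T12 : List (Nat × List Nat × List Nat) := [
  (3, [99639381172449844766539140832169074238685440, 160660043415339847053348047900657452673139072,
  34883230034337290860575858860363082952081664, 140416503179777307368059729417099872615530496,
  149337347040245005698646037997073058681061504, 45173764255355125350391741848589523971211520], [5, 1, 2, 1, 2, 4]),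
  (5, [94057047613802462734794518274279019422679552, 13665198859953680192133925753744385665663104,
  141786921957471783086292563246178871531274880, 36501753205088664701022220148132255599952384,
  152014610278686638206191388108320729670353408, 47879447717574886654276373469434986429939840], [4, 3, 6, 2, 4, 3]),
  (9, [78329531580455584946828839290206304446973056, 17301889561359733846620431497553155201172480,
  153087868174709299512098869976176508379595904, 140584205229865485809850759118448028020637696,
  134999397978323827618493852501967753990635648, 118258086398123094566254599761637779540280448], [7, 5, 1, 7, 5, 1]),
  (17, [98493396561006978707695033781455325883271168, 40198252519880885979802673863250683579336704,
  38942484973856611419514488685217607957086336, 15305092694171992265349221223242472536146048,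
  8715080695907999644444532625057350867224704, 107125763386421040217823123793695807505432576], [2, 4, 3, 3, 6, 7]),
  (33, [80048220721563784661820728913024486425497728, 115582242110526461460163458750646403763015808,
  38832765842786581368461930603151388280094848, 82264796798156260537620163829848258862121088,
  100821713523842907748542955319569648499822592, 174277616037259210715425766664348233902325760], [6, 7, 5, 4, 3, 6]),
  (65, [168841506196913362464479981032405114099343488, 106639193498985135171758119942708058430374016,
  36391962962754569911500364047846335938830336, 140990983559099686914391851364595071948169344,
  122620326896270171199582570972917081745399936, 48672378075426274546481739317469849896091776], [1, 2, 4, 6, 7, 5]),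
  (6, [86359183897122689905848590088425876662255616, 22266597331562553910218604252212257412350464,
  144307837411365140559406705233479418035307264, 42113348388834783156609517245634286742143232,
  32895027290634964331721333579982092772573952, 132275843045457419427303539650017848291492608], [7, 5, 1, 3, 6, 7]),
  (10, [106643564662977599048682838208144689747460352, 11091126249118362011555412636481480585905152,
  25936601809612877437072561623276885498659072, 155070611779600899111036924299215586155560960,
  44021497711917686139852066318696213236417792, 61271764045564454964119250492421768170438912], [2, 4, 3, 6, 7, 5]),
  (18, [61055593026162467362872696923880173634322432, 156659063160911169874316046057636309824964864,
  34592890751591678642369030129673478430787584, 11218625799042170086650651476497072392241408,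
  144986817041308781451041170735171145119565824, 47038598026591395218574989546634153599961088], [6, 7, 5, 2, 4, 3]),
  (34, [83224628346228414864885995933774801541271808, 18591720569510439838206186525294302976806912,
  79002793535445335791188030584792192674435072, 34101020566224299467318505200756786464821248,
  29567222592106143447650144987568114891755776, 2442209870542727277523456919262660938174464], [1, 2, 4, 5, 1, 2]),
  (66, [95344083921796145063132530795983182426546176, 160096441443127252410992581360314952133386496,
  52758523297421933223811907179251851379876096, 144461353942716357365388629702242344881889536,
  148773920526127813734282088611885206692962304, 40007007183571867702284147583959223005880576], [3, 6, 7, 7, 5, 1]),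
  (12, [75227104133373375850796918201494258174658048, 171324656289928943624088165648764704378585088,
  43139398752830624854050221234384579063710720, 25609518011670299764544968457121679938683904,
  27863702600764434753887684644472995740385280, 66302089155819502508859259759102000950673920], [6, 7, 5, 5, 1, 2]),
  (20, [85289455766042902427277834449352584733917184, 34881252808301940723816898099055961095275008,
  20788456587942555493493816488954297881462784, 136129354759404650854757644856140584204634624,
  146007012820353715474587247745814395525007360, 77011142109586032577424054978541544299038720], [1, 2, 4, 1, 2, 4]),
  (36, [142500210290525096345712997388458441410875392, 120728278513157926354268563570185544639971328,
  136295157343335776290748403339027206717313536, 90687553671932846072141963865807131930268160,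
  27129910925673235281995366473521476482891776, 4790681919506916972679351015273393341596160], [3, 6, 7, 6, 7, 5]),
  (68, [8650944783255890171029787972678885692146176, 165055460782162663675734010791581465035416064,
  37183356733043144877717178201909397104369664, 36946261003772927619274539783935346910167552,
  57049871416932940562226740627836228134240768, 33466526873337196223013303921142327794475520], [5, 1, 2, 4, 3, 6]),
  (24, [119980743284717662856227646127078859964679168, 149060496762430001077214843388870194932747264,
  164243351656226897532619558724932927920013312, 3173845538068309635316638817645314554464256,
  168431785625039648063358521620835354361725952, 128781882188756613825674990962641440901958656], [3, 6, 7, 4, 3, 6]),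
  (40, [143158768990282844631077166708362218917859328, 170568023160958332716182777363166484980826112,
  69762505616603878991096530741185404829959168, 26245352229612127117491079814848953490342912,
  87830548237799482288552509913971052769181696, 173298567839037555271991165159811413861995520], [5, 1, 2, 3, 6, 7]),
  (72, [20790580032099813185782633088980645358601216, 107977367196585582473806095508715555858161664,
  63061484473812020694433332480333770785816576, 52684728547023275153317566514842893966910464,
  44863614825040264839894881343477134112326656, 48878108011841926423807115407053073602846720], [4, 3, 6, 1, 2, 4]),
  (48, [98298228008227913601317528161962011916240896, 62949237150120455290900419993911240104609792,
  119725836566378437817509595248168127044786176, 163422350662209420554852214266861676165863424,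
  101022668206087545984525079934448892362362880, 107273591484130386130632922845552578912059392], [4, 3, 6, 7, 5, 1]),
  (80, [57791163260828120139209445458615036681398272, 107922465428061859723929436735822588308103168,
  164123881308579844227234093550241446765789184, 126393717401647013181359088802090770048747520,
  10693247771041124692972140180657219894781952, 48821225693604520088755500511193218347442176], [7, 5, 1, 5, 1, 2]),
  (96, [54016494704639650622418931634895102446411776, 18201383463952312081838505607961598983409664,
  125887585929113121550120704508208970792439808, 170784956495211946477085379278678977278906368,
  11301586241978121807456777498778137001992192, 138541924842647415580158909291725851245678592], [2, 4, 3, 2, 4, 3])]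

/-- Interpolation tables for line 2, three-point supports. -/
def T23 : List (Nat × List Nat) := [
  (7, [119631802351619870019595029941350694855426048, 13917114149511896595655827358947872795082752,
  76058757592351843910947205258371201192951808, 8990305358956882499483822262748432694329344,
  28404446506181349148112981180126524245901312, 17974153281579513980947160151574494643748864,
  17943731915438576228697646554878267868905472, 25192446823623987426670598724874623569182720,
  158607424294028041559518492232688441478922240]),
  (11, [158541614226341391354627286080996192972587008, 80793654485447904952892913639604298792878080,
  67847882339030298637510995499924742247432192, 67274574969664058731418119668504837994217472,
  8698497927623400827422996200596842519511040, 65087670616120801175995092639660771916169216,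
  82106717028231291092816220612865379780444160, 433624079855151729608850150775625355362304,
  116536979449379693029405399109314414391590912]),
  (19, [63898923363567671275706599105879932806643712, 38255764600743159703136338739486575179071488,
  134330977159355330179277994098248341874851840, 92058235730069702701430864234163630581530624,
  55853806231890419313027046699226212369465344, 47523445324030812271023859483039133711220736,
  101227568789906761631018245062999701746384896, 64641162376033485854454421416103073005453312,
  132706981567451857812314108003033832038367232]),
  (35, [100686914030872376234275473237232149267005440, 126530481666888225235713786397186443864211456,
  60005848679386686195620652022317786515636224, 101507930306468525141618138882805528319787008,
  99220741479669434665108387356881169903271936, 17511949470587192618508148799569923479175168,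
  92649103577218827973977432975349163277991936, 91108335431083638827576771948317181378854912,
  158537172600608746608542826683071589997658112]),
  (67, [95464639581424358890872763142241969742315520, 38029420999164788136149001702654499803365376,
  64231144305385934671854066999188862999248896, 17091086301414188317275603685694994804424704,
  22276289075327783480734772379860266008985600, 8074417070735005905170604999978409899622400,
  9668764242577222896194435333167679625265152, 13293121696670085713490933093268136983035904,
  168506650735551498745555740696800453721079808]),
  (13, [141991593223297347195315479193743300566794240, 21954041393469696563087455773586353918509056,
  48701464289160848611368828308002232728748032, 25194514468925015284759224930274586570932224,
  47858414704344849456535618607055408417882112, 42826223996554871986384799095397569395769344,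
  15178118900529706364100941050441631661244416, 8993607857066319049233555954478674721521664,
  100335407506985930526106449214562275996925952]),
  (21, [24629871750133963335270083905692115513982976, 74652514848220245640504899676077951117705216,
  34040158641834067910199139145109355058446336, 56528965011050513599005912644819753128755200,
  151126673375757264180355786199361204491976704, 42396595576055307765749431155556891154792448,
  67839156009160911153230129569394852001742848, 84928484053474321313169522794233082455326720,
  13628008410425755862948526603847047192002560]),
  (37, [9201535633030731344250808106250126989262848, 13290426349409144291429722634182094663794688,
  60588939130455651896646015265133607360921600, 38475844371160114133350205147867199972655104,
  99453722581244645847486598110453479464517632, 24357588133833133262630861185165161150808064,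
  17653964864655444627859498760026967033053184, 22272002823886541424058707958144557014663168,
  48697224010315665313030531391955233657126912]),
  (69, [129594363848686560544210437896560234495754240, 33923983372504015499430311139309111896768512,
  50378224905200431612201300695493314045100032, 28962441823265387494169785431278615785373696,
  17976411977443643184477293806876413298556928, 22275742445891452918466804042488386224717824,
  41058802699679382853534005064049025392656384, 913709995074816119729871666066697624748032,
  146779974543643978751010249661275328672169984]),
  (25, [133197041999167122498687575668890879874433024, 74379799134167257016013825131748724238991360,
  151633523982055378570552469628567455126536192, 26141370757916591465289563920027563042422784,
  121176874475698142327386242811429298687328256, 111942765347363057014445796990288466383601664,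
  94835575168396057134455986808577524089749504, 158934553368393675089119391387267829833285632,
  175201315309190720462867550637055669260533760]),
  (41, [147914524985817794682095089978672961602715648, 138365780368395452643897342854757822530977792,
  100690163359861652005879376330903520186744832, 157968323493094395620110052765714353712922624,
  50347861370861791600662804420401234201018368, 32321603857613796379250973056642076647768064,
  4761961460087497465802278435424583133708288, 138678274434835384931290909636203728987504640,
  100683152969873722227464480627247559529873408]),
  (73, [108325461109323054099932581951773241434439680, 67170890891963386733052218513488262491815936,
  38787060011036859570647874985673967558328320, 7693283861742096029341585658526757714673664,
  50885756076232147680177215952676474497007616, 66958773981277960507301157462009389055623168,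
  50613826927653097513220457900448681214099456, 32326025373580637452738680392807848518746112,
  155556471575252273052628947655160590409809920]),
  (49, [13288711152026316296723797040366464574963712, 24620703560994144930034856993034105013157888,
  21418513980852305891374949644601907015843840, 5193701940795665223425028722164665992888320,
  138679188403697448368710663721622564166189056, 8755070104777489468439207744056812305399808,
  55217298671699704657265157684051188212580352, 1265650356132671098951835017453654190850048,
  81990680995533894071876126081189521636982784]),
  (81, [63956736806016482974674858717379110379995136, 118514409158647475334192843685692553306308608,
  13918200881667661575663022570822440720793600, 141991869313298329750272902621199396246913024,
  91581137249578307067900617809722093417283584, 47575261289762327286885367305502161461592064,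
  46324593991598437386124072372356147542507520, 134065694737484975049231291965174604336742400,
  168471567091830874669128296238753657532727296]),
  (97, [107526237521525391256788231618547412851752960, 32120974135267995680688722227649197921812480,
  155552459923622715381079322197516803262398464, 7101132728039771605635163244494391344119808,
  5187693575832094010047814469279892778254336, 95148843925527016914307032133990753345470464,
  5531280076435851703022664257264906603085824, 95158045667289173864784383924788948466417664,
  84253325367775907819507045572477569446969344]),
  (14, [99702043669659046698873078887445073183735808, 60868532150736222481047941095636134009077760,
  26451236353879364457909608077673075031834624, 50376104822893181598132043354742117000904704,
  66959575199413973239348228690519829952790528, 84923851657562958627439194428155516527149056,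
  34493667920582986384165614646847641726615552, 50374005276120185802469364584312017122394112,
  138808972070402825764829838670915331491463168]),
  (22, [4386111532570893343600705355382540877168640, 138677267529051792993547864453010639477309440,
  160193513060601641376168818495199934029070336, 151845316478033030351026733840389780843823104,
  111668379562179044387525902366617703850967040, 67724343266026397442561558008539816573337600,
  162830442111318155908767660042438935692279808, 856444194560246769545559078413509500862464,
  54678801940278136139319052653991559037976576]),
  (38, [38262232120517839764187417272365677770506240, 126414939187968648635898043806594244008247296,
  76511529201486004969502698992378962293817344, 118808404099455251022015147989507049387491328,
  27985712438335197344061600136319563171201024, 23765044213258067266666599717595912993767424,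
  24060065027310008160581571932245964340920320, 129282324752066657272138864345053406039670784,
  88401798121566577545381208273404987242512384]),
  (70, [99483103203403258874589163033687732424638464, 24350774677280142231589414683495433699950592,
  74655002410145463212408065678148701407739904, 43163762514970043813230344114082778378764288,
  32749761975411786092271637159152936385806336, 9523599928156143835407823947663367924187136,
  8285957735122787963895496896827203087597568, 5193701883680399779541638883796063873990656,
  138679188242736245754131173257873841346150400]),
  (26, [21415563811238757640664566202592437463187456, 105577309928941437036273877456635420616065024,
  42525090841794964392622929771118891951849472, 134552570801036881763679411435240423728087040,
  168473745416132004870348419879569179671920640, 129594363620225498768678142145054875121254400,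
  28962441890765246655122138773805446455525376, 17976411748982581408944905821650685377413120,
  22275742461468343494070779642617848198987776]),
  (42, [25872160887894443300802934372742533594349568, 47865947589973758140923159027934119378190336,
  147911318192124057569279682803762839538925568, 13624188364934995603535141368546158511652864,
  140844926706981013491642802209541730322644992, 73970984518508686462957525450733194326474752,
  134295404479155125934257904141429369662341120, 168473976161804213892936998948802046259232768,
  25862305316535078014017001523469954543288320]),
  (74, [126523794030072730887941463346881487994748928, 17020079320917033955099569572836135327105024,
  25187141194501854870979393584140049486872576, 80155727029373735367554621135679581716611072,
  63091577901947200793211201770778449388011520, 38263321298245087776017981037563809809694720,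
  33925022190144192883666577658524745051799552, 43161098108606386476064996054755561328246784,
  96011540481464636710545908379303397616123904]),
  (50, [143155466772557419545084045546462412194217984, 87998927039852997534570606365902118333448192,
  148748794303184457342355509039801155361210368, 13075269042567441118737184393395928324636672,
  17085441646461102406230449775307862110142464, 56801616330237815830997303152454646281011200,
  12658900917477246284702669427452779384274944, 140846053352322739941277250983566794832510976,
  171996669694750453666715594157887152200384512]),
  (82, [95151337884362006137820099096066522008813568, 118805996587170981583765913623862093281230848,
  99708507352326297507520354511304340375076864, 60720153794175323114436116477139380589559808,
  142678847577412017789951605150401903085256704, 8284320780461568526725204274031550081826816,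
  9523838514196948133484951605570224032612352, 100333579891183894443507179717054194001149952,
  24354056520432576470719657064238662044385280]),
  (98, [17653487988535071405109686256834230956359680, 25194514764885936221245239083368231122010112,
  47858415176843863583204932803330574377844736, 91377584336793344354064993548485585203101696,
  105126470404622167972554215381943805822894080, 107493573399871644725265384598420532952072192,
  109040885839082973146112998226956117268267008, 1148308767120913464351688259412044403441664,
  162587566080773622070522573700024337482907648]),
  (28, [61175143853680517290127007300901759137218560, 21008930380836843478404347345525470042193920,
  120343352797156008793678565049563093267578880, 56254504020638643422036178590988552506769408,
  34556537154405889310453821073960542203609088, 112213101743303750992195796101286460379234304,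
  67593624336849539056451177608916955392376832, 100747926146262322350131923311141651900334080,
  99211983217174661813952969633407468421971968]),
  (44, [138807949219075341064031751938631249812455424, 8761419099991732454216470079826348784746496,
  100342370044766447907698786037527456793559040, 168471566967215750064291805964723239506214912,
  90702974108219522740018745010034342273613824, 34761495409066332209403156784399887722807296,
  147254923299005322101978547511722838374154240, 319176884804059827361001607875404398329856,
  109357603880555957841718191685557784684789760]),
  (76, [125696024606451757026957348241981777124655104, 76513660275885622838852628457424691475382272,
  74434805823433779713653968826681784221630464, 4622552583465118249594171668690327580049408,
  14208528487627121635574388956134592043220992, 46392171543097069471683920462303915739840512,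
  48109241683492227270291310999059062352642048, 80158772986480059646607848352571743615909888,
  176803596243132838197305237466899606184001536]),
  (52, [48432169483546632072443795813072871767736320, 42820239251349726230457299539747644910403584,
  32748743340229616718340609118809289765748736, 67847882474030016959416753649390605031964672,
  100745645980250524856634963938722101101920256, 13038333046942680727114339578734458369015808,
  56531087871236324780477333628334067803815936, 34559027587670994288272802859851259105050624,
  43157773418620253276411442736842633701490688]),
  (84, [157694417206140723510737369762514612787675136, 50350525865494720528376190282571809490731008,
  95721006808819729687511750647357491743358976, 124869970593097559163761142332831380450377728,
  46326822769447962731642664313819650432696320, 72054710216447212679907423308627976127774720,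
  91578559538995381427919173771502580946436096, 158542075805955170431516916966752912000942080,
  50341618687925727294482021270886093201408000]),
  (100, [33585487648970716765661465141423515306033152, 107905057027461584192498210755389755925004288,
  175997854079705678175684033651893868365873152, 14314643894678029953158794506887735467376640,
  100395068077888435917531552919683507910410240, 126523556887490741703028363694087188242825216,
  25306913463826705975070771445840623535390720, 104669137726158604463629797547611402835394560,
  166981174376163771710571510903648413335748608]),
  (56, [171998367773130422431054606174451227226144768, 120967380168194340664588925060806751342559232,
  42017776355695640158689089426326186069721088, 134058769246742508659626849260323939639361536,
  24481365907108118612253842221302624163332096, 90815331819169010168856413971219132065775616,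
  135187248673698763676132376730685534500290560, 24483687279187509077554104346547109969395712,
  21411801421012188005196196990520191105761280]),
  (88, [101507930259737853414804690226031061357559808, 99220741479669434665109023769551712882655232,
  17511949828855675857411172157825838502379520, 159740298434314740656106657407616091580399616,
  72163636359171727837407402238821724585066496, 92649103816064483466580140300422537401073664,
  116114774045507129102352241693861092269621248, 638269363630072856602397950467502875082752,
  41692238782625037807824478358835822392770560]),
  (104, [148454783058564518616959236824402380288163840, 95470627462776827976620209620826197836038144,
  84257570963532758545249509539057074795839488, 158606955071353164161526348950169498629570560,
  4386111937570048309317573975410507618713600, 138677267705589886183732723246066389344583680,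
  111668379832178481031337658473222387644628992, 67724343671025552408278223714382972510666752,
  84932639298073812637157795933247052378013696]),
  (112, [105258023673596764354687582278547423521931264, 166973766567773966986497307336064155568570368,
  63539603377907433866223370013344164035952640, 138673965446326031159481069008731828021624832,
  46622774718095586494378746241475806871420928, 134055818069823362115925538635204380140503040,
  91968620829744269998057607666346601940516864, 47584467019208324239443119152097453006913536,
  42823518436046329212272788716315628196855808])]

/-- Interpolation tables for line 2, four-point supports. -/
def T24 : List (Nat × List Nat) := [
  (15, [166575181181925865014364129332842444074516480, 63546735132642216866260008205861209443123200,
  9204327728359045566370870369401141947629568, 67274574969664058731418119668504837994217472,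
  8698497927623400827422996200596842519511040, 65087670616120801175995092639660771916169216,
  15178118900529706364100941050441631661244416, 8993607857066319049233555954478674721521664,
  100335407506985930526106449214562275996925952, 75565174690870553635900800141690817600536576,
  25593227008930885945250491575084529752293376, 47867588397319257443818014407258403246227456]),
  (23, [147259568390082625671171563905579574897262592, 54367989866482464290543601495408468864335872,
  109572564425308062804411307884027330238382080, 151845316478033030351026733840389780843823104,
  111668379562179044387525902366617703850967040, 67724343266026397442561558008539816573337600,
  42259938341576439600868164575705935370010624, 96010723099708623590832209048661910146351104,
  38031384289683860359363165898270836651261952, 148454782882026425426774617839019588646715392,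
  95470627192777391332808960799683541056192512, 84257570844109930798947754659836784550412288]),
  (39, [9665155071838585318635587293392387730636800, 28402507365035342271012326037980203024728064,
  167624433978419880582674018232902576065069056, 8398028613209010725931985579236203104911360,
  13288473915983043466001064770518878336942080, 133622198823996667677635331837068131955228672,
  92649103577218827973977432975349163277991936, 91108335431083638827576771948317181378854912,
  158537172600608746608542826683071589997658112, 638269363630072856601946005237696991068160,
  41692238528202491739617924560841502260985856, 116010791862466936777300321333289524138721280]),
  (71, [120970903842572867212201649180589754695139328, 5293660166462586438579965872159521935245312,
  62782631399643848938897992605611976561901568, 28962441823265387494169785431278615785373696,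
  17976411977443643184477293806876413298556928, 22275742445891452918466804042488386224717824,
  8285957735122787963895496896827203087597568, 5193701883680399779541638883796063873990656,
  138679188242736245754131173257873841346150400, 26072718759236356429970973825238145540636672,
  34173462514463519322935339246306821740216320, 4346017301612251617636029315669651518193664]),
  (27, [174341051588369394219877773069007889512185856, 141559792169254033733532486603755912675377152,
  25310076174919864053181794815895820547817472, 67274574969664058731418119668504837994217472,
  8698497927623400827422996200596842519511040, 65087670616120801175995092639660771916169216,
  28962441890765246655122138773805446455525376, 17976411748982581408944905821650685377413120,
  22275742461468343494070779642617848198987776, 48113417816701823343561237386173342225055744,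
  112619940690007842892571339350811185581817856, 176849256870746370247947944583296811750834176]),
  (43, [67845143412821905188025048740920679780237312, 38795828606202359360436484206095443903381504,
  12803061140339382449712732074079237500354560, 67274574969664058731418119668504837994217472,
  8698497927623400827422996200596842519511040, 65087670616120801175995092639660771916169216,
  92649103577218827973977432975349163277991936, 91108335431083638827576771948317181378854912,
  158537172600608746608542826683071589997658112, 80155490920058820721742558994325701973409792,
  138250128103550959406901683820155405230161920, 38508509536465547026066736174836338336612352]),
  (75, [115690119642898508918992049283664072872722432, 54791726727928619226293103111316517526061056,
  55508531211925360236530894810455137078755328, 67274574969664058731418119668504837994217472,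
  8698497927623400827422996200596842519511040, 65087670616120801175995092639660771916169216,
  21135371153363090926810196088488481640153088, 48696815319437815971634224221967133209313280,
  107521817184210058698556465372925826277998592, 32748743137730039235482497626816596312981504,
  83667274237884261429900690849062712305139712, 13623108528149480423412168855933198753890304]),
  (51, [4620411228317978086603178537426908008677376, 176442413536551427545946376027301739348918272,
  47156159030953850885254993460194347309350912, 5193701940795665223425028722164665992888320,
  138679188403697448368710663721622564166189056, 8755070104777489468439207744056812305399808,
  92649103577218827973977432975349163277991936, 91108335431083638827576771948317181378854912,
  158537172600608746608542826683071589997658112, 155044928524129778384804801538994647895687168,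
  64859228210267998880533988916686019132407808, 142020993202338772541854087504397571037888512]),
  (83, [14206698197792258959519230304224661516353536, 84509073071079008892432254530795395945381888,
  13626289121513171972408801076319212576964608, 60859337257613807630472901888326987005820928,
  55970472573080645414529386153257696210747392, 151126130038237029896197117643458590359699456,
  46324593991598437386124072372356147542507520, 134065694737484975049231291965174604336742400,
  168471567091830874669128296238753657532727296, 109147918366720302175616659395021067178213376,
  55627900289014392356601511547018621828251648, 55510367291171261496357153374801588995276800]),
  (99, [91152912919610712775875041214099798134636544, 120588851976073840466830077371717955658235904,
  148451778307526155209703033626291982322663424, 91377584336793344354064993548485585203101696,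
  105126470404622167972554215381943805822894080, 107493573399871644725265384598420532952072192,
  92649103577218827973977432975349163277991936, 91108335431083638827576771948317181378854912,
  158537172600608746608542826683071589997658112, 7100684627628766594822948688950803317178368,
  108434599201605519324391538826301124172627968, 95601245505625783771453386268380644038426624]),
  (29, [60232366965408404212327703487922823986806784, 172417793543187034341605920389480665544065024,
  34490205333577045117229092659706034670288896, 142733305144939717363726911678577502649991168,
  33592030046858305629152678119751259705901056, 50377191555048976598184564047790333657219072,
  15178118900529706364100941050441631661244416, 8993607857066319049233555954478674721521664,
  100335407506985930526106449214562275996925952, 162587565722505138831619467331420090766721024,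
  109986341121767148074251542263262075077214208, 162314511055312965163848766414796451762667520]),
  (45, [13035048592064906218407329656253595450359808, 140841626415597900875445458679683561118253056,
  91580732411384727688589715964527225890095104, 168471566967215750064291805964723239506214912,
  90702974108219522740018745010034342273613824, 34761495409066332209403156784399887722807296,
  15178118900529706364100941050441631661244416, 8993607857066319049233555954478674721521664,
  100335407506985930526106449214562275996925952, 21953129003065896998997217572765950621597696,
  151257334036978993295133278887893397525823488, 148857699276914838395364379816521994863329280]),
  (77, [159291380573870297357843606268623413518221312, 12655038087459932026666450660267099169046528,
  17087764596999065688297836030957111495098368, 28962441823265387494169785431278615785373696,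
  17976411977443643184477293806876413298556928, 22275742445891452918466804042488386224717824,
  15178118900529706364100941050441631661244416, 8993607857066319049233555954478674721521664,
  100335407506985930526106449214562275996925952, 79647959972295631305878958760378543937486848,
  32876893344189533365585388695913146440876032, 9517338308913466932738896279140789846687744]),
  (53, [74646052967279965439205970979637376257441792, 48425014752898131247055877450703407334293504,
  50757201763692554252380386653928582136545280, 5193701940795665223425028722164665992888320,
  138679188403697448368710663721622564166189056, 8755070104777489468439207744056812305399808,
  56531087871236324780477333628334067803815936, 34559027587670994288272802859851259105050624,
  43157773418620253276411442736842633701490688, 71194529068722518327393184735763565769932800,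
  60234521607643224595758742193247398512115712, 21009332596920539007598155959137833293266944]),
  (85, [107904039342469465417553667022170773191131136, 95604511361696192589788216502173019856191488,
  118806231118027632355936257960537662969692160, 28962441823265387494169785431278615785373696,
  17976411977443643184477293806876413298556928, 22275742445891452918466804042488386224717824,
  46324593991598437386124072372356147542507520, 134065694737484975049231291965174604336742400,
  168471567091830874669128296238753657532727296, 63904229080958865243014612277671285893709824,
  84026356951155250477104322536830574201733120, 134545794609598285679805223936435641473318912]),
  (101, [116598844155490812206347034749254901370519552, 116957246397489025493005388103491601951096832,
  81752943184075822628977938918712316640903168, 28962441823265387494169785431278615785373696,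
  17976411977443643184477293806876413298556928, 22275742445891452918466804042488386224717824,
  99079170395635676471444015422396938951589888, 24348407659719065204277654606597667689611264,
  142267033631473313858270057309207150213545984, 118809533771906045920843604690453107626737664,
  125968269737448277008047756647599408879845376, 24912982629420539911884217774767388834676736]),
  (57, [109984221049844256568645121593358379454824448, 1146666713623852360723508670855910562873344,
  81983569667294915627085661711864382056169472, 5193701940795665223425028722164665992888320,
  138679188403697448368710663721622564166189056, 8755070104777489468439207744056812305399808,
  158225814478914121911529263030414439736279040, 50345545315694424586662211326682063090483200,
  124418567964183996241625551568682271566741504, 24350774448819080456057524760359695937044480,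
  74655002706106384148893074483690328786599936, 120000893300162286684861856311789957594103808]),
  (89, [88912703070558934646752122260278210703015936, 112089564004720364380434034920363569265770496,
  176854240561886310014993232873078164172193792, 159740298434314740656106657407616091580399616,
  72163636359171727837407402238821724585066496, 92649103816064483466580140300422537401073664,
  46324593991598437386124072372356147542507520, 134065694737484975049231291965174604336742400,
  168471567091830874669128296238753657532727296, 134298601402292361445637779095866796507676672,
  141072575683143190900058016067870955163107328, 25307828865762693161216741659454387995934720]),
  (105, [42259938518114532791052783561088727013539840, 96010723369708060234643780687825856843350016,
  38031384590837078154383887776058498419392512, 47577882319678347647912448823904858664878080,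
  167204618910714050910989039641492076310970368, 139225511780135290030094824008314131504955392,
  111668379832178481031337658473222387644628992, 67724343671025552408278223714382972510666752,
  84932639298073812637157795933247052378013696, 162830442111318155908767660042438935693639680,
  856444194560246769546324618292568447254528, 54678802371238775397709745822022754363244544]),
  (113, [60299827970611791359791152486496673627652096, 74917342923346583009338269239245410798944256,
  105842935250096493737207553798443876481253376, 5193701940795665223425028722164665992888320,
  138679188403697448368710663721622564166189056, 8755070104777489468439207744056812305399808,
  46324593991598437386124072372356147542507520, 134065694737484975049231291965174604336742400,
  168471567091830874669128296238753657532727296, 50755143599525505978607482971437834659692544,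
  95723882738972727780217059942628546946023424, 9242985676545068576645872347358506264297472]),
  (30, [138253580061925547583031733374054149096931328, 154744401440220740313171486092534218825400320,
  125699758760967997564252634405844321279901696, 151845316478033030351026733840389780843823104,
  111668379562179044387525902366617703850967040, 67724343266026397442561558008539816573337600,
  28962441890765246655122138773805446455525376, 17976411748982581408944905821650685377413120,
  22275742461468343494070779642617848198987776, 133917229695527547596649868385481086944346112,
  17384069206449006470391839390341372255174656, 56805388658520921706789719823245857398325248]),
  (46, [109347723074633829160070319625529009679532032, 116113175856534264083173685559662438236520448,
  108725091361837139530215370124821155805790208, 168471566967215750064291805964723239506214912,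
  90702974108219522740018745010034342273613824, 34761495409066332209403156784399887722807296,
  84509072718002822512064187928278493216931840, 13626289240935999718709937989613033550446592,
  76051880208239931667704563794714814235410432, 157635322689057335503322913158011952724246528,
  50343456958320923901598657276552400450256896, 63956737044862138467276302440483435399184384]),
  (78, [174720381590547649407185477869553268773978112, 17936598639360736925391122902002083713646592,
  56804930324092637743755111675404506707951616, 41985926277151107947704712268181129975136256,
  63659368938784707067851686195573856637321216, 46869556467029349982628983613862686959468544,
  8285957735122787963895496896827203087597568, 5193701883680399779541638883796063873990656,
  138679188242736245754131173257873841346150400, 41328851058144265943211679321422146351366144,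
  40848168319554573372917880908122662622167040, 55217298671699704657265157684051188213055488]),
  (54, [133073493772144060599191644713172195592404992, 171659134198251910564293576261008557284884480,
  104724511786004552365460119877373052651929600, 151845316478033030351026733840389780843823104,
  111668379562179044387525902366617703850967040, 67724343266026397442561558008539816573337600,
  56531087871236324780477333628334067803815936, 34559027587670994288272802859851259105050624,
  43157773418620253276411442736842633701490688, 128730954333274998465034682051829812024606720,
  33920377400220269550364454295583319304765440, 80558365828495180676520800011002363773714432]),
  (86, [158932298026753238664221603529486387249414144, 134296490915349641846283153562560170766467072,
  76197861302110552647793225085667259159937024, 151845316478033030351026733840389780843823104,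
  111668379562179044387525902366617703850967040, 67724343266026397442561558008539816573337600,
  8285957735122787963895496896827203087597568, 5193701883680399779541638883796063873990656,
  138679188242736245754131173257873841346150400, 157688747321817058991145638555309792126304256,
  4380867001205884349150676736273805634240512, 95157601975138150995694868678294565499797504]),
  (102, [94839045735962113913354034414128255288246272, 9240738050657906918399551217371433672900608,
  174478866149471865376186044346180284136882176, 91377584336793344354064993548485585203101696,
  105126470404622167972554215381943805822894080, 107493573399871644725265384598420532952072192,
  8285957735122787963895496896827203087597568, 5193701883680399779541638883796063873990656,
  138679188242736245754131173257873841346150400, 33243003727412560246195468022081338768195584,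
  101231314144207368120331205660140839198261248, 28849161529433609328365940689756567322525696]),
  (58, [142267033377050767790063097682843208471838720, 120464733930816491531348163032324976906338304,
  166440514533870551125219657128285772620103680, 175597459142056385495662700137012540581249024,
  167911291894311490984330957721281965362380800, 74859409938647165474944170214633424019423232,
  28962441890765246655122138773805446455525376, 17976411748982581408944905821650685377413120,
  22275742461468343494070779642617848198987776, 161998707237124941278201799702512668244869120,
  41058802699679382853534005064049025392476160, 913709995074816119729770208974292222214144]),
  (90, [24909363458318134224698737392017148226174976, 26070097184129498000044680825354450929483776,
  104671087817858663671643909626704445402284032, 159740298434314740656106657407616091580399616,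
  72163636359171727837407402238821724585066496, 92649103816064483466580140300422537401073664,
  28962441890765246655122138773805446455525376, 17976411748982581408944905821650685377413120,
  22275742461468343494070779642617848198987776, 17512410821739969186261642035135744204636160,
  25190758439262104996127757830995849551151104, 104675632032992570685908149980668151108730880]),
  (106, [48499111762717320886106295864668086603350016, 147909198395393234506359522097741199813804032,
  95467121966629568578596600496799744970457088, 91377584336793344354064993548485585203101696,
  105126470404622167972554215381943805822894080, 107493573399871644725265384598420532952072192,
  111668379832178481031337658473222387644628992, 67724343671025552408278223714382972510666752,
  84932639298073812637157795933247052378013696, 100751975255121452162861014225871263604670464,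
  64645786209847416069731441991009405120839680, 167327079034815319815721754944394918768541696]),
  (114, [146990150220687511163560025115624019952664576, 41573369547184995579298059535482648534712320,
  910425888081008349394597479619716517756928, 91377584336793344354064993548485585203101696,
  105126470404622167972554215381943805822894080, 107493573399871644725265384598420532952072192,
  138045668034197256564039018945158881372012544, 100680286666238794940339482022425393211375616,
  71824970915030854403854160268870720972423168, 99213906682776673201583562442055561006579712,
  141991593337527878083082314210712725934604288, 21954041746545882943456094225169541642092544]),
  (60, [159222558563814332105329757435083415376953344, 99484191145364219746988827192755034220003328,
  132476553461126612642133667994811980635439104, 168471566967215750064291805964723239506214912,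
  90702974108219522740018745010034342273613824, 34761495409066332209403156784399887722807296,
  56531087871236324780477333628334067803815936, 34559027587670994288272802859851259105050624,
  43157773418620253276411442736842633701490688, 100978943313473596091465920065989495063117824,
  13042615923390781307516258454352035318005760, 24622466657315552301984389014255304962605056]),
  (92, [1270189108970144264570998590125425139187712, 41683281135930522697280961839490680200953856,
  55214102293753660182288002064899564784517120, 159740298434314740656106657407616091580399616,
  72163636359171727837407402238821724585066496, 92649103816064483466580140300422537401073664,
  167624433931689208855860993851241804421201920, 25869670942705303065217520981861369072975872,
  150720768471335437058544346406691992822349824, 26453410057036235473605307241181045368160256,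
  158602545710553469815110623685526567859257344, 80796223545664586445667112756222908561424384]),
  (108, [56736278304643247073955148444019549759209472, 89124018565801245779458585006822204355182592,
  166306103383166685505727475109891223504748544, 168471566967215750064291805964723239506214912,
  90702974108219522740018745010034342273613824, 34761495409066332209403156784399887722807296,
  111668379832178481031337658473222387644628992, 67724343671025552408278223714382972510666752,
  84932639298073812637157795933247052378013696, 92285102185557217179508710492455697967087616,
  172211809825473989920279952562451578944684032, 104720889888946340667526646570087340063653888]),
  (116, [48696815454437534293540010041549106557812736, 107521817334786667596066826311819657162063872,
  63906498883146107643621686508738137931907072, 13995382603896322060560754128583033799901184,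
  38481152887199295508729499039565974736535552, 134335623886005956329846220781246650093142016,
  56531087871236324780477333628334067803815936, 34559027587670994288272802859851259105050624,
  43157773418620253276411442736842633701490688, 81750703912594442818854247647501818525450240,
  116838388424141189204404625336443501918814208, 146671522410892029184242582652170680395431936]),
  (120, [125970198483616445911767854630417056492814336, 141432952114291528587949772594430636922634240,
  21956217277391303871267912109215322701824000, 159740298434314740656106657407616091580399616,
  72163636359171727837407402238821724585066496, 92649103816064483466580140300422537401073664,
  111668379832178481031337658473222387644628992, 67724343671025552408278223714382972510666752,
  84932639298073812637157795933247052378013696, 68142312103546073279406585819540163052830720,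
  46028255107796618738881694670308488999600128, 72058610275232528355418797878247444629553152])]

/-- Interpolation table for line 1, full support. -/
def T17 : List Nat :=
  [1865981683535960308301798607686528, 3731963367071911465289154398525184, 2312194694816298642895706970402304,
  1865981683535957786286007280215424, 2312194694816297706146984477333248, 4097046739937639082962007632125056,
  177023053389616339800410167250271922961776640, 177012165018488870118574541172218307742285696,
  178395072557655247160124075004203578582646656, 116325681989337370911339125827578025807459456,
  162534720122278040867243620094288039317085440, 41330577988292539724684956976837736483792640,
  41692231019654444649401630797346662021870720, 109357642202059368986857143061015857981307392,
  54678821101029842940082198078202597221604608, 141594120764174779714248060836131810972797824,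
  128858582632689699403903544409836064897775872, 104793084564716265489594073926107156547901184,
  54676341428191320957452184713880864812971136, 81992521061977140569248295659890364465030912,
  116541151175911155336504478643238672825072128]

/-- Interpolation table for line 2, full support. -/
def T27 : List Nat :=
  [238845655492602919462630221783875584, 477691310985204667557011763011223552, 295960920936486226290650492211494912,
  119422827746301884006428806213091328, 477691310985205193289217863733067776, 591921841872971041405379345640783872, 2080768,
  1171368248680556527616, 659421701033923108823373033810952192, 41054158013601426711041828238526844530999296,
  55210799151799730724914676301939406390853632, 147261401722603564434572541642290821992775680,
  55624568085774863930533642582423567590899712, 116323810735119735855478954457955880601976832,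
  146673432059792173046145861240671174424166400, 80456072990391511577486600573563928603639808,
  32880417319721609398675067207666472757002240, 159518349411067153591433083539746159839641600,
  109150699750340187334340765009312174250278912, 162315323665348170240580681486927213790199808,
  55266845847742306805602773096301999060484096]

/-! ### The finite computations -/

def tri (h : List Nat) : List Nat := [h.getD 0 0, h.getD 1 0, h.getD 2 0]

def sl (k : Nat) (h : List Nat) : List Nat := tri (h.drop k)

def chunk {α : Type} (i : Nat) (l : List α) : List α := (l.drop (12 * i)).take 12

def runA1 (i : Nat) : Bool :=
  run 13 9 ((chunk i T23).map fun p => lin (sl 3 p.2) 1 :: (sl 6 p.2 ++ (sl 6 p.2 ++ VE)))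
    (T03.map fun p => lin (sl 3 p.2) 1 :: sl 6 p.2)
    (T13.map fun p => lin (sl 3 p.2) 1 :: ([0, 0, 0] ++ sl 6 p.2))

def runA0 : Bool :=
  run 12 6 (T23.map fun p => lin (sl 6 p.2) 1 :: (sl 6 p.2 ++ VE))
    (T03.map fun p => [lin (sl 6 p.2) 1])
    (T13.map fun p => 0 :: sl 6 p.2)

def cs4 (t i : Nat) : List (List Nat) :=
  (chunk i T24).map fun p =>
    Nat.xor (lin (sl 3 p.2) 1) (lin (sl 6 p.2) t) :: (sl 6 p.2 ++ (sl 9 p.2 ++ VE))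

def cs3 (t i : Nat) : List (List Nat) :=
  (chunk i T23).map fun p =>
    Nat.xor (lin (sl 3 p.2) 1) (lin (sl 6 p.2) t) :: (sl 6 p.2 ++ ([0, 0, 0] ++ VE))

def runC (i : Nat) : Bool :=
  T12.all fun p1 => run 13 9 (cs4 (lin (sl 3 p1.2.2) 1) i)
    (T03.map fun p => lin (sl 3 p.2) 1 :: sl 6 p.2)
    [[lin (sl 3 p1.2.1) 1]]

def runB1 (i : Nat) : Bool :=
  T02.all fun p0 => run 13 9 (cs3 (lin (sl 3 p0.2.2) 1) i)
    [[lin (sl 3 p0.2.1) 1]]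
    (T14.map fun p => lin (sl 3 p.2) 1 :: (sl 6 p.2 ++ sl 9 p.2))

def runB2 (i : Nat) : Bool :=
  T02.all fun p0 => run 13 9 (cs4 (lin (sl 3 p0.2.2) 1) i)
    [[lin (sl 3 p0.2.1) 1]]
    (T13.map fun p => lin (sl 3 p.2) 1 :: sl 6 p.2)

def runFull (h : List Nat) (bs : List (List Nat)) : Bool :=
  run 13 13 [0 :: ((h.drop 9).take 10 ++ VE)]
    ([0, 1, 2, 3].map fun q => [lin (h.drop 19) q]) bs

def bsE : List (List Nat) :=
  T02.flatMap fun p0 => T12.map fun p1 =>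
    [Nat.xor (Nat.xor (lin (sl 3 p0.2.1) 1) (lin (sl 3 p1.2.1) 1))
      (Nat.xor (lin (sl 3 T27) 1)
        (lin (sl 6 T27) (Nat.xor (lin (sl 3 p0.2.2) 1) (lin (sl 3 p1.2.2) 1))))]

def bsF : List (List Nat) :=
  T03.map fun p => [Nat.xor (lin (sl 6 p.2) 1) (lin (sl 6 T27) 1)]

def bsZ (T : List (Nat × List Nat)) (h : List Nat) (t : Nat) : List (List Nat) :=
  T.flatMap fun p => (List.range 8).map fun r =>
    [Nat.xor (Nat.xor (lin (sl 6 p.2) t) (lin (sl 9 p.2) r)) (lin (sl 6 h) t)]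

theorem runA1_0 : runA1 0 = true := by decide +kernel
theorem runA1_1 : runA1 1 = true := by decide +kernel
theorem runA1_2 : runA1 2 = true := by decide +kernel
theorem runA0_t : runA0 = true := by decide +kernel
theorem runC_0 : runC 0 = true := by decide +kernel
theorem runC_1 : runC 1 = true := by decide +kernel
theorem runC_2 : runC 2 = true := by decide +kernel
theorem runB1_0 : runB1 0 = true := by decide +kernel
theorem runB1_1 : runB1 1 = true := by decide +kernel
theorem runB1_2 : runB1 2 = true := by decide +kernel
theorem runB2_0 : runB2 0 = true := by decide +kernel
theorem runB2_1 : runB2 1 = true := by decide +kernel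
theorem runB2_2 : runB2 2 = true := by decide +kernel
theorem runE_t : runFull T27 bsE = true := by decide +kernel
theorem runF_t : runFull T27 bsF = true := by decide +kernel
theorem runZ1_0 : runFull T27 (bsZ T14 T27 0) = true := by decide +kernel
theorem runZ1_1 : runFull T27 (bsZ T14 T27 1) = true := by decide +kernel
theorem runZ2_0 : runFull T17 (bsZ T24 T17 0) = true := by decide +kernel
theorem runZ2_1 : runFull T17 (bsZ T24 T17 1) = true := by decide +kernel

section LineArguments

/-! ### Lines, supports and symmetries -/

attribute [local irreducible] lin

/-- The packed word with coefficients `K`. -/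
def cw (K : Nat) : Nat := lin GEN K

/-- The `i`-th line of a word. -/
def ln (i w : Nat) : Nat :=
  ((w >>> (7 * i)) % 2 ^ 7) ^^^
    ((((w >>> (49 + 7 * i)) % 2 ^ 7) <<< 7) ^^^ (((w >>> (98 + 7 * i)) % 2 ^ 7) <<< 14))

theorem XH_ln (i : Nat) : XH (ln i) := by
  intro a b
  simp only [ln, Nat.shiftRight_xor_distrib, Nat.xor_mod_two_pow, Nat.shiftLeft_xor_distrib]
  ac_rfl

theorem XH_cw : XH cw := XH_lin GEN

attribute [irreducible] cw

/-- The support of a line. -/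
def sup (c : Nat) : Nat := (c ||| ((c >>> 7) ||| (c >>> 14))) % 2 ^ 7

theorem testBit_sup (c j : Nat) : (sup c).testBit j =
    (decide (j < 7) && (c.testBit j || (c.testBit (7 + j) || c.testBit (14 + j)))) := by
  simp [sup, Nat.testBit_mod_two_pow, Nat.testBit_shiftRight, -Nat.reducePow]

theorem sup_lt (c : Nat) : sup c < 128 := Nat.mod_lt _ (by norm_num)

theorem ln_lt (i w : Nat) : ln i w < 2 ^ 21 := by
  have h : ∀ x k, k ≤ 14 → (x % 2 ^ 7) <<< k < 2 ^ 21 := by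
    intro x k hk
    rw [Nat.shiftLeft_eq]
    calc x % 2 ^ 7 * 2 ^ k < 2 ^ 7 * 2 ^ k :=
          Nat.mul_lt_mul_of_pos_right (Nat.mod_lt _ (by positivity)) (by positivity)
      _ ≤ 2 ^ 7 * 2 ^ 14 := Nat.mul_le_mul_left _ (Nat.pow_le_pow_right (by norm_num) hk)
      _ = 2 ^ 21 := by norm_num
  unfold ln
  apply Nat.xor_lt_two_pow
  · simpa using h (w >>> (7 * i)) 0 (by norm_num)
  · exact Nat.xor_lt_two_pow (h _ 7 (by norm_num)) (h _ 14 (by norm_num))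

theorem testBit_ln (i w j : Nat) (hj : j < 7) :
    (ln i w).testBit j = w.testBit (7 * i + j) ∧
    (ln i w).testBit (7 + j) = w.testBit (49 + 7 * i + j) ∧
    (ln i w).testBit (14 + j) = w.testBit (98 + 7 * i + j) := by
  have e1 : ¬ (7 ≤ j) := by omega
  have e2 : ¬ (14 ≤ j) := by omega
  have e3 : ¬ (14 ≤ 7 + j) := by omega
  have e4 : ¬ (7 + j < 7) := by omega
  have e5 : ¬ (14 + j < 7) := by omega
  have e6 : ¬ (14 + j - 7 < 7) := by omega
  have e7 : 7 ≤ 7 + j := by omega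
  have e8 : 14 ≤ 14 + j := by omega
  have e9 : 7 ≤ 14 + j := by omega
  have e10 : 7 + j - 7 = j := by omega
  have e11 : 14 + j - 14 = j := by omega
  simp only [ln, Nat.testBit_xor, Nat.testBit_mod_two_pow, Nat.testBit_shiftRight,
    Nat.testBit_shiftLeft, hj, e1, e2, e3, e4, e5, e6, e7, e8, e9, e10, e11, decide_true,
    decide_false, Bool.true_and, Bool.false_and, Bool.xor_false, Bool.false_xor, and_self]

theorem testBit_nz (w k : Nat) (hk : k < 49) : (nz w).testBit k =
    (w.testBit k || (w.testBit (49 + k) || w.testBit (98 + k))) := by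
  simp only [nz, pl_eq, Nat.testBit_or, Nat.testBit_mod_two_pow, Nat.testBit_shiftRight, hk,
    decide_true, Bool.true_and, Nat.mul_zero, Nat.zero_add, Nat.mul_one]

theorem nz_lt (w : Nat) : nz w < 2 ^ 49 := by
  have h : ∀ d, pl d w < 2 ^ 49 := fun d => by rw [pl_eq]; exact Nat.mod_lt _ (by positivity)
  exact Nat.or_lt_two_pow (h 0) (Nat.or_lt_two_pow (h 1) (h 2))

theorem sup_ln (i w : Nat) (hi : i < 7) : sup (ln i w) = (nz w >>> (7 * i)) % 2 ^ 7 := by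
  apply Nat.eq_of_testBit_eq
  intro j
  rw [testBit_sup, Nat.testBit_mod_two_pow, Nat.testBit_shiftRight]
  by_cases hj : j < 7
  · obtain ⟨h1, h2, h3⟩ := testBit_ln i w j hj
    rw [h1, h2, h3, testBit_nz _ _ (by omega)]
    simp only [Nat.add_assoc]
  · simp [hj]

/-- Number of ones among the first seven bits. -/
def pop (n : Nat) : Nat :=
  n % 2 + n / 2 % 2 + n / 4 % 2 + n / 8 % 2 + n / 16 % 2 + n / 32 % 2 + n / 64 % 2

theorem sum_seven (f : Nat → Nat) : ∑ k ∈ Finset.range 49, f k =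
    ∑ i ∈ Finset.range 7, ∑ j ∈ Finset.range 7, f (7 * i + j) := by
  simp [Finset.sum_range_succ, Nat.add_assoc]

theorem wt_eq (w : Nat) : wt w = ∑ i ∈ Finset.range 7, pop (sup (ln i w)) := by
  have h0 := nz_lt w
  have hb : ∀ i < 7, pop (sup (ln i w)) =
      ∑ j ∈ Finset.range 7, (nz w / 2 ^ (7 * i + j)) % 2 := by
    intro i hi
    rw [sup_ln i w hi, Nat.shiftRight_eq_div_pow]
    simp only [Nat.pow_add, ← Nat.div_div_eq_div_mul, Finset.sum_range_succ, Finset.sum_range_zero]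
    generalize nz w / 2 ^ (7 * i) = X
    simp only [pop]
    omega
  rw [Finset.sum_congr rfl (fun i hi => hb i (Finset.mem_range.mp hi))]
  unfold wt cnt
  have hl : ∀ i, lane 1 i (nz w) = (nz w / 2 ^ i) % 2 := by
    intro i; simp [lane, Nat.shiftRight_eq_div_pow]
  simp only [hl]
  generalize nz w = N at *
  have hz : ∀ k, 49 ≤ k → N / 2 ^ k % 2 = 0 := by
    intro k hk
    rw [Nat.div_eq_of_lt (lt_of_lt_of_le h0 (Nat.pow_le_pow_right (by norm_num) hk))]
  rw [show 64 = 49 + 15 from rfl, Finset.sum_range_add,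
    Finset.sum_eq_zero (s := Finset.range 15) (fun k _ => hz _ (by omega)), Nat.add_zero]
  exact sum_seven (fun k => N / 2 ^ k % 2)

attribute [local irreducible] wt
attribute [irreducible] pop

theorem eq_zero_of_sup (c : Nat) (hc : c < 2 ^ 21) (h : sup c = 0) : c = 0 := by
  apply Nat.eq_of_testBit_eq
  intro b
  rw [Nat.zero_testBit]
  by_cases hb : b < 21
  · have h1 : (sup c).testBit (b % 7) = false := by rw [h, Nat.zero_testBit]
    rw [testBit_sup] at h1
    have h2 : b % 7 < 7 := Nat.mod_lt _ (by norm_num)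
    simp only [h2, decide_true, Bool.true_and, Bool.or_eq_false_iff] at h1
    obtain ⟨a1, a2, a3⟩ := h1
    have : b = b % 7 ∨ b = 7 + b % 7 ∨ b = 14 + b % 7 := by omega
    rcases this with e | e | e <;> rw [e] <;> assumption
  · exact Nat.testBit_lt_two_pow (lt_of_lt_of_le hc (Nat.pow_le_pow_right (by norm_num) (by omega)))

theorem testBit_sup_of (c b : Nat) (hb : b < 21) (h : c.testBit b = true) :
    (sup c).testBit (b % 7) = true := by
  rw [testBit_sup]
  have h2 : b % 7 < 7 := Nat.mod_lt _ (by norm_num)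
  have : b = b % 7 ∨ b = 7 + b % 7 ∨ b = 14 + b % 7 := by omega
  rcases this with e | e | e <;> rw [e] at h <;> simp [h, h2]

/-- Multiplication by `α` on a line. -/
def maL (c : Nat) : Nat :=
  ((c >>> 14) % 2 ^ 7) ^^^
    ((((c % 2 ^ 7) ^^^ ((c >>> 14) % 2 ^ 7)) <<< 7) ^^^ (((c >>> 7) % 2 ^ 7) <<< 14))

/-- Rotation of a seven bit number. -/
def rot (x : Nat) : Nat := ((x % 2 ^ 7) >>> 1) ^^^ ((x % 2 ^ 1) <<< 6)

/-- Rotation of a line. -/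
def ryL (c : Nat) : Nat := rot c ^^^ ((rot (c >>> 7) <<< 7) ^^^ (rot (c >>> 14) <<< 14))

theorem XH_maL : XH maL := by
  intro a b
  simp only [maL, Nat.shiftRight_xor_distrib, Nat.xor_mod_two_pow, Nat.shiftLeft_xor_distrib]
  ac_rfl

theorem XH_rot : XH rot := by
  intro a b
  simp only [rot, Nat.shiftRight_xor_distrib, Nat.xor_mod_two_pow, Nat.shiftLeft_xor_distrib]
  ac_rfl

theorem XH_ryL : XH ryL := by
  intro a b
  simp only [ryL, XH_rot _ _, Nat.shiftRight_xor_distrib, Nat.shiftLeft_xor_distrib]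
  ac_rfl

theorem sup_maL (c : Nat) : sup (maL c) = sup c := by
  apply Nat.eq_of_testBit_eq
  intro j
  rw [testBit_sup, testBit_sup]
  by_cases hj : j < 7
  · simp only [maL, Nat.testBit_xor, Nat.testBit_mod_two_pow, Nat.testBit_shiftRight,
      Nat.testBit_shiftLeft]
    have e1 : ¬ (7 ≤ j) := by omega
    have e2 : ¬ (14 ≤ j) := by omega
    simp [hj, e1, e2, show 14 + j - 7 = 7 + j by omega, show ¬ (14 ≤ 7 + j) by omega,
      show ¬ (14 + j < 7) by omega]
    cases c.testBit j <;> cases c.testBit (7 + j) <;> cases c.testBit (14 + j) <;> rfl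
  · simp [hj]

theorem testBit_rot (x j : Nat) (hj : j < 7) : (rot x).testBit j = x.testBit ((j + 1) % 7) := by
  simp only [rot, Nat.testBit_xor, Nat.testBit_mod_two_pow, Nat.testBit_shiftRight,
      Nat.testBit_shiftLeft]
  interval_cases j <;> simp

theorem testBit_rot_ge (x j : Nat) (hj : 7 ≤ j) : (rot x).testBit j = false := by
  simp only [rot, Nat.testBit_xor, Nat.testBit_mod_two_pow, Nat.testBit_shiftRight,
      Nat.testBit_shiftLeft]
  have e1 : ¬ (1 + j < 7) := by omega
  have e2 : ¬ (j - 6 < 1) := by omega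
  simp [e1, e2]

theorem sup_ryL (c : Nat) : sup (ryL c) = rot (sup c) := by
  apply Nat.eq_of_testBit_eq
  intro j
  rw [testBit_sup]
  by_cases hj : j < 7
  · have e1 : ¬ (7 ≤ j) := by omega
    have e2 : ¬ (14 ≤ j) := by omega
    have e3 : ¬ (14 ≤ 7 + j) := by omega
    have e4 : (rot c).testBit (7 + j) = false := testBit_rot_ge _ _ (by omega)
    have e5 : (rot c).testBit (14 + j) = false := testBit_rot_ge _ _ (by omega)
    have e6 : (rot (c >>> 7)).testBit (14 + j - 7) = false := testBit_rot_ge _ _ (by omega)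
    have e7 : (j + 1) % 7 < 7 := Nat.mod_lt _ (by norm_num)
    rw [testBit_rot _ _ hj, testBit_sup]
    simp only [ryL, Nat.testBit_xor, Nat.testBit_shiftLeft, e4, e5, e6]
    simp [hj, e1, e2, e3, testBit_rot, Nat.testBit_shiftRight, e7]
  · rw [testBit_rot_ge _ _ (by omega)]; simp [hj]

/-! Generator checks -/

theorem RX_gen : ∀ i < 7, ∀ k < 48,
    ln i (cw (lin RX (2 ^ k))) = ln ((i + 1) % 7) (cw (2 ^ k)) := by decide +kernel

theorem RY_gen : ∀ i < 7, ∀ k < 48,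
    ln i (cw (lin RY (2 ^ k))) = ryL (ln i (cw (2 ^ k))) := by decide +kernel

theorem MA_gen : ∀ i < 7, ∀ k < 48,
    ln i (cw (lin MA (2 ^ k))) = maL (ln i (cw (2 ^ k))) := by decide +kernel

theorem ln_RX (i : Nat) (hi : i < 7) (K : Nat) (hK : K < 2 ^ 48) :
    ln i (cw (lin RX K)) = ln ((i + 1) % 7) (cw K) :=
  ((XH_ln i).comp (XH_cw.comp (XH_lin RX))).ext_all ((XH_ln ((i + 1) % 7)).comp XH_cw) 48
    (RX_gen i hi) K hK

theorem ln_RY (i : Nat) (hi : i < 7) (K : Nat) (hK : K < 2 ^ 48) :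
    ln i (cw (lin RY K)) = ryL (ln i (cw K)) :=
  ((XH_ln i).comp (XH_cw.comp (XH_lin RY))).ext_all (XH_ryL.comp ((XH_ln i).comp XH_cw)) 48
    (RY_gen i hi) K hK

theorem ln_MA (i : Nat) (hi : i < 7) (K : Nat) (hK : K < 2 ^ 48) :
    ln i (cw (lin MA K)) = maL (ln i (cw K)) :=
  ((XH_ln i).comp (XH_cw.comp (XH_lin MA))).ext_all (XH_maL.comp ((XH_ln i).comp XH_cw)) 48
    (MA_gen i hi) K hK

theorem RX_lt (K : Nat) : lin RX K < 2 ^ 48 := lin_lt 48 RX (by decide +kernel) K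
theorem RY_lt (K : Nat) : lin RY K < 2 ^ 48 := lin_lt 48 RY (by decide +kernel) K
theorem MA_lt (K : Nat) : lin MA K < 2 ^ 48 := lin_lt 48 MA (by decide +kernel) K

/-- Support of line `i` of the word with coefficients `K`. -/
def us (i K : Nat) : Nat := sup (ln i (cw K))

theorem wt_cw (K : Nat) : wt (cw K) = ∑ i ∈ Finset.range 7, pop (us i K) := wt_eq _

theorem us_lt (i K : Nat) : us i K < 128 := sup_lt _

theorem us_RX (i : Nat) (hi : i < 7) (K : Nat) (hK : K < 2 ^ 48) :
    us i (lin RX K) = us ((i + 1) % 7) K := by unfold us; rw [ln_RX i hi K hK]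

theorem us_RY (i : Nat) (hi : i < 7) (K : Nat) (hK : K < 2 ^ 48) :
    us i (lin RY K) = rot (us i K) := by unfold us; rw [ln_RY i hi K hK, sup_ryL]

theorem us_MA (i : Nat) (hi : i < 7) (K : Nat) (hK : K < 2 ^ 48) :
    us i (lin MA K) = us i K := by unfold us; rw [ln_MA i hi K hK, sup_maL]

attribute [irreducible] us

theorem wt_cw7 (K : Nat) : wt (cw K) = pop (us 0 K) + pop (us 1 K) + pop (us 2 K) + pop (us 3 K)
    + pop (us 4 K) + pop (us 5 K) + pop (us 6 K) := by
  rw [wt_cw]; simp [Finset.sum_range_succ]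

theorem pop_rot : ∀ n < 128, pop (rot n) = pop n := by decide +kernel

/-! Rotations -/

theorem add_seven (a b c d e f g : Nat) :
    b + c + d + e + f + g + a = a + b + c + d + e + f + g := by omega

theorem mod_shift (i r : Nat) : ((i + 1) % 7 + r) % 7 = (i + (r + 1)) % 7 := by omega

theorem rotX (r : Nat) (K : Nat) (hK : K < 2 ^ 48) : ∃ K' < 2 ^ 48, wt (cw K') = wt (cw K) ∧
    ∀ i < 7, us i K' = us ((i + r) % 7) K := by
  induction r with
  | zero => exact ⟨K, hK, rfl, fun i hi => by rw [Nat.add_zero, Nat.mod_eq_of_lt hi]⟩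
  | succ r ih =>
    obtain ⟨K', h1, h2, h3⟩ := ih
    refine ⟨lin RX K', RX_lt _, ?_, ?_⟩
    · rw [← h2, wt_cw7, wt_cw7]
      have a0 : us 0 (lin RX K') = us 1 K' := us_RX 0 (by norm_num) K' h1
      have a1 : us 1 (lin RX K') = us 2 K' := us_RX 1 (by norm_num) K' h1
      have a2 : us 2 (lin RX K') = us 3 K' := us_RX 2 (by norm_num) K' h1
      have a3 : us 3 (lin RX K') = us 4 K' := us_RX 3 (by norm_num) K' h1
      have a4 : us 4 (lin RX K') = us 5 K' := us_RX 4 (by norm_num) K' h1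
      have a5 : us 5 (lin RX K') = us 6 K' := us_RX 5 (by norm_num) K' h1
      have a6 : us 6 (lin RX K') = us 0 K' := us_RX 6 (by norm_num) K' h1
      rw [a0, a1, a2, a3, a4, a5, a6]
      exact add_seven _ _ _ _ _ _ _
    · intro i hi
      rw [us_RX i hi K' h1, h3 _ (Nat.mod_lt _ (by norm_num))]
      rw [mod_shift]

theorem rotY (r : Nat) (K : Nat) (hK : K < 2 ^ 48) : ∃ K' < 2 ^ 48, wt (cw K') = wt (cw K) ∧
    (∀ i < 7, pop (us i K') = pop (us i K)) ∧ us 0 K' = rot^[r] (us 0 K) := by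
  induction r with
  | zero => exact ⟨K, hK, rfl, fun i hi => rfl, by rw [Function.iterate_zero, id_eq]⟩
  | succ r ih =>
    obtain ⟨K', h1, h2, h3, h4⟩ := ih
    have h5 : ∀ i < 7, pop (us i (lin RY K')) = pop (us i K) := by
      intro i hi
      rw [us_RY i hi K' h1, pop_rot _ (us_lt _ _), h3 i hi]
    refine ⟨lin RY K', RY_lt _, ?_, h5, ?_⟩
    · rw [wt_cw, wt_cw]
      exact Finset.sum_congr rfl (fun i hi => h5 i (Finset.mem_range.mp hi))
    · rw [us_RY 0 (by norm_num) K' h1, h4, Function.iterate_succ_apply']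

theorem rot_odd : ∀ n < 128, n = 0 ∨ ∃ r < 7, rot^[r] n % 2 = 1 := by decide +kernel

theorem cycle (w : Nat → Nat) (h : w 0 + w 1 + w 2 + w 3 + w 4 + w 5 + w 6 ≤ 23) :
    ∃ r < 7, w (r % 7) ≤ 3 ∧ w (r % 7) + w ((1 + r) % 7) ≤ 6 ∧
      w (r % 7) + w ((1 + r) % 7) + w ((2 + r) % 7) ≤ 9 := by
  by_contra hc
  push Not at hc
  have a0 := hc 0 (by norm_num)
  have a1 := hc 1 (by norm_num)
  have a2 := hc 2 (by norm_num)
  have a3 := hc 3 (by norm_num)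
  have a4 := hc 4 (by norm_num)
  have a5 := hc 5 (by norm_num)
  have a6 := hc 6 (by norm_num)
  norm_num at a0 a1 a2 a3 a4 a5 a6
  omega

/-- Normalisation by the two rotations. -/
theorem normalise (K : Nat) (hK : K < 2 ^ 48) (h : wt (cw K) ≤ 23) :
    ∃ K' < 2 ^ 48, wt (cw K') = wt (cw K) ∧ pop (us 0 K') ≤ 3 ∧
      pop (us 0 K') + pop (us 1 K') ≤ 6 ∧ pop (us 0 K') + pop (us 1 K') + pop (us 2 K') ≤ 9 ∧
      (us 0 K' = 0 ∨ us 0 K' % 2 = 1) := by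
  rw [wt_cw7] at h
  obtain ⟨r, hr, h1, h2, h3⟩ := cycle (fun i => pop (us i K)) h
  obtain ⟨K1, k1, k2, k3⟩ := rotX r K hK
  have e0 := k3 0 (by norm_num)
  rw [Nat.zero_add] at e0
  rw [← e0, ← k3 1 (by norm_num)] at h2
  rw [← e0, ← k3 1 (by norm_num), ← k3 2 (by norm_num)] at h3
  rw [← e0] at h1
  rcases rot_odd _ (us_lt 0 K1) with hz | ⟨q, _, hq⟩
  · exact ⟨K1, k1, k2, h1, h2, h3, Or.inl hz⟩
  · obtain ⟨K2, l1, l2, l3, l4⟩ := rotY q K1 k1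
    refine ⟨K2, l1, l2.trans k2, ?_, ?_, ?_, Or.inr (by rw [l4]; exact hq)⟩
    · rw [l3 0 (by norm_num)]; exact h1
    · rw [l3 0 (by norm_num), l3 1 (by norm_num)]; exact h2
    · rw [l3 0 (by norm_num), l3 1 (by norm_num), l3 2 (by norm_num)]; exact h3

/-! ### Syndromes -/

/-- The `r`-th three bit digit. -/
def dg (r x : Nat) : Nat := (x >>> (3 * r)) % 2 ^ 3

theorem dg_lt (r x : Nat) : dg r x < 8 := Nat.mod_lt _ (by norm_num)

theorem XH_dg (r : Nat) : XH (dg r) := by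
  intro a b
  simp only [dg, Nat.shiftRight_xor_distrib, Nat.xor_mod_two_pow]

/-- Multiplication by `α` on three bit digits. -/
def mu (x : Nat) : Nat := ((x % 2 ^ 2) <<< 1) ^^^ ((x >>> 2) ^^^ ((x >>> 2) <<< 1))

theorem XH_mu : XH mu := by
  intro a b
  simp only [mu, Nat.shiftRight_xor_distrib, Nat.xor_mod_two_pow, Nat.shiftLeft_xor_distrib]
  ac_rfl

/-- Syndromes of the lines `0, 1, 2`. -/
def sg0 (K : Nat) : Nat := lin SYN0 (ln 0 (cw K))
def sg1 (K : Nat) : Nat := lin SYN1 (ln 1 (cw K))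
def sg2 (K : Nat) : Nat := lin SYN2 (ln 2 (cw K))

theorem XH_sg0 : XH sg0 := (XH_lin SYN0).comp ((XH_ln 0).comp XH_cw)
theorem XH_sg1 : XH sg1 := (XH_lin SYN1).comp ((XH_ln 1).comp XH_cw)
theorem XH_sg2 : XH sg2 := (XH_lin SYN2).comp ((XH_ln 2).comp XH_cw)

theorem syn_gen : ∀ k < 48, dg 0 (sg0 (2 ^ k)) = 0 ∧ dg 0 (sg1 (2 ^ k)) = 0 ∧
    dg 0 (sg2 (2 ^ k)) = 0 ∧ dg 1 (sg1 (2 ^ k)) = dg 1 (sg0 (2 ^ k)) ∧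
    dg 1 (sg2 (2 ^ k)) = dg 1 (sg0 (2 ^ k)) ∧
    dg 2 (sg2 (2 ^ k)) = dg 2 (sg0 (2 ^ k)) ^^^ dg 2 (sg1 (2 ^ k)) := by decide +kernel

theorem d00 (K : Nat) (hK : K < 2 ^ 48) : dg 0 (sg0 K) = 0 :=
  ((XH_dg 0).comp XH_sg0).ext_all XH_const 48 (fun k hk => (syn_gen k hk).1) K hK

theorem d01 (K : Nat) (hK : K < 2 ^ 48) : dg 0 (sg1 K) = 0 :=
  ((XH_dg 0).comp XH_sg1).ext_all XH_const 48 (fun k hk => (syn_gen k hk).2.1) K hK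

theorem d02 (K : Nat) (hK : K < 2 ^ 48) : dg 0 (sg2 K) = 0 :=
  ((XH_dg 0).comp XH_sg2).ext_all XH_const 48 (fun k hk => (syn_gen k hk).2.2.1) K hK

theorem d11 (K : Nat) (hK : K < 2 ^ 48) : dg 1 (sg1 K) = dg 1 (sg0 K) :=
  ((XH_dg 1).comp XH_sg1).ext_all ((XH_dg 1).comp XH_sg0) 48
    (fun k hk => (syn_gen k hk).2.2.2.1) K hK

theorem d12 (K : Nat) (hK : K < 2 ^ 48) : dg 1 (sg2 K) = dg 1 (sg0 K) :=
  ((XH_dg 1).comp XH_sg2).ext_all ((XH_dg 1).comp XH_sg0) 48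
    (fun k hk => (syn_gen k hk).2.2.2.2.1) K hK

theorem d22 (K : Nat) (hK : K < 2 ^ 48) : dg 2 (sg2 K) = dg 2 (sg0 K) ^^^ dg 2 (sg1 K) :=
  ((XH_dg 2).comp XH_sg2).ext_all (((XH_dg 2).comp XH_sg0).xor ((XH_dg 2).comp XH_sg1)) 48
    (fun k hk => (syn_gen k hk).2.2.2.2.2) K hK

theorem mu_gen : ∀ k < 48, dg 1 (sg0 (lin MA (2 ^ k))) = mu (dg 1 (sg0 (2 ^ k))) ∧
    dg 2 (sg0 (lin MA (2 ^ k))) = mu (dg 2 (sg0 (2 ^ k))) ∧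
    dg 2 (sg1 (lin MA (2 ^ k))) = mu (dg 2 (sg1 (2 ^ k))) := by decide +kernel

theorem mu_s (K : Nat) (hK : K < 2 ^ 48) : dg 1 (sg0 (lin MA K)) = mu (dg 1 (sg0 K)) :=
  ((XH_dg 1).comp (XH_sg0.comp (XH_lin MA))).ext_all (XH_mu.comp ((XH_dg 1).comp XH_sg0)) 48
    (fun k hk => (mu_gen k hk).1) K hK

theorem mu_t0 (K : Nat) (hK : K < 2 ^ 48) : dg 2 (sg0 (lin MA K)) = mu (dg 2 (sg0 K)) :=
  ((XH_dg 2).comp (XH_sg0.comp (XH_lin MA))).ext_all (XH_mu.comp ((XH_dg 2).comp XH_sg0)) 48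
    (fun k hk => (mu_gen k hk).2.1) K hK

theorem mu_t1 (K : Nat) (hK : K < 2 ^ 48) : dg 2 (sg1 (lin MA K)) = mu (dg 2 (sg1 K)) :=
  ((XH_dg 2).comp (XH_sg1.comp (XH_lin MA))).ext_all (XH_mu.comp ((XH_dg 2).comp XH_sg1)) 48
    (fun k hk => (mu_gen k hk).2.2) K hK

theorem scale (n : Nat) (K : Nat) (hK : K < 2 ^ 48) : ∃ K' < 2 ^ 48, wt (cw K') = wt (cw K) ∧
    (∀ i < 7, us i K' = us i K) ∧ dg 1 (sg0 K') = mu^[n] (dg 1 (sg0 K)) ∧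
    dg 2 (sg0 K') = mu^[n] (dg 2 (sg0 K)) ∧ dg 2 (sg1 K') = mu^[n] (dg 2 (sg1 K)) := by
  induction n with
  | zero =>
    refine ⟨K, hK, rfl, fun i hi => rfl, ?_, ?_, ?_⟩ <;> rw [Function.iterate_zero, id_eq]
  | succ r ih =>
    obtain ⟨K', h1, h2, h3, h4, h5, h6⟩ := ih
    have h7 : ∀ i < 7, us i (lin MA K') = us i K := by
      intro i hi
      rw [us_MA i hi K' h1, h3 i hi]
    refine ⟨lin MA K', MA_lt _, ?_, h7, ?_, ?_, ?_⟩
    · rw [wt_cw, wt_cw]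
      exact Finset.sum_congr rfl (fun i hi => by rw [h7 i (Finset.mem_range.mp hi)])
    · rw [mu_s K' h1, h4, Function.iterate_succ_apply']
    · rw [mu_t0 K' h1, h5, Function.iterate_succ_apply']
    · rw [mu_t1 K' h1, h6, Function.iterate_succ_apply']

theorem mu_one : ∀ x < 8, x ≠ 0 → ∃ n < 7, mu^[n] x = 1 := by decide +kernel
theorem mu_zero (n : Nat) : mu^[n] 0 = 0 := Function.iterate_fixed (by decide) n

/-! ### Decomposition -/

theorem dec_gen : ∀ k < 48, cw (2 ^ k) = ((lin GR0 (ln 0 (cw (2 ^ k))) ^^^ lin GR1 (ln 1 (cw (2 ^ k))))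
    ^^^ lin GR2 (ln 2 (cw (2 ^ k)))) ^^^ lin VE (dg 3 (2 ^ k)) := by decide +kernel

theorem dec (K : Nat) (hK : K < 2 ^ 48) : cw K = ((lin GR0 (ln 0 (cw K)) ^^^ lin GR1 (ln 1 (cw K)))
    ^^^ lin GR2 (ln 2 (cw K))) ^^^ lin VE (dg 3 K) :=
  XH_cw.ext_all (((((XH_lin GR0).comp ((XH_ln 0).comp XH_cw)).xor
    ((XH_lin GR1).comp ((XH_ln 1).comp XH_cw))).xor
    ((XH_lin GR2).comp ((XH_ln 2).comp XH_cw))).xor ((XH_lin VE).comp (XH_dg 3))) 48 dec_gen K hK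

theorem GR0_inj (c : Nat) (hc : c < 2 ^ 21) (h : lin GR0 c = 0) : c = 0 := by
  have h1 : ln 0 (lin GR0 c) = c :=
    ((XH_ln 0).comp (XH_lin GR0)).ext_all XH_id 21 (by decide +kernel) c hc
  rw [h, (XH_ln 0).zero] at h1
  exact h1.symm

/-! ### Interpolation -/

/-- The interpolation property of a table entry. -/
def Itp (G Y : List Nat) (m : Nat) (h : List Nat) : Prop :=
  ∀ b < 21, m.testBit (b % 7) = true → lin G (2 ^ b) = lin h (lin Y (2 ^ b))

instance (G Y : List Nat) (m : Nat) (h : List Nat) : Decidable (Itp G Y m h) := by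
  unfold Itp; infer_instance

theorem and_testBit (n m j : Nat) (h : n &&& m = n) (hb : n.testBit j = true) :
    m.testBit j = true := by
  rw [← h, Nat.testBit_and] at hb
  simpa using (Bool.and_eq_true_iff.mp hb).2

theorem Itp.spec {G Y : List Nat} {m : Nat} {h : List Nat} (H : Itp G Y m h) (c : Nat)
    (hc : c < 2 ^ 21) (hs : sup c &&& m = sup c) : lin G c = lin h (lin Y c) :=
  (XH_lin G).ext ((XH_lin h).comp (XH_lin Y)) 21 c hc
    (fun k hk hb => H k hk (and_testBit _ _ _ hs (testBit_sup_of c k hk hb)))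

theorem T03_itp : ∀ p ∈ T03, Itp GR0 SYN0 p.1 p.2 ∧ p.2.length = 9 := by decide +kernel
theorem T13_itp : ∀ p ∈ T13, Itp GR1 SYN1 p.1 p.2 ∧ p.2.length = 9 := by decide +kernel
theorem T23_itp : ∀ p ∈ T23, Itp GR2 SYN2 p.1 p.2 ∧ p.2.length = 9 := by decide +kernel
theorem T14_itp : ∀ p ∈ T14, Itp GR1 SYN1 p.1 p.2 ∧ p.2.length = 12 := by decide +kernel
theorem T24_itp : ∀ p ∈ T24, Itp GR2 SYN2 p.1 p.2 ∧ p.2.length = 12 := by decide +kernel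
theorem T02_itp : ∀ p ∈ T02, Itp GR0 SYN0 p.1 p.2.1 ∧ p.2.1.length = 6 := by decide +kernel
theorem T12_itp : ∀ p ∈ T12, Itp GR1 SYN1 p.1 p.2.1 ∧ p.2.1.length = 6 := by decide +kernel
theorem T17_itp : Itp GR1 SYN1 127 T17 ∧ T17.length = 21 := by decide +kernel
theorem T27_itp : Itp GR2 SYN2 127 T27 ∧ T27.length = 21 := by decide +kernel

/-- The relation property of a two-point table entry. -/
def Rlt (Y : List Nat) (m : Nat) (q : List Nat) : Prop :=
  ∀ b < 21, m.testBit (b % 7) = true → dg 2 (lin Y (2 ^ b)) = lin q (lin Y (2 ^ b))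

instance (Y : List Nat) (m : Nat) (h : List Nat) : Decidable (Rlt Y m h) := by
  unfold Rlt; infer_instance

theorem Rlt.spec {Y : List Nat} {m : Nat} {q : List Nat} (H : Rlt Y m q) (c : Nat)
    (hc : c < 2 ^ 21) (hs : sup c &&& m = sup c) : dg 2 (lin Y c) = lin q (lin Y c) :=
  ((XH_dg 2).comp (XH_lin Y)).ext ((XH_lin q).comp (XH_lin Y)) 21 c hc
    (fun k hk hb => H k hk (and_testBit _ _ _ hs (testBit_sup_of c k hk hb)))

theorem T02_rel : ∀ p ∈ T02, Rlt SYN0 p.1 p.2.2 ∧ p.2.2.length = 6 := by decide +kernel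
theorem T12_rel : ∀ p ∈ T12, Rlt SYN1 p.1 p.2.2 ∧ p.2.2.length = 6 := by decide +kernel

/-! Coverage of the supports by the tables -/

theorem T03_cov : ∀ n < 128, pop n ≤ 3 → n % 2 = 1 → ∃ p ∈ T03, n &&& p.1 = n := by decide +kernel
theorem T02_cov : ∀ n < 128, pop n ≤ 2 → n % 2 = 1 → ∃ p ∈ T02, n &&& p.1 = n := by decide +kernel
theorem T13_cov : ∀ n < 128, pop n ≤ 3 → ∃ p ∈ T13, n &&& p.1 = n := by decide +kernel
theorem T23_cov : ∀ n < 128, pop n ≤ 3 → ∃ p ∈ T23, n &&& p.1 = n := by decide +kernel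
theorem T12_cov : ∀ n < 128, pop n ≤ 2 → ∃ p ∈ T12, n &&& p.1 = n := by decide +kernel
theorem T14_cov : ∀ n < 128, pop n ≤ 4 → ∃ p ∈ T14, n &&& p.1 = n := by decide +kernel
theorem T24_cov : ∀ n < 128, pop n ≤ 4 → ∃ p ∈ T24, n &&& p.1 = n := by decide +kernel
theorem full_cov : ∀ n < 128, n &&& 127 = n := by decide +kernel
theorem pop_one : ∀ n < 128, pop n ≤ 1 → n = 0 ∨ ∃ j < 7, n = 2 ^ j := by decide +kernel
theorem pop_pos : ∀ n < 128, pop n = 0 → n = 0 := by decide +kernel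

/-! Splitting of interpolation maps -/

theorem sl_zero_eq (k : Nat) (h : List Nat) : sl k h = sl 0 (h.drop k) := rfl

theorem lin_step (h : List Nat) (hl : 3 ≤ h.length) (x : Nat) :
    lin h x = lin (sl 0 h) (x % 8) ^^^ lin (h.drop 3) (x / 8) := by
  match h, hl with
  | a :: b :: c :: t, _ =>
    have h1 : a :: b :: c :: t = [a, b, c] ++ t := rfl
    have h2 : sl 0 (a :: b :: c :: t) = [a, b, c] := rfl
    rw [h2, h1, lin_append, lin_mod [a, b, c] x]
    rfl

theorem dg_div (r x : Nat) : dg r x = x / 8 ^ r % 8 := by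
  simp only [dg, Nat.shiftRight_eq_div_pow, Nat.pow_mul]; norm_num

theorem lin_nine (h : List Nat) (hl : 9 ≤ h.length) (x : Nat) (h0 : dg 0 x = 0) :
    lin h x = lin (sl 3 h) (dg 1 x) ^^^ (lin (sl 6 h) (dg 2 x) ^^^ lin (h.drop 9) (x / 512)) := by
  have e : x / 8 / 8 % 8 = x / 64 % 8 := by omega
  have e2 : x / 8 / 8 / 8 = x / 512 := by omega
  rw [dg_div] at h0
  rw [lin_step h (by omega), show x % 8 = 0 by simpa using h0, (XH_lin _).zero, Nat.zero_xor,
    lin_step (h.drop 3) (by rw [List.length_drop]; omega), List.drop_drop,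
    lin_step (h.drop (3 + 3)) (by rw [List.length_drop]; omega), List.drop_drop, dg_div, dg_div,
    sl_zero_eq 3, sl_zero_eq 6, e, e2]
  norm_num

theorem lin_six (h : List Nat) (hl : h.length = 6) (x : Nat) (h0 : dg 0 x = 0) :
    lin h x = lin (sl 3 h) (dg 1 x) := by
  rw [dg_div] at h0
  rw [lin_step h (by omega), show x % 8 = 0 by simpa using h0, (XH_lin _).zero, Nat.zero_xor,
    lin_step (h.drop 3) (by rw [List.length_drop]; omega), List.drop_drop,
    List.drop_eq_nil_of_le (as := h) (i := 3 + 3) (by omega), lin_nil, Nat.xor_zero, dg_div,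
    sl_zero_eq 3]
  norm_num

theorem lin_nine' (h : List Nat) (hl : h.length = 9) (x : Nat) (h0 : dg 0 x = 0) :
    lin h x = lin (sl 3 h) (dg 1 x) ^^^ lin (sl 6 h) (dg 2 x) := by
  rw [lin_nine h (by omega) x h0, List.drop_eq_nil_of_le (by omega), lin_nil, Nat.xor_zero]

theorem lin_twelve (h : List Nat) (hl : h.length = 12) (x : Nat) (h0 : dg 0 x = 0) :
    lin h x = lin (sl 3 h) (dg 1 x) ^^^ (lin (sl 6 h) (dg 2 x) ^^^ lin (sl 9 h) (dg 3 x)) := by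
  rw [lin_nine h (by omega) x h0, lin_step (h.drop 9) (by rw [List.length_drop]; omega),
    List.drop_drop, List.drop_eq_nil_of_le (as := h) (i := 9 + 3) (by omega), lin_nil,
    Nat.xor_zero, dg_div 3,
    sl_zero_eq 9, show 8 ^ 3 = 512 by norm_num]

/-! ### The individual cases -/

/-- The conclusion for one word. -/
def Ok (w : Nat) : Prop := wt w = 0 ∨ 24 ≤ wt w

theorem lin_odd (g : Nat) (l : List Nat) (r : Nat) : lin (g :: l) (2 * r + 1) = g ^^^ lin l r := by
  rw [lin_cons, show (2 * r + 1) % 2 = 1 by omega, show (2 * r + 1) / 2 = r by omega, Nat.one_mul]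

theorem lin_sl_append (k : Nat) (h l : List Nat) (r : Nat) :
    lin (sl k h ++ l) r = lin (sl k h) (r % 8) ^^^ lin l (r / 8) := by
  rw [lin_append, lin_mod (sl k h) r]; rfl

theorem lin_sl_mod (k : Nat) (h : List Nat) (r : Nat) : lin (sl k h) r = lin (sl k h) (r % 8) :=
  lin_mod (sl k h) r

theorem lin_VE_mod (r : Nat) : lin VE r = lin VE (r % 8) := lin_mod VE r

theorem lin_zeros (l : List Nat) (r : Nat) : lin ([0, 0, 0] ++ l) r = lin l (r / 8) := by
  rw [lin_append]
  simp [lin_cons, lin_nil]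

theorem split8 (a b e : Nat) (ha : a < 8) (hb : b < 8) (he : e < 8) :
    (a + 8 * b + 64 * e) % 8 = a ∧ (a + 8 * b + 64 * e) / 8 % 8 = b ∧
      (a + 8 * b + 64 * e) / 8 / 8 = e ∧ (a + 8 * b + 64 * e) / 8 / 8 % 8 = e ∧
      a + 8 * b + 64 * e < 2 ^ 9 := by
  refine ⟨?_, ?_, ?_, ?_, ?_⟩ <;> omega

theorem chunk_length {α : Type} (i : Nat) (l : List α) : (chunk i l).length ≤ 12 :=
  List.length_take_le _ _

theorem mem_chunk {α : Type} (l : List α) (hl : l.length ≤ 36) (x : α) (hx : x ∈ l) :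
    x ∈ chunk 0 l ∨ x ∈ chunk 1 l ∨ x ∈ chunk 2 l := by
  unfold chunk
  rw [← List.take_append_drop 12 l, List.mem_append] at hx
  rcases hx with hx | hx
  · exact Or.inl hx
  · rw [← List.take_append_drop 12 (l.drop 12), List.mem_append, List.drop_drop] at hx
    rcases hx with hx | hx
    · exact Or.inr (Or.inl hx)
    · refine Or.inr (Or.inr ?_)
      rw [List.take_of_length_le (by rw [List.length_drop]; omega)]
      exact hx

theorem len23 : T23.length ≤ 36 := by decide +kernel
theorem len24 : T24.length ≤ 36 := by decide +kernel

theorem hk_chunk {α : Type} (i : Nat) (l : List α) (f : α → List Nat) :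
    ((chunk i l).map f).length * 2 ^ 9 ≤ 2 ^ 13 := by
  have := chunk_length i l
  rw [List.length_map]
  omega

theorem caseA1 (p0 : Nat × List Nat) (h0 : p0 ∈ T03) (p1 : Nat × List Nat) (h1 : p1 ∈ T13)
    (p2 : Nat × List Nat) (h2 : p2 ∈ T23) (t0 t1 e : Nat) (ht0 : t0 < 8) (ht1 : t1 < 8)
    (he : e < 8) :
    Ok ((((lin (sl 3 p0.2) 1 ^^^ lin (sl 6 p0.2) t0) ^^^ (lin (sl 3 p1.2) 1 ^^^ lin (sl 6 p1.2) t1))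
      ^^^ (lin (sl 3 p2.2) 1 ^^^ lin (sl 6 p2.2) (t0 ^^^ t1))) ^^^ lin VE e) := by
  have key : ∀ i, runA1 i = true → p2 ∈ chunk i T23 → Ok ((((lin (sl 3 p0.2) 1 ^^^
      lin (sl 6 p0.2) t0) ^^^ (lin (sl 3 p1.2) 1 ^^^ lin (sl 6 p1.2) t1))
      ^^^ (lin (sl 3 p2.2) 1 ^^^ lin (sl 6 p2.2) (t0 ^^^ t1))) ^^^ lin VE e) := by
    intro i hr hc
    obtain ⟨q1, q2, q3, q4, q5⟩ := split8 t0 t1 e ht0 ht1 he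
    have := run_spec _ _ _ _ _ hr (by norm_num) (hk_chunk _ _ _) _ (List.mem_map_of_mem hc) _
      (List.mem_map_of_mem h0) _ (List.mem_map_of_mem h1) _ q5
    simp only [lin_odd, lin_sl_append, lin_zeros, lin_sl_mod 6 p0.2 (t0 + 8 * t1 + 64 * e),
      lin_sl_mod 6 p1.2 ((t0 + 8 * t1 + 64 * e) / 8), q1, q2, q3] at this
    rw [XH_lin (sl 6 p2.2) t0 t1]
    unfold Ok
    convert this using 3 <;> ac_rfl
  rcases mem_chunk T23 len23 p2 h2 with h | h | h
  · exact key 0 runA1_0 h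
  · exact key 1 runA1_1 h
  · exact key 2 runA1_2 h

theorem caseA0 (p0 : Nat × List Nat) (h0 : p0 ∈ T03) (p1 : Nat × List Nat) (h1 : p1 ∈ T13)
    (p2 : Nat × List Nat) (h2 : p2 ∈ T23) (t1 e : Nat) (ht1 : t1 < 8) (he : e < 8) :
    Ok (((lin (sl 6 p0.2) 1 ^^^ lin (sl 6 p1.2) t1) ^^^ lin (sl 6 p2.2) (1 ^^^ t1))
      ^^^ lin VE e) := by
  have q1 : (t1 + 8 * e) % 8 = t1 := by omega
  have q2 : (t1 + 8 * e) / 8 = e := by omega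
  have := run_spec _ _ _ _ _ runA0_t (by norm_num)
    (by rw [List.length_map]; have := len23; omega) _ (List.mem_map_of_mem h2) _
      (List.mem_map_of_mem h0) _ (List.mem_map_of_mem h1) (t1 + 8 * e) (by omega)
  simp only [lin_odd, lin_sl_append, lin_nil, Nat.xor_zero, Nat.zero_xor,
    lin_sl_mod 6 p1.2 (t1 + 8 * e), q1, q2] at this
  rw [XH_lin (sl 6 p2.2) 1 t1]
  unfold Ok
  convert this using 3 <;> ac_rfl

theorem caseC (p0 : Nat × List Nat) (h0 : p0 ∈ T03) (p1 : Nat × List Nat × List Nat) (h1 : p1 ∈ T12)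
    (p2 : Nat × List Nat) (h2 : p2 ∈ T24) (t0 r e : Nat) (ht0 : t0 < 8) (hr : r < 8)
    (he : e < 8) :
    Ok ((((lin (sl 3 p0.2) 1 ^^^ lin (sl 6 p0.2) t0) ^^^ lin (sl 3 p1.2.1) 1)
      ^^^ (lin (sl 3 p2.2) 1 ^^^ (lin (sl 6 p2.2) (t0 ^^^ lin (sl 3 p1.2.2) 1) ^^^
        lin (sl 9 p2.2) r))) ^^^ lin VE e) := by
  have key : ∀ i, runC i = true → p2 ∈ chunk i T24 → Ok ((((lin (sl 3 p0.2) 1 ^^^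
      lin (sl 6 p0.2) t0) ^^^ lin (sl 3 p1.2.1) 1)
      ^^^ (lin (sl 3 p2.2) 1 ^^^ (lin (sl 6 p2.2) (t0 ^^^ lin (sl 3 p1.2.2) 1) ^^^
        lin (sl 9 p2.2) r))) ^^^ lin VE e) := by
    intro i hrun hc
    obtain ⟨q1, q2, q3, q4, q5⟩ := split8 t0 r e ht0 hr he
    have := run_spec _ _ _ _ _ (List.all_eq_true.mp hrun p1 h1) (by norm_num) (hk_chunk _ _ _) _
      (List.mem_map_of_mem hc) _ (List.mem_map_of_mem h0) _ (List.mem_singleton_self _) _ q5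
    simp only [lin_odd, lin_sl_append, lin_nil, Nat.xor_zero,
      lin_sl_mod 6 p0.2 (t0 + 8 * r + 64 * e), q1, q2, q3] at this
    rw [XH_lin (sl 6 p2.2) t0]
    unfold Ok
    convert this using 3 <;> (simp only [show ∀ a b, Nat.xor a b = a ^^^ b from fun _ _ => rfl]; ac_rfl)
  rcases mem_chunk T24 len24 p2 h2 with h | h | h
  · exact key 0 runC_0 h
  · exact key 1 runC_1 h
  · exact key 2 runC_2 h

theorem caseB1 (p0 : Nat × List Nat × List Nat) (h0 : p0 ∈ T02) (p1 : Nat × List Nat) (h1 : p1 ∈ T14)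
    (p2 : Nat × List Nat) (h2 : p2 ∈ T23) (t1 r e : Nat) (ht1 : t1 < 8) (hr : r < 8)
    (he : e < 8) :
    Ok (((lin (sl 3 p0.2.1) 1 ^^^ (lin (sl 3 p1.2) 1 ^^^ (lin (sl 6 p1.2) t1 ^^^ lin (sl 9 p1.2) r)))
      ^^^ (lin (sl 3 p2.2) 1 ^^^ lin (sl 6 p2.2) (lin (sl 3 p0.2.2) 1 ^^^ t1))) ^^^ lin VE e) := by
  have key : ∀ i, runB1 i = true → p2 ∈ chunk i T23 → Ok (((lin (sl 3 p0.2.1) 1 ^^^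
      (lin (sl 3 p1.2) 1 ^^^ (lin (sl 6 p1.2) t1 ^^^ lin (sl 9 p1.2) r)))
      ^^^ (lin (sl 3 p2.2) 1 ^^^ lin (sl 6 p2.2) (lin (sl 3 p0.2.2) 1 ^^^ t1))) ^^^ lin VE e) := by
    intro i hrun hc
    obtain ⟨q1, q2, q3, q4, q5⟩ := split8 t1 r e ht1 hr he
    have := run_spec _ _ _ _ _ (List.all_eq_true.mp hrun p0 h0) (by norm_num) (hk_chunk _ _ _) _
      (List.mem_map_of_mem hc) _ (List.mem_singleton_self _) _ (List.mem_map_of_mem h1) _ q5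
    simp only [lin_odd, lin_sl_append, lin_nil, Nat.xor_zero, lin_zeros,
      lin_sl_mod 9 p1.2 ((t1 + 8 * r + 64 * e) / 8), q1, q2, q3] at this
    rw [XH_lin (sl 6 p2.2) _ t1]
    unfold Ok
    convert this using 3 <;> (simp only [show ∀ a b, Nat.xor a b = a ^^^ b from fun _ _ => rfl]; ac_rfl)
  rcases mem_chunk T23 len23 p2 h2 with h | h | h
  · exact key 0 runB1_0 h
  · exact key 1 runB1_1 h
  · exact key 2 runB1_2 h

theorem caseB2 (p0 : Nat × List Nat × List Nat) (h0 : p0 ∈ T02) (p1 : Nat × List Nat) (h1 : p1 ∈ T13)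
    (p2 : Nat × List Nat) (h2 : p2 ∈ T24) (t1 r e : Nat) (ht1 : t1 < 8) (hr : r < 8)
    (he : e < 8) :
    Ok (((lin (sl 3 p0.2.1) 1 ^^^ (lin (sl 3 p1.2) 1 ^^^ lin (sl 6 p1.2) t1))
      ^^^ (lin (sl 3 p2.2) 1 ^^^ (lin (sl 6 p2.2) (lin (sl 3 p0.2.2) 1 ^^^ t1) ^^^
        lin (sl 9 p2.2) r))) ^^^ lin VE e) := by
  have key : ∀ i, runB2 i = true → p2 ∈ chunk i T24 → Ok (((lin (sl 3 p0.2.1) 1 ^^^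
      (lin (sl 3 p1.2) 1 ^^^ lin (sl 6 p1.2) t1))
      ^^^ (lin (sl 3 p2.2) 1 ^^^ (lin (sl 6 p2.2) (lin (sl 3 p0.2.2) 1 ^^^ t1) ^^^
        lin (sl 9 p2.2) r))) ^^^ lin VE e) := by
    intro i hrun hc
    obtain ⟨q1, q2, q3, q4, q5⟩ := split8 t1 r e ht1 hr he
    have := run_spec _ _ _ _ _ (List.all_eq_true.mp hrun p0 h0) (by norm_num) (hk_chunk _ _ _) _
      (List.mem_map_of_mem hc) _ (List.mem_singleton_self _) _ (List.mem_map_of_mem h1) _ q5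
    simp only [lin_odd, lin_sl_append, lin_nil, Nat.xor_zero,
      lin_sl_mod 6 p1.2 (t1 + 8 * r + 64 * e), q1, q2, q3] at this
    rw [XH_lin (sl 6 p2.2) _ t1]
    unfold Ok
    convert this using 3 <;> (simp only [show ∀ a b, Nat.xor a b = a ^^^ b from fun _ _ => rfl]; ac_rfl)
  rcases mem_chunk T24 len24 p2 h2 with h | h | h
  · exact key 0 runB2_0 h
  · exact key 1 runB2_1 h
  · exact key 2 runB2_2 h

theorem caseFull (h : List Nat) (hl : h.length = 21) (bs : List (List Nat))
    (hrun : runFull h bs = true) (g : Nat) (hg : [g] ∈ bs) (x e : Nat) (hx : x < 4096) (he : e < 8) :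
    Ok ((lin (h.drop 9) x ^^^ lin VE e) ^^^ g) := by
  have hq : x / 1024 ∈ [0, 1, 2, 3] := by
    have : x / 1024 < 4 := by omega
    interval_cases x / 1024 <;> simp
  have hlen : ((h.drop 9).take 10).length = 10 := by
    rw [List.length_take, List.length_drop]; omega
  have hs : lin (h.drop 9) x = lin ((h.drop 9).take 10) (x % 2 ^ 10) ^^^ lin (h.drop 19) (x / 1024) := by
    conv_lhs => rw [← List.take_append_drop 10 (h.drop 9)]
    rw [lin_append, hlen, List.drop_drop, lin_mod, hlen]
    norm_num
  have := run_spec _ _ _ _ _ hrun (by norm_num) (by norm_num) _ (List.mem_singleton_self _) _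
    (List.mem_map_of_mem hq) _ hg (x % 1024 + 1024 * e) (by omega)
  simp only [lin_odd, lin_nil, Nat.xor_zero, Nat.zero_xor, lin_append, hlen] at this
  rw [lin_mod ((h.drop 9).take 10), hlen, show (x % 1024 + 1024 * e) % 2 ^ 10 = x % 2 ^ 10 by omega,
    show (x % 1024 + 1024 * e) / 2 ^ 10 = e by omega] at this
  rw [hs]
  unfold Ok
  convert this using 3 <;> ac_rfl

/-! ### Assembling the cases -/

theorem us_def (i K : Nat) : us i K = sup (ln i (cw K)) := by unfold us; rfl

/-- Inversion of a one-point line from its first power sum. -/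
def SNG : List (List Nat) :=
  [[1, 128, 16384], [32770, 2, 256], [66052, 65540, 4], [132096, 132104, 131080],
    [2064, 264192, 264208], [524288, 4128, 528384], [8192, 1048576, 8256]]

theorem sng_gen : ∀ j < 7, ∃ R ∈ SNG, ∀ b < 21, (2 ^ j).testBit (b % 7) = true →
    2 ^ b = lin R (dg 0 (lin SYN0 (2 ^ b))) ∧ 2 ^ b = lin R (dg 0 (lin SYN1 (2 ^ b))) := by
  decide +kernel

theorem single0 (K : Nat) (hK : K < 2 ^ 48) (h : pop (us 0 K) ≤ 1) : us 0 K = 0 := by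
  rcases pop_one _ (us_lt 0 K) h with h | ⟨j, hj, h⟩
  · exact h
  · obtain ⟨R, _, hR⟩ := sng_gen j hj
    have h1 : ln 0 (cw K) = lin R (dg 0 (lin SYN0 (ln 0 (cw K)))) :=
      XH_id.ext ((XH_lin R).comp ((XH_dg 0).comp (XH_lin SYN0))) 21 _ (ln_lt _ _)
        (fun k hk hb => (hR k hk (by
          rw [← h, us_def]; exact testBit_sup_of _ k hk hb)).1)
    have h2 : dg 0 (lin SYN0 (ln 0 (cw K))) = 0 := d00 K hK
    rw [h2, (XH_lin R).zero] at h1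
    rw [us_def, h1]; rfl

theorem single1 (K : Nat) (hK : K < 2 ^ 48) (h : pop (us 1 K) ≤ 1) : ln 1 (cw K) = 0 := by
  rcases pop_one _ (us_lt 1 K) h with h | ⟨j, hj, h⟩
  · rw [us_def] at h
    exact eq_zero_of_sup _ (ln_lt _ _) h
  · obtain ⟨R, _, hR⟩ := sng_gen j hj
    have h1 : ln 1 (cw K) = lin R (dg 0 (lin SYN1 (ln 1 (cw K)))) :=
      XH_id.ext ((XH_lin R).comp ((XH_dg 0).comp (XH_lin SYN1))) 21 _ (ln_lt _ _)
        (fun k hk hb => (hR k hk (by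
          rw [← h, us_def]; exact testBit_sup_of _ k hk hb)).2)
    have h2 : dg 0 (lin SYN1 (ln 1 (cw K))) = 0 := d01 K hK
    rw [h2, (XH_lin R).zero] at h1
    exact h1

theorem L03 (K : Nat) (hK : K < 2 ^ 48) (h : pop (us 0 K) ≤ 3) (ho : us 0 K % 2 = 1) :
    ∃ p ∈ T03, lin GR0 (ln 0 (cw K)) =
      lin (sl 3 p.2) (dg 1 (sg0 K)) ^^^ lin (sl 6 p.2) (dg 2 (sg0 K)) := by
  obtain ⟨p, hp, hs⟩ := T03_cov _ (us_lt 0 K) h ho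
  rw [us_def] at hs
  refine ⟨p, hp, ?_⟩
  rw [(T03_itp p hp).1.spec _ (ln_lt _ _) hs]
  exact lin_nine' _ (T03_itp p hp).2 (sg0 K) (d00 K hK)

theorem L13 (K : Nat) (hK : K < 2 ^ 48) (h : pop (us 1 K) ≤ 3) :
    ∃ p ∈ T13, lin GR1 (ln 1 (cw K)) =
      lin (sl 3 p.2) (dg 1 (sg1 K)) ^^^ lin (sl 6 p.2) (dg 2 (sg1 K)) := by
  obtain ⟨p, hp, hs⟩ := T13_cov _ (us_lt 1 K) h
  rw [us_def] at hs
  refine ⟨p, hp, ?_⟩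
  rw [(T13_itp p hp).1.spec _ (ln_lt _ _) hs]
  exact lin_nine' _ (T13_itp p hp).2 (sg1 K) (d01 K hK)

theorem L23 (K : Nat) (hK : K < 2 ^ 48) (h : pop (us 2 K) ≤ 3) :
    ∃ p ∈ T23, lin GR2 (ln 2 (cw K)) =
      lin (sl 3 p.2) (dg 1 (sg2 K)) ^^^ lin (sl 6 p.2) (dg 2 (sg2 K)) := by
  obtain ⟨p, hp, hs⟩ := T23_cov _ (us_lt 2 K) h
  rw [us_def] at hs
  refine ⟨p, hp, ?_⟩
  rw [(T23_itp p hp).1.spec _ (ln_lt _ _) hs]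
  exact lin_nine' _ (T23_itp p hp).2 (sg2 K) (d02 K hK)

theorem L14 (K : Nat) (hK : K < 2 ^ 48) (h : pop (us 1 K) ≤ 4) :
    ∃ p ∈ T14, lin GR1 (ln 1 (cw K)) = lin (sl 3 p.2) (dg 1 (sg1 K)) ^^^
      (lin (sl 6 p.2) (dg 2 (sg1 K)) ^^^ lin (sl 9 p.2) (dg 3 (sg1 K))) := by
  obtain ⟨p, hp, hs⟩ := T14_cov _ (us_lt 1 K) h
  rw [us_def] at hs
  refine ⟨p, hp, ?_⟩
  rw [(T14_itp p hp).1.spec _ (ln_lt _ _) hs]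
  exact lin_twelve _ (T14_itp p hp).2 (sg1 K) (d01 K hK)

theorem L24 (K : Nat) (hK : K < 2 ^ 48) (h : pop (us 2 K) ≤ 4) :
    ∃ p ∈ T24, lin GR2 (ln 2 (cw K)) = lin (sl 3 p.2) (dg 1 (sg2 K)) ^^^
      (lin (sl 6 p.2) (dg 2 (sg2 K)) ^^^ lin (sl 9 p.2) (dg 3 (sg2 K))) := by
  obtain ⟨p, hp, hs⟩ := T24_cov _ (us_lt 2 K) h
  rw [us_def] at hs
  refine ⟨p, hp, ?_⟩
  rw [(T24_itp p hp).1.spec _ (ln_lt _ _) hs]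
  exact lin_twelve _ (T24_itp p hp).2 (sg2 K) (d02 K hK)

theorem L02 (K : Nat) (hK : K < 2 ^ 48) (h : pop (us 0 K) ≤ 2) (ho : us 0 K % 2 = 1) :
    ∃ p ∈ T02, lin GR0 (ln 0 (cw K)) = lin (sl 3 p.2.1) (dg 1 (sg0 K)) ∧
      dg 2 (sg0 K) = lin (sl 3 p.2.2) (dg 1 (sg0 K)) := by
  obtain ⟨p, hp, hs⟩ := T02_cov _ (us_lt 0 K) h ho
  rw [us_def] at hs
  refine ⟨p, hp, ?_, ?_⟩
  · rw [(T02_itp p hp).1.spec _ (ln_lt _ _) hs]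
    exact lin_six _ (T02_itp p hp).2 (sg0 K) (d00 K hK)
  · have h1 := (T02_rel p hp).1.spec _ (ln_lt _ _) hs
    exact h1.trans (lin_six _ (T02_rel p hp).2 (sg0 K) (d00 K hK))

theorem L12 (K : Nat) (hK : K < 2 ^ 48) (h : pop (us 1 K) ≤ 2) :
    ∃ p ∈ T12, lin GR1 (ln 1 (cw K)) = lin (sl 3 p.2.1) (dg 1 (sg1 K)) ∧
      dg 2 (sg1 K) = lin (sl 3 p.2.2) (dg 1 (sg1 K)) := by
  obtain ⟨p, hp, hs⟩ := T12_cov _ (us_lt 1 K) h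
  rw [us_def] at hs
  refine ⟨p, hp, ?_, ?_⟩
  · rw [(T12_itp p hp).1.spec _ (ln_lt _ _) hs]
    exact lin_six _ (T12_itp p hp).2 (sg1 K) (d01 K hK)
  · have h1 := (T12_rel p hp).1.spec _ (ln_lt _ _) hs
    exact h1.trans (lin_six _ (T12_rel p hp).2 (sg1 K) (d01 K hK))

theorem L17 (K : Nat) (hK : K < 2 ^ 48) :
    ∃ x < 4096, lin GR1 (ln 1 (cw K)) = lin (sl 3 T17) (dg 1 (sg1 K)) ^^^
      (lin (sl 6 T17) (dg 2 (sg1 K)) ^^^ lin (T17.drop 9) x) := by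
  have hs := full_cov _ (us_lt 1 K)
  rw [us_def] at hs
  have hb : sg1 K < 2 ^ 21 := lin_lt 21 SYN1 (by decide +kernel) _
  refine ⟨sg1 K / 512, by omega, ?_⟩
  rw [T17_itp.1.spec _ (ln_lt _ _) hs]
  exact lin_nine _ (by rw [T17_itp.2]; norm_num) (sg1 K) (d01 K hK)

theorem L27 (K : Nat) (hK : K < 2 ^ 48) :
    ∃ x < 4096, lin GR2 (ln 2 (cw K)) = lin (sl 3 T27) (dg 1 (sg2 K)) ^^^
      (lin (sl 6 T27) (dg 2 (sg2 K)) ^^^ lin (T27.drop 9) x) := by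
  have hs := full_cov _ (us_lt 2 K)
  rw [us_def] at hs
  have hb : sg2 K < 2 ^ 21 := lin_lt 21 SYN2 (by decide +kernel) _
  refine ⟨sg2 K / 512, by omega, ?_⟩
  rw [T27_itp.1.spec _ (ln_lt _ _) hs]
  exact lin_nine _ (by rw [T27_itp.2]; norm_num) (sg2 K) (d02 K hK)

theorem us0_ne (K : Nat) (ho : us 0 K % 2 = 1) : lin GR0 (ln 0 (cw K)) ≠ 0 := by
  intro h
  have h1 := GR0_inj _ (ln_lt _ _) h
  rw [us_def, h1] at ho
  exact absurd ho (by decide)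

/-- Line 0 empty, second syndrome normalised. -/
theorem fin_zero (K : Nat) (hK : K < 2 ^ 48) (h0 : us 0 K = 0)
    (hw : pop (us 1 K) ≤ 4 ∨ pop (us 2 K) ≤ 4) (ht : dg 2 (sg1 K) = 0 ∨ dg 2 (sg1 K) = 1) :
    Ok (cw K) := by
  have hc : ln 0 (cw K) = 0 := eq_zero_of_sup _ (ln_lt _ _) (by rw [← us_def]; exact h0)
  have hs : sg0 K = 0 := by unfold sg0; rw [hc, (XH_lin _).zero]
  have e1 := d11 K hK
  have e2 := d12 K hK
  have e3 := d22 K hK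
  rw [hs, (XH_dg 1).zero] at e1 e2
  rw [hs, (XH_dg 2).zero, Nat.zero_xor] at e3
  rw [dec K hK, hc, (XH_lin _).zero, Nat.zero_xor]
  rcases hw with hw | hw
  · obtain ⟨p, hp, hp1⟩ := L14 K hK hw
    obtain ⟨x, hx, hx1⟩ := L27 K hK
    rw [hp1, hx1, e1, e2, e3, (XH_lin _).zero, (XH_lin _).zero, Nat.zero_xor, Nat.zero_xor]
    have key : ∀ t, runFull T27 (bsZ T14 T27 t) = true → Ok (((lin (sl 6 p.2) t ^^^
        lin (sl 9 p.2) (dg 3 (sg1 K))) ^^^ (lin (sl 6 T27) t ^^^ lin (T27.drop 9) x)) ^^^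
        lin VE (dg 3 K)) := by
      intro t hr
      have := caseFull T27 T27_itp.2 _ hr
        ((lin (sl 6 p.2) t ^^^ lin (sl 9 p.2) (dg 3 (sg1 K))) ^^^ lin (sl 6 T27) t)
        (List.mem_flatMap.mpr ⟨p, hp, List.mem_map.mpr
          ⟨dg 3 (sg1 K), List.mem_range.mpr (dg_lt _ _), rfl⟩⟩) x (dg 3 K) hx (dg_lt _ _)
      convert this using 1; ac_rfl
    rcases ht with ht | ht <;> rw [ht]
    · exact key 0 runZ1_0
    · exact key 1 runZ1_1
  · obtain ⟨p, hp, hp1⟩ := L24 K hK hw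
    obtain ⟨x, hx, hx1⟩ := L17 K hK
    rw [hp1, hx1, e1, e2, e3, (XH_lin _).zero, (XH_lin _).zero, Nat.zero_xor, Nat.zero_xor]
    have key : ∀ t, runFull T17 (bsZ T24 T17 t) = true → Ok (((lin (sl 6 T17) t ^^^
        lin (T17.drop 9) x) ^^^ (lin (sl 6 p.2) t ^^^ lin (sl 9 p.2) (dg 3 (sg2 K)))) ^^^
        lin VE (dg 3 K)) := by
      intro t hr
      have := caseFull T17 T17_itp.2 _ hr
        ((lin (sl 6 p.2) t ^^^ lin (sl 9 p.2) (dg 3 (sg2 K))) ^^^ lin (sl 6 T17) t)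
        (List.mem_flatMap.mpr ⟨p, hp, List.mem_map.mpr
          ⟨dg 3 (sg2 K), List.mem_range.mpr (dg_lt _ _), rfl⟩⟩) x (dg 3 K) hx (dg_lt _ _)
      convert this using 1; ac_rfl
    rcases ht with ht | ht <;> rw [ht]
    · exact key 0 runZ2_0
    · exact key 1 runZ2_1

/-- Line 0 of weight two, first syndrome one. -/
theorem fin_two (K : Nat) (hK : K < 2 ^ 48) (ho : us 0 K % 2 = 1) (h0 : pop (us 0 K) ≤ 2)
    (hs : dg 1 (sg0 K) = 1) (hw : pop (us 1 K) ≤ 2 ∨ (pop (us 1 K) ≤ 3 ∧ pop (us 2 K) ≤ 4) ∨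
      (pop (us 1 K) ≤ 4 ∧ pop (us 2 K) ≤ 3)) : Ok (cw K) := by
  have e1 := d11 K hK
  have e2 := d12 K hK
  have e3 := d22 K hK
  rw [hs] at e1 e2
  obtain ⟨p0, hp0, hq0, ht0⟩ := L02 K hK h0 ho
  rw [hs] at hq0 ht0
  rw [dec K hK, hq0]
  rcases hw with hw | ⟨hw, hw2⟩ | ⟨hw, hw2⟩
  · obtain ⟨p1, hp1, hq1, ht1⟩ := L12 K hK hw
    obtain ⟨x, hx, hx1⟩ := L27 K hK
    rw [e1] at hq1 ht1
    rw [hq1, hx1, e2, e3, ht0, ht1]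
    have := caseFull T27 T27_itp.2 _ runE_t
      ((lin (sl 3 p0.2.1) 1 ^^^ lin (sl 3 p1.2.1) 1) ^^^ (lin (sl 3 T27) 1 ^^^
        lin (sl 6 T27) (lin (sl 3 p0.2.2) 1 ^^^ lin (sl 3 p1.2.2) 1)))
      (List.mem_flatMap.mpr ⟨p0, hp0, List.mem_map.mpr ⟨p1, hp1, rfl⟩⟩) x (dg 3 K) hx (dg_lt _ _)
    convert this using 1; ac_rfl
  · obtain ⟨p1, hp1, hq1⟩ := L13 K hK hw
    obtain ⟨p2, hp2, hq2⟩ := L24 K hK hw2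
    rw [hq1, hq2, e1, e2, e3, ht0]
    exact caseB2 p0 hp0 p1 hp1 p2 hp2 _ _ _ (dg_lt _ _) (dg_lt _ _) (dg_lt _ _)
  · obtain ⟨p1, hp1, hq1⟩ := L14 K hK hw
    obtain ⟨p2, hp2, hq2⟩ := L23 K hK hw2
    rw [hq1, hq2, e1, e2, e3, ht0]
    exact caseB1 p0 hp0 p1 hp1 p2 hp2 _ _ _ (dg_lt _ _) (dg_lt _ _) (dg_lt _ _)

/-- Line 0 of weight three, first syndrome one. -/
theorem fin_three (K : Nat) (hK : K < 2 ^ 48) (ho : us 0 K % 2 = 1) (h0 : pop (us 0 K) ≤ 3)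
    (hs : dg 1 (sg0 K) = 1) (hw : (pop (us 1 K) ≤ 3 ∧ pop (us 2 K) ≤ 3) ∨
      (pop (us 1 K) ≤ 2 ∧ pop (us 2 K) ≤ 4)) : Ok (cw K) := by
  have e1 := d11 K hK
  have e2 := d12 K hK
  have e3 := d22 K hK
  rw [hs] at e1 e2
  obtain ⟨p0, hp0, hq0⟩ := L03 K hK h0 ho
  rw [hs] at hq0
  rw [dec K hK, hq0]
  rcases hw with ⟨hw, hw2⟩ | ⟨hw, hw2⟩
  · obtain ⟨p1, hp1, hq1⟩ := L13 K hK hw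
    obtain ⟨p2, hp2, hq2⟩ := L23 K hK hw2
    rw [hq1, hq2, e1, e2, e3]
    exact caseA1 p0 hp0 p1 hp1 p2 hp2 _ _ _ (dg_lt _ _) (dg_lt _ _) (dg_lt _ _)
  · obtain ⟨p1, hp1, hq1, ht1⟩ := L12 K hK hw
    obtain ⟨p2, hp2, hq2⟩ := L24 K hK hw2
    rw [e1] at hq1 ht1
    rw [hq1, hq2, e2, e3, ht1]
    exact caseC p0 hp0 p1 hp1 p2 hp2 _ _ _ (dg_lt _ _) (dg_lt _ _) (dg_lt _ _)

/-- Line 0 of weight three, first syndrome zero, second syndrome one. -/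
theorem fin_three' (K : Nat) (hK : K < 2 ^ 48) (ho : us 0 K % 2 = 1) (h0 : pop (us 0 K) ≤ 3)
    (hs : dg 1 (sg0 K) = 0) (ht : dg 2 (sg0 K) = 1) (hw : (pop (us 1 K) ≤ 3 ∧ pop (us 2 K) ≤ 3) ∨
      pop (us 1 K) ≤ 2) : Ok (cw K) := by
  have e1 := d11 K hK
  have e2 := d12 K hK
  have e3 := d22 K hK
  rw [hs] at e1 e2
  rw [ht] at e3
  obtain ⟨p0, hp0, hq0⟩ := L03 K hK h0 ho
  rw [hs, ht, (XH_lin _).zero, Nat.zero_xor] at hq0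
  rw [dec K hK, hq0]
  rcases hw with ⟨hw, hw2⟩ | hw
  · obtain ⟨p1, hp1, hq1⟩ := L13 K hK hw
    obtain ⟨p2, hp2, hq2⟩ := L23 K hK hw2
    rw [hq1, hq2, e1, e2, e3, (XH_lin (sl 3 p1.2)).zero, (XH_lin (sl 3 p2.2)).zero, Nat.zero_xor,
      Nat.zero_xor]
    exact caseA0 p0 hp0 p1 hp1 p2 hp2 _ _ (dg_lt _ _) (dg_lt _ _)
  · obtain ⟨p1, hp1, hq1, ht1⟩ := L12 K hK hw
    obtain ⟨x, hx, hx1⟩ := L27 K hK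
    rw [e1, (XH_lin _).zero] at hq1 ht1
    rw [hq1, hx1, e2, e3, ht1, (XH_lin _).zero, Nat.xor_zero, Nat.zero_xor]
    have := caseFull T27 T27_itp.2 _ runF_t (lin (sl 6 p0.2) 1 ^^^ lin (sl 6 T27) 1)
      (List.mem_map.mpr ⟨p0, hp0, rfl⟩) x (dg 3 K) hx (dg_lt _ _)
    convert this using 1; ac_rfl

theorem Ok_of_wt {K K' : Nat} (h : wt (cw K') = wt (cw K)) (h' : Ok (cw K')) : Ok (cw K) := by
  unfold Ok at *
  rw [h] at h'
  exact h'

theorem arith_two (a b c : Nat) (h0 : a = 2) (h1 : a + b ≤ 6) (h2 : a + b + c ≤ 9) :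
    b ≤ 2 ∨ (b ≤ 3 ∧ c ≤ 4) ∨ (b ≤ 4 ∧ c ≤ 3) := by omega

theorem arith_three (a b c : Nat) (h0 : a = 3) (h1 : a + b ≤ 6) (h2 : a + b + c ≤ 9)
    (h3 : ¬ b ≤ 1) : (b ≤ 3 ∧ c ≤ 3) ∨ (b ≤ 2 ∧ c ≤ 4) := by omega

theorem arith_three' (a b c : Nat) (h0 : a = 3) (h1 : a + b ≤ 6) (h2 : a + b + c ≤ 9) :
    (b ≤ 3 ∧ c ≤ 3) ∨ b ≤ 2 := by omega

theorem arith_zero (a b c : Nat) (h2 : a + b + c ≤ 9) : b ≤ 4 ∨ c ≤ 4 := by omega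

theorem arith_split (a : Nat) (h : a ≤ 3) : a ≤ 1 ∨ a = 2 ∨ a = 3 := by omega

theorem main_ok (K : Nat) (hK : K < 2 ^ 48) : Ok (cw K) := by
  by_cases h23 : wt (cw K) ≤ 23
  swap
  · right; omega
  obtain ⟨L, hL, hwt, w0, w1, w2, hodd⟩ := normalise K hK h23
  apply Ok_of_wt hwt
  have hz : us 0 L = 0 → Ok (cw L) := by
    intro h0
    have hw := arith_zero _ _ _ w2
    by_cases ht : dg 2 (sg1 L) = 0
    · exact fin_zero L hL h0 hw (Or.inl ht)
    · obtain ⟨n, _, hn⟩ := mu_one _ (dg_lt _ _) ht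
      obtain ⟨M, hM, m1, m2, m3, m4, m5⟩ := scale n L hL
      apply Ok_of_wt m1
      refine fin_zero M hM ?_ ?_ (Or.inr (m5.trans hn))
      · rw [m2 0 (by norm_num)]; exact h0
      · rw [m2 1 (by norm_num), m2 2 (by norm_num)]; exact hw
  rcases hodd with h0 | ho
  · exact hz h0
  rcases arith_split _ w0 with h1 | h1 | h1
  · exact hz (single0 L hL h1)
  · have hw := arith_two _ _ _ h1 w1 w2
    have hs : dg 1 (sg0 L) ≠ 0 := by
      intro hs
      obtain ⟨p, _, hp, _⟩ := L02 L hL h1.le ho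
      rw [hs, (XH_lin _).zero] at hp
      exact us0_ne L ho hp
    obtain ⟨n, _, hn⟩ := mu_one _ (dg_lt _ _) hs
    obtain ⟨M, hM, m1, m2, m3, m4, m5⟩ := scale n L hL
    apply Ok_of_wt m1
    refine fin_two M hM ?_ ?_ (m3.trans hn) ?_
    · rw [m2 0 (by norm_num)]; exact ho
    · rw [m2 0 (by norm_num)]; exact h1.le
    · rw [m2 1 (by norm_num), m2 2 (by norm_num)]; exact hw
  · by_cases hs : dg 1 (sg0 L) = 0
    · have hw := arith_three' _ _ _ h1 w1 w2
      have ht : dg 2 (sg0 L) ≠ 0 := by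
        intro ht
        obtain ⟨p, _, hp⟩ := L03 L hL w0 ho
        rw [hs, ht, (XH_lin _).zero, (XH_lin _).zero, Nat.xor_zero] at hp
        exact us0_ne L ho hp
      obtain ⟨n, _, hn⟩ := mu_one _ (dg_lt _ _) ht
      obtain ⟨M, hM, m1, m2, m3, m4, m5⟩ := scale n L hL
      apply Ok_of_wt m1
      refine fin_three' M hM ?_ ?_ (m3.trans (by rw [hs, mu_zero])) (m4.trans hn) ?_
      · rw [m2 0 (by norm_num)]; exact ho
      · rw [m2 0 (by norm_num)]; exact w0
      · rw [m2 1 (by norm_num), m2 2 (by norm_num)]; exact hw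
    · have hn1 : ¬ pop (us 1 L) ≤ 1 := by
        intro h
        have h2 := single1 L hL h
        have h3 : sg1 L = 0 := by unfold sg1; rw [h2, (XH_lin _).zero]
        have h4 := d11 L hL
        rw [h3, (XH_dg 1).zero] at h4
        exact hs h4.symm
      have hw := arith_three _ _ _ h1 w1 w2 hn1
      obtain ⟨n, _, hn⟩ := mu_one _ (dg_lt _ _) hs
      obtain ⟨M, hM, m1, m2, m3, m4, m5⟩ := scale n L hL
      apply Ok_of_wt m1
      refine fin_three M hM ?_ ?_ (m3.trans hn) ?_
      · rw [m2 0 (by norm_num)]; exact ho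
      · rw [m2 0 (by norm_num)]; exact w0
      · rw [m2 1 (by norm_num), m2 2 (by norm_num)]; exact hw

end LineArguments

/-! ### Transport to the field with eight elements -/

theorem F8_card : Nat.card F8 = 8 := by
  have := GaloisField.card 2 3 (by norm_num)
  simpa using this

theorem F8_two : (2 : F8) = 0 := by
  have := CharP.cast_eq_zero F8 2
  exact_mod_cast this

theorem F8_dbl (x : F8) : x + x = 0 := by
  rw [← two_mul, F8_two, zero_mul]

theorem F8_fin : Finite F8 := Nat.finite_of_card_ne_zero (by rw [F8_card]; norm_num)

theorem F8_units_card : Nat.card F8ˣ = 7 := by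
  have := F8_fin
  rw [Nat.card_units, F8_card]

theorem F8_pow7 (u : F8ˣ) : u ^ 7 = 1 := by
  have := pow_card_eq_one' (x := u)
  rwa [F8_units_card] at this

theorem exists_alpha : ∃ u : F8ˣ, (u : F8) ^ 3 = u + 1 := by
  have : Finite F8ˣ := Nat.finite_of_card_ne_zero (by rw [F8_units_card]; norm_num)
  have : Nontrivial F8ˣ := by
    rw [← Finite.one_lt_card_iff_nontrivial, F8_units_card]; norm_num
  obtain ⟨v, hv⟩ := exists_ne (1 : F8ˣ)
  have h7 : (v : F8) ^ 7 = 1 := by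
    have := congrArg (Units.val) (F8_pow7 v)
    simpa using this
  have hv1 : (v : F8) - 1 ≠ 0 := by
    intro h
    exact hv (Units.ext (by simpa [sub_eq_zero] using h))
  have h2 := F8_two
  have hf : ((v : F8) - 1) * (((v : F8) ^ 3 + v + 1) * ((v : F8) ^ 3 + (v : F8) ^ 2 + 1)) = 0 := by
    linear_combination h7 + ((v : F8) ^ 4 - (v : F8) ^ 3) * h2
  rcases mul_eq_zero.1 ((mul_eq_zero.1 hf).resolve_left hv1) with h | h
  · exact ⟨v, by linear_combination h - ((v : F8) + 1) * h2⟩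
  · refine ⟨v⁻¹, ?_⟩
    have hi : (v : F8) * ((v⁻¹ : F8ˣ) : F8) = 1 := by simp
    generalize ((v⁻¹ : F8ˣ) : F8) = y at *
    generalize (v : F8) = x at *
    have hx : x ≠ 0 := left_ne_zero_of_mul_eq_one hi
    have hx3 : x ^ 3 ≠ 0 := pow_ne_zero _ hx
    apply mul_left_cancel₀ hx3
    have e1 : x ^ 3 * y ^ 3 = 1 := by rw [← mul_pow, hi, one_pow]
    have e2 : x ^ 3 * (y + 1) = x ^ 2 * (x * y) + x ^ 3 := by ring
    rw [e1, e2, hi]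
    linear_combination -h + h2

/-- A bit as an element of `F8`. -/
noncomputable def bv (b : Bool) : F8 := if b then 1 else 0

theorem bv_xor (a b : Bool) : bv (a ^^ b) = bv a + bv b := by
  cases a <;> cases b <;> simp [bv, F8_dbl]

/-- The field element encoded by digit `p` of a packed word. -/
noncomputable def val (α : F8) (w p : Nat) : F8 :=
  bv (w.testBit p) + bv (w.testBit (49 + p)) * α + bv (w.testBit (98 + p)) * α ^ 2

theorem val_xor (α : F8) (v w p : Nat) : val α (v ^^^ w) p = val α v p + val α w p := by
  simp only [val, Nat.testBit_xor, bv_xor]; ring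

theorem val_zero (α : F8) (p : Nat) : val α 0 p = 0 := by
  simp [val, bv]

/-- Exponents of `α` for digit values. -/
def pw : List Nat := [1, 2, 4, 3, 6, 7, 5]

theorem pw_val (α : F8) (h : α ^ 3 = α + 1) (e : Nat) (he : e < 7) :
    bv ((pw.getD e 0).testBit 0) + bv ((pw.getD e 0).testBit 1) * α +
      bv ((pw.getD e 0).testBit 2) * α ^ 2 = α ^ e := by
  have h2 := F8_two
  interval_cases e <;> simp [pw, bv, Nat.testBit]
  · linear_combination -h
  · linear_combination -α * h
  · linear_combination (-α ^ 2 - 1) * h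
  · linear_combination (-α ^ 3 - α - 1) * h + (-α) * h2

theorem bits_val (α : F8) (h : α ^ 3 = α + 1) (h0 : α ≠ 0) (a b c : Bool) :
    bv a + bv b * α + bv c * α ^ 2 = 0 ↔ (a || (b || c)) = false := by
  have key : ∀ e < 7, bv ((pw.getD e 0).testBit 0) + bv ((pw.getD e 0).testBit 1) * α +
      bv ((pw.getD e 0).testBit 2) * α ^ 2 ≠ 0 := by
    intro e he
    rw [pw_val α h e he]
    exact pow_ne_zero _ h0
  have k0 := key 0 (by norm_num)
  have k1 := key 1 (by norm_num)
  have k2 := key 2 (by norm_num)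
  have k3 := key 3 (by norm_num)
  have k4 := key 4 (by norm_num)
  have k5 := key 5 (by norm_num)
  have k6 := key 6 (by norm_num)
  simp only [pw, List.getD_cons_zero, List.getD_cons_succ, Nat.testBit, Nat.shiftRight_zero,
    Nat.reduceShiftRight, Nat.reduceAnd, Nat.reduceBNe] at k0 k1 k2 k3 k4 k5 k6
  cases a <;> cases b <;> cases c <;> simp_all [bv]

/-- The list of exponent vectors. -/
def SL : List (Nat × Nat) := [(0,1),(0,2),(0,4),(0,5),(1,1),(1,4),(1,5),(2,0),(2,1),(2,4),
  (3,2),(3,3),(3,5),(4,2),(5,0),(5,5)]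

theorem mem_S (ab : ℕ × ℕ) : ab ∈ S ↔ ab ∈ SL := by
  simp [S, SL]

/-- The code. -/
noncomputable abbrev CS : Submodule F8 (F8ˣ × F8ˣ → F8) := Submodule.span F8 (evalVec '' S)

/-- Point number `k` of the torus. -/
noncomputable def pt (u : F8ˣ) (k : Nat) : F8ˣ × F8ˣ := (u ^ (k / 7), u ^ (k % 7))

/-- The vector `c` is encoded by the packed word `w`. -/
def Enc (u : F8ˣ) (c : F8ˣ × F8ˣ → F8) (w : Nat) : Prop :=
  ∀ k < 49, c (pt u k) = val (u : F8) w k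

theorem Enc_add (u : F8ˣ) {c d : F8ˣ × F8ˣ → F8} {v w : Nat} (h : Enc u c v) (h' : Enc u d w) :
    Enc u (c + d) (v ^^^ w) := by
  intro k hk
  rw [val_xor, Pi.add_apply, h k hk, h' k hk]

theorem Enc_zero (u : F8ˣ) : Enc u 0 0 := by
  intro k hk
  rw [val_zero, Pi.zero_apply]

/-- Check of the generator table. -/
def genOk : Bool :=
  (List.range 16).all fun m => (List.range 3).all fun κ =>
    let g := lin GEN (2 ^ (3 * m + κ))
    let ab := SL.getD m (0, 0)
    (List.range 49).all fun k =>
      let v := pw.getD ((κ + k / 7 * ab.1 + k % 7 * ab.2) % 7) 0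
      (g.testBit k == v.testBit 0) && ((g.testBit (49 + k) == v.testBit 1) &&
        (g.testBit (98 + k) == v.testBit 2))

theorem genOk_true : genOk = true := by decide +kernel

theorem cw_def (K : Nat) : cw K = lin GEN K := by unfold cw; rfl

theorem pow_mod7 (u : F8ˣ) (n : Nat) : (u : F8) ^ (n % 7) = (u : F8) ^ n := by
  have h7 : (u : F8) ^ 7 = 1 := by
    have := congrArg (Units.val) (F8_pow7 u)
    simpa using this
  conv_rhs => rw [← Nat.mod_add_div n 7, pow_add, pow_mul, h7, one_pow, mul_one]

theorem Enc_gen (u : F8ˣ) (hu : (u : F8) ^ 3 = u + 1) (m κ : Nat) (hm : m < 16) (hκ : κ < 3) :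
    Enc u (((u : F8) ^ κ) • evalVec (SL.getD m (0, 0))) (cw (2 ^ (3 * m + κ))) := by
  have h := genOk_true
  simp only [genOk, List.all_eq_true, List.mem_range, Bool.and_eq_true, beq_iff_eq] at h
  have h1 := h m hm κ hκ
  rw [cw_def]
  intro k hk
  obtain ⟨h2, h3, h4⟩ := h1 k hk
  unfold val
  rw [h2, h3, h4, pw_val _ hu _ (Nat.mod_lt _ (by norm_num)), pow_mod7]
  simp only [Pi.smul_apply, smul_eq_mul, evalVec, pt, Units.val_pow_eq_pow_val]
  ring

theorem pow_surj (u : F8ˣ) (hu : (u : F8) ^ 3 = u + 1) (x : F8ˣ) : ∃ i < 7, u ^ i = x := by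
  have hne : u ≠ 1 := by
    intro h
    rw [h] at hu
    simp at hu
  have ho : orderOf u = 7 := by
    have : Fact (Nat.Prime 7) := ⟨by norm_num⟩
    exact orderOf_eq_prime (F8_pow7 u) hne
  have : Finite F8ˣ := Nat.finite_of_card_ne_zero (by rw [F8_units_card]; norm_num)
  have hx : x ∈ Subgroup.zpowers u := by
    have : Subgroup.zpowers u = ⊤ := by
      apply Subgroup.eq_top_of_card_eq
      rw [Nat.card_zpowers, ho, F8_units_card]
    rw [this]; trivial
  classical
  rw [mem_zpowers_iff_mem_range_orderOf, ho] at hx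
  simpa using hx

theorem elt_cases (u : F8ˣ) (hu : (u : F8) ^ 3 = u + 1) (a : F8) :
    ∃ b₀ b₁ b₂ : Bool, a = bv b₀ + bv b₁ * u + bv b₂ * (u : F8) ^ 2 := by
  by_cases ha : a = 0
  · exact ⟨false, false, false, by simp [bv, ha]⟩
  · obtain ⟨i, hi, h⟩ := pow_surj u hu (Units.mk0 a ha)
    refine ⟨_, _, _, (?_ : a = _ ).trans (pw_val _ hu i hi).symm⟩
    have := congrArg Units.val h
    simpa using this.symm

theorem lt48 (m κ : Nat) (hm : m < 16) (hκ : κ < 3) : 2 ^ (3 * m + κ) < 2 ^ 48 :=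
  Nat.pow_lt_pow_right (by norm_num) (by omega)

/-- Vectors encoded by words of the packed code. -/
def TT (u : F8ˣ) (c : F8ˣ × F8ˣ → F8) : Prop := ∃ K < 2 ^ 48, Enc u c (cw K)

theorem TT_zero (u : F8ˣ) : TT u 0 :=
  ⟨0, by norm_num, by rw [XH_cw.zero]; exact Enc_zero u⟩

theorem TT_add (u : F8ˣ) {c d : F8ˣ × F8ˣ → F8} (hc : TT u c) (hd : TT u d) : TT u (c + d) := by
  obtain ⟨K, hK, h⟩ := hc
  obtain ⟨L, hL, h'⟩ := hd
  exact ⟨K ^^^ L, Nat.xor_lt_two_pow hK hL, by rw [XH_cw]; exact Enc_add u h h'⟩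

theorem TT_bv (u : F8ˣ) {c : F8ˣ × F8ˣ → F8} (hc : TT u c) (b : Bool) : TT u (bv b • c) := by
  cases b
  · simpa [bv] using TT_zero u
  · simpa [bv] using hc

theorem TT_gen (u : F8ˣ) (hu : (u : F8) ^ 3 = u + 1) (a : F8) (ab : ℕ × ℕ) (h : ab ∈ SL) :
    TT u (a • evalVec ab) := by
  obtain ⟨m, hm, rfl⟩ := List.mem_iff_getElem.1 h
  have hm' : m < 16 := hm
  have e : SL[m]'hm = SL.getD m (0, 0) := (List.getD_eq_getElem _ _ hm).symm
  rw [e]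
  obtain ⟨b₀, b₁, b₂, rfl⟩ := elt_cases u hu a
  have key : ∀ κ < 3, TT u (((u : F8) ^ κ) • evalVec (SL.getD m (0, 0))) := fun κ hκ =>
    ⟨_, lt48 m κ hm' hκ, Enc_gen u hu m κ hm' hκ⟩
  have h0 := TT_bv u (key 0 (by norm_num)) b₀
  have h1 := TT_bv u (key 1 (by norm_num)) b₁
  have h2 := TT_bv u (key 2 (by norm_num)) b₂
  have := TT_add u (TT_add u h0 h1) h2
  simpa only [add_smul, mul_smul, pow_zero, one_smul, pow_one] using this

theorem TT_span (u : F8ˣ) (hu : (u : F8) ^ 3 = u + 1) (c : F8ˣ × F8ˣ → F8) (hc : c ∈ CS) :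
    TT u c := by
  have key : ∀ a : F8, TT u (a • c) := by
    induction hc using Submodule.span_induction with
    | mem x hx =>
      intro a
      obtain ⟨ab, hab, rfl⟩ := hx
      exact TT_gen u hu a ab ((mem_S ab).1 hab)
    | zero => intro a; rw [smul_zero]; exact TT_zero u
    | add x y _ _ hx hy => intro a; rw [smul_add]; exact TT_add u (hx a) (hy a)
    | smul b x _ hx => intro a; rw [smul_smul]; exact hx _
  simpa using key 1

theorem span_enc (u : F8ˣ) (hu : (u : F8) ^ 3 = u + 1) (n : Nat) (hn : n ≤ 48) :
    ∀ K < 2 ^ n, ∃ c ∈ CS, Enc u c (cw K) := by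
  induction n with
  | zero =>
    intro K hK
    have : K = 0 := by omega
    subst this
    exact ⟨0, Submodule.zero_mem _, by rw [XH_cw.zero]; exact Enc_zero u⟩
  | succ n ih =>
    intro K hK
    have ih := ih (by omega)
    by_cases hb : K < 2 ^ n
    · exact ih K hb
    · have htb : K.testBit n = true := by
        rw [Nat.testBit_eq_decide_div_mod_eq, decide_eq_true_eq,
          Nat.div_eq_of_lt_le (k := 1) (by omega) (by rw [pow_succ] at hK; omega)]
      have hlt : K ^^^ 2 ^ n < 2 ^ n := by
        apply Nat.lt_pow_two_of_testBit
        intro i hi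
        rw [Nat.testBit_xor, Nat.testBit_two_pow]
        rcases Nat.eq_or_lt_of_le hi with h1 | h1
        · subst h1; simp [htb]
        · have h2 : K.testBit i = false :=
            Nat.testBit_lt_two_pow (lt_of_lt_of_le hK (Nat.pow_le_pow_right (by norm_num) h1))
          have h3 : ¬ n = i := by omega
          simp [h2, h3]
      have hx : (K ^^^ 2 ^ n) ^^^ 2 ^ n = K := by
        rw [Nat.xor_assoc, Nat.xor_self, Nat.xor_zero]
      obtain ⟨c, hc, h⟩ := ih _ hlt
      have hg := Enc_gen u hu (n / 3) (n % 3) (by omega) (Nat.mod_lt _ (by norm_num))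
      rw [Nat.div_add_mod] at hg
      have hmem : SL.getD (n / 3) (0, 0) ∈ SL := by
        rw [List.getD_eq_getElem _ _ (show n / 3 < SL.length by simp [SL]; omega)]
        exact List.getElem_mem _
      have hin : (u : F8) ^ (n % 3) • evalVec (SL.getD (n / 3) (0, 0)) ∈ CS :=
        Submodule.smul_mem _ _ (Submodule.subset_span ⟨_, (mem_S _).2 hmem, rfl⟩)
      exact ⟨_, Submodule.add_mem _ hc hin, by rw [← hx, XH_cw]; exact Enc_add u h hg⟩

theorem pt_bij (u : F8ˣ) (hu : (u : F8) ^ 3 = u + 1) :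
    Function.Bijective (fun k : Fin 49 => pt u k) := by
  have : Finite F8ˣ := Nat.finite_of_card_ne_zero (by rw [F8_units_card]; norm_num)
  rw [Nat.bijective_iff_surjective_and_card]
  constructor
  · rintro ⟨x, y⟩
    obtain ⟨i, hi, rfl⟩ := pow_surj u hu x
    obtain ⟨j, hj, rfl⟩ := pow_surj u hu y
    refine ⟨⟨7 * i + j, by omega⟩, ?_⟩
    have h1 : (7 * i + j) / 7 = i := by omega
    have h2 : (7 * i + j) % 7 = j := by omega
    simp only [pt, h1, h2]
  · simp [Nat.card_prod, F8_units_card]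

theorem Enc_ne (u : F8ˣ) (hu : (u : F8) ^ 3 = u + 1) {c : F8ˣ × F8ˣ → F8} {w : Nat}
    (h : Enc u c w) (k : Nat) (hk : k < 49) : c (pt u k) ≠ 0 ↔ (nz w).testBit k = true := by
  rw [h k hk, testBit_nz w k hk, Ne, val, bits_val _ hu u.ne_zero]
  simp only [Bool.not_eq_false]

theorem wt_bits (w : Nat) : wt w = ∑ k ∈ Finset.range 49, if (nz w).testBit k then 1 else 0 := by
  have hl : ∀ k, lane 1 k (nz w) = if (nz w).testBit k then 1 else 0 := by
    intro k
    rw [lane, Nat.one_mul, pow_one, Nat.testBit_eq_decide_div_mod_eq, Nat.shiftRight_eq_div_pow]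
    rcases Nat.mod_two_eq_zero_or_one (nz w / 2 ^ k) with h | h <;> simp [h]
  unfold wt cnt
  simp only [hl]
  symm
  apply Finset.sum_subset
  · intro x; simp only [Finset.mem_range]; omega
  · intro x _ hx
    simp only [Finset.mem_range, not_lt] at hx
    have : (nz w).testBit x = false :=
      Nat.testBit_lt_two_pow (lt_of_lt_of_le (nz_lt w) (Nat.pow_le_pow_right (by norm_num) hx))
    simp [this]

theorem weight_eq (u : F8ˣ) (hu : (u : F8) ^ 3 = u + 1) {c : F8ˣ × F8ˣ → F8} {w : Nat}
    (h : Enc u c w) : hammingWeight c = wt w := by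
  have e : {k : Fin 49 // (nz w).testBit k = true} ≃ {p : F8ˣ × F8ˣ // c p ≠ 0} :=
    (Equiv.ofBijective _ (pt_bij u hu)).subtypeEquiv (fun k => by
      rw [Equiv.ofBijective_apply]
      exact (Enc_ne u hu h k k.2).symm)
  unfold hammingWeight
  rw [← Nat.card_congr e, wt_bits, Nat.card_eq_fintype_card, Fintype.card_subtype,
    Finset.card_filter, Finset.sum_range]

theorem wt_witness : wt (lin GEN 48423523173159) = 24 := by decide +kernel

/-- The generalised toric code `C_S` over `F₈` has minimum distance exactly 24:
every nonzero codeword has Hamming weight at least 24, and some codeword has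
Hamming weight exactly 24. -/
theorem min_dist :
    (∀ c ∈ Submodule.span F8 (evalVec '' S), c ≠ 0 → 24 ≤ hammingWeight c) ∧
    (∃ c ∈ Submodule.span F8 (evalVec '' S), hammingWeight c = 24) := by
  obtain ⟨u, hu⟩ := exists_alpha
  constructor
  · intro c hc hne
    obtain ⟨K, hK, h⟩ := TT_span u hu c hc
    rw [weight_eq u hu h]
    rcases main_ok K hK with h0 | h0
    · exfalso
      apply hne
      rw [← weight_eq u hu h, hammingWeight] at h0
      have hf : Finite F8ˣ := Nat.finite_of_card_ne_zero (by rw [F8_units_card]; norm_num)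
      rw [Finite.card_eq_zero_iff] at h0
      funext p
      by_contra hp
      exact h0.false ⟨p, hp⟩
    · exact h0
  · obtain ⟨c, hc, h⟩ := span_enc u hu 48 le_rfl 48423523173159 (by norm_num)
    refine ⟨c, hc, ?_⟩
    rw [weight_eq u hu h, cw_def]
    exact wt_witness
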